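/- Let D ⊂ ℂⁿ be a bounded α-regular domain, U ⊂ D an open set with U = ⋃_{j=1}^∞ K_j, where each K_j is compact and K_j ⊂ int(K_{j+1}), and let ψ be a bounded upper semicontinuous function on U with sup_U ψ < 0. Then the sequence ω*_α(z,K_j,D,ψ) decreases pointwise on D to ω*_α(z,U,D,ψ). -/

import Mathlib

open MeasureTheory Filter Topology Complex Metric

noncomputable section

/-- Complex `n`-space. -/
abbrev Cn (n : ℕ) := Fin n → ℂ

/-- The Wirtinger derivative `∂f/∂z_j` of a (real-differentiable) function `f : ℂⁿ → ℂ`. -/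
noncomputable def wdz {n : ℕ} (j : Fin n) (f : Cn n → ℂ) (z : Cn n) : ℂ :=
  (fderiv ℝ f z (Pi.single j 1) - Complex.I * fderiv ℝ f z (Pi.single j Complex.I)) / 2

/-- The Wirtinger derivative `∂f/∂z̄_j` of a (real-differentiable) function `f : ℂⁿ → ℂ`. -/
noncomputable def wdzbar {n : ℕ} (j : Fin n) (f : Cn n → ℂ) (z : Cn n) : ℂ :=
  (fderiv ℝ f z (Pi.single j 1) + Complex.I * fderiv ℝ f z (Pi.single j Complex.I)) / 2

/-- The square of the Euclidean norm `|z|² = ∑ |z_i|²` on `ℂⁿ`. -/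
noncomputable def sqNorm {n : ℕ} (z : Cn n) : ℝ := ∑ i, Complex.normSq (z i)

/-- A closed, strictly positive differential form `α` of bidegree `(n-1, n-1)` with `C¹`
coefficients on `ℂⁿ`, recorded through its normalized coefficient matrix:  `coeff j k` is
the Hermitian positive-definite matrix `A_{jk}` such that
`dd^c u ∧ α = (∑_{j,k} A_{jk} ∂²u/∂z_j∂z̄_k) dV`.  In these terms closedness of `α`
reads `∑_j ∂A_{jk}/∂z_j = 0` for every `k` (the conjugate identity follows by
Hermitian symmetry). -/
structure AlphaForm (n : ℕ) where
  coeff : Fin n → Fin n → Cn n → ℂ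
  contDiff : ∀ j k, ContDiff ℝ 1 (coeff j k)
  hermitian : ∀ j k z, coeff k j z = starRingEnd ℂ (coeff j k z)
  strictlyPositive : ∀ z : Cn n, ∀ ξ : Fin n → ℂ, ξ ≠ 0 →
    0 < (∑ j, ∑ k, coeff j k z * ξ j * starRingEnd ℂ (ξ k)).re
  closed : ∀ k, ∀ z : Cn n, (∑ j, wdz j (coeff j k) z) = 0

/-- The second order operator `f ↦ ∑_{j,k} A_{jk} ∂²f/∂z_j∂z̄_k` representing the
top-degree form `dd^c f ∧ α` (with respect to Lebesgue measure). -/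
noncomputable def alphaOp {n : ℕ} (A : AlphaForm n) (f : Cn n → ℂ) (z : Cn n) : ℂ :=
  ∑ j, ∑ k, A.coeff j k z * wdzbar k (wdz j f) z

/-- The operator `alphaOp` applied to a real-valued function, returning the real part. -/
noncomputable def alphaOpR {n : ℕ} (A : AlphaForm n) (ω : Cn n → ℝ) (z : Cn n) : ℝ :=
  (alphaOp A (fun w => (ω w : ℂ)) z).re

/-- `u : ℂⁿ → EReal` is `α`-subharmonic on `D`: it is finite-or-`-∞`, strongly upper
semicontinuous on `D`, locally integrable on `D`, and the current `dd^c u ∧ α` is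
positive, i.e. `∫_D u · (α ∧ dd^c ω) ≥ 0` for every nonnegative test function `ω` on `D`. -/
def IsAlphaSubharmonicE {n : ℕ} (A : AlphaForm n) (D : Set (Cn n)) (u : Cn n → EReal) : Prop :=
  (∀ z ∈ D, u z ≠ ⊤) ∧
  UpperSemicontinuousOn u D ∧
  (∀ z₀ ∈ D, ∀ S : Set (Cn n),
      (∃ N ∈ 𝓝 z₀, volume (N \ S) = 0) → Filter.limsup u (𝓝[S] z₀) = u z₀) ∧
  LocallyIntegrableOn (fun z => (u z).toReal) D volume ∧
  ∀ ω : Cn n → ℝ, ContDiff ℝ (⊤ : ℕ∞) ω → HasCompactSupport ω → tsupport ω ⊆ D →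
    (∀ z, 0 ≤ ω z) → 0 ≤ ∫ z in D, (u z).toReal * alphaOpR A ω z

/-- A real-valued function is `α`-subharmonic on `D` if it is so as an `EReal`-valued
function. -/
def IsAlphaSubharmonic {n : ℕ} (A : AlphaForm n) (D : Set (Cn n)) (u : Cn n → ℝ) : Prop :=
  IsAlphaSubharmonicE A D (fun z => (u z : EReal))

/-- `h` is `α`-harmonic on the open set `U`: `dd^c h ∧ α = 0` there, in the sense of
currents. -/
def IsAlphaHarmonicOn {n : ℕ} (A : AlphaForm n) (U : Set (Cn n)) (h : Cn n → ℝ) : Prop :=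
  LocallyIntegrableOn h U volume ∧
  ∀ ω : Cn n → ℝ, ContDiff ℝ (⊤ : ℕ∞) ω → HasCompactSupport ω → tsupport ω ⊆ U →
    (∫ z in U, h z * alphaOpR A ω z) = 0

/-- `u` is strictly `α`-subharmonic on `G`: for every compact subdomain `G' ⋐ G` there is
`ε > 0` with `u - ε|z|²` `α`-subharmonic on `G'`. -/
def IsStrictlyAlphaSubharmonic {n : ℕ} (A : AlphaForm n) (G : Set (Cn n)) (u : Cn n → ℝ) :
    Prop :=
  ∀ G' : Set (Cn n), IsOpen G' → IsCompact (closure G') → closure G' ⊆ G →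
    ∃ ε > (0 : ℝ), IsAlphaSubharmonic A G' (fun z => u z - ε * sqNorm z)

/-- `D` is a bounded `α`-regular domain: a bounded domain carrying a negative
`α`-subharmonic exhaustion `ρ` with boundary limit `0`. -/
def IsAlphaRegularDomain {n : ℕ} (A : AlphaForm n) (D : Set (Cn n)) : Prop :=
  IsOpen D ∧ IsConnected D ∧ Bornology.IsBounded D ∧
  ∃ ρ : Cn n → ℝ, IsAlphaSubharmonic A D ρ ∧ (∀ z ∈ D, ρ z < 0) ∧
    ∀ ζ ∈ frontier D, Filter.Tendsto ρ (𝓝[D] ζ) (𝓝 0)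

/-- `D` is a strongly `α`-regular domain: `D = {ρ < 0}` for some `ρ` which is `C²` and
strictly `α`-subharmonic on a neighborhood `D⁺` of `closure D`. -/
def IsStronglyAlphaRegularDomain {n : ℕ} (A : AlphaForm n) (D : Set (Cn n)) : Prop :=
  IsOpen D ∧ IsConnected D ∧ Bornology.IsBounded D ∧
  ∃ Dp : Set (Cn n), IsOpen Dp ∧ closure D ⊆ Dp ∧
    ∃ ρ : Cn n → ℝ, ContDiffOn ℝ 2 ρ Dp ∧ IsStrictlyAlphaSubharmonic A Dp ρ ∧
      D = {z ∈ Dp | ρ z < 0}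

/-- The class `U(E, D, ψ)` of `α`-subharmonic functions `u` on `D` with `u ≤ ψ` on `E`
and `u < 0` on `D`. -/
def Uclass {n : ℕ} (A : AlphaForm n) (E D : Set (Cn n)) (ψ : Cn n → ℝ) :
    Set (Cn n → ℝ) :=
  {u | IsAlphaSubharmonic A D u ∧ (∀ z ∈ E, u z ≤ ψ z) ∧ ∀ z ∈ D, u z < 0}

/-- The weighted extremal function `ω_α(z, E, D, ψ)`. -/
noncomputable def omegaW {n : ℕ} (A : AlphaForm n) (E D : Set (Cn n)) (ψ : Cn n → ℝ)
    (z : Cn n) : ℝ :=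
  sSup ((fun u : Cn n → ℝ => u z) '' Uclass A E D ψ)

/-- The weighted `α`-subharmonic measure `ω*_α(z, E, D, ψ)`: the upper semicontinuous
regularization of `ω_α(·, E, D, ψ)`. -/
noncomputable def omegaWStar {n : ℕ} (A : AlphaForm n) (E D : Set (Cn n)) (ψ : Cn n → ℝ)
    (z : Cn n) : ℝ :=
  Filter.limsup (omegaW A E D ψ) (𝓝 z)

/-- The (unweighted) extremal function `ω_α(z, E, D)`. -/
noncomputable def omega0 {n : ℕ} (A : AlphaForm n) (E D : Set (Cn n)) : Cn n → ℝ :=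
  omegaW A E D (fun _ => (-1 : ℝ))

/-- The (unweighted) `α`-subharmonic measure `ω*_α(z, E, D)`. -/
noncomputable def omega0Star {n : ℕ} (A : AlphaForm n) (E D : Set (Cn n)) : Cn n → ℝ :=
  omegaWStar A E D (fun _ => (-1 : ℝ))

/-- `S` is `α`-polar in `D`: there is an `α`-subharmonic `ρ` on `D`, not identically
`-∞`, with `ρ = -∞` on `S`. -/
def IsAlphaPolar {n : ℕ} (A : AlphaForm n) (D S : Set (Cn n)) : Prop :=
  ∃ ρ : Cn n → EReal, IsAlphaSubharmonicE A D ρ ∧ (∃ z ∈ D, ρ z ≠ ⊥) ∧ ∀ z ∈ S, ρ z = ⊥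

/-- `u` is plurisubharmonic on `D`: upper semicontinuous, locally integrable, and with
positive semidefinite complex Hessian in the sense of distributions. -/
def IsPlurisubharmonic {n : ℕ} (D : Set (Cn n)) (u : Cn n → ℝ) : Prop :=
  UpperSemicontinuousOn u D ∧ LocallyIntegrableOn u D volume ∧
  ∀ ξ : Fin n → ℂ, ∀ ω : Cn n → ℝ, ContDiff ℝ (⊤ : ℕ∞) ω → HasCompactSupport ω →
    tsupport ω ⊆ D → (∀ z, 0 ≤ ω z) →
    0 ≤ ∫ z in D, u z *
      (∑ j, ∑ k, ξ j * starRingEnd ℂ (ξ k) * wdzbar k (wdz j (fun w => (ω w : ℂ))) z).re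

/-- The class `U(E,D)` for the plurisubharmonic measure. -/
def UclassPsh {n : ℕ} (E D : Set (Cn n)) : Set (Cn n → ℝ) :=
  {u | IsPlurisubharmonic D u ∧ (∀ z ∈ E, u z ≤ -1) ∧ ∀ z ∈ D, u z < 0}

/-- The plurisubharmonic extremal function `ω(z, E, D)`. -/
noncomputable def omegaPsh {n : ℕ} (E D : Set (Cn n)) (z : Cn n) : ℝ :=
  sSup ((fun u : Cn n → ℝ => u z) '' UclassPsh E D)

/-- The plurisubharmonic measure `ω*(z, E, D)`. -/
noncomputable def omegaPshStar {n : ℕ} (E D : Set (Cn n)) (z : Cn n) : ℝ :=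
  Filter.limsup (omegaPsh E D) (𝓝 z)

end

open MeasureTheory Filter Topology Complex Metric
set_option linter.unusedSectionVars false
set_option linter.unusedVariables false

/-- A symmetric positive definite divergence free second order operator in coordinates. -/
structure Ell (n : ℕ) (E ι : Type) [NormedAddCommGroup E] [NormedSpace ℝ E]
    [Fintype ι] where
  b : Module.Basis ι ℝ E
  c : ι → ι → E → ℝ
  hc : ∀ i j, ContDiff ℝ 1 (c i j)
  symm : ∀ i j z, c i j z = c j i z
  pos : ∀ z (ξ : ι → ℝ), ξ ≠ 0 → 0 < ∑ i, ∑ j, c i j z * ξ i * ξ j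
  div : ∀ j z, ∑ i, fderiv ℝ (c i j) z (b i) = 0
  card : Fintype.card ι = 2 * n
  hn : 1 ≤ n

namespace Ell

variable {n : ℕ} {E ι : Type} [NormedAddCommGroup E] [NormedSpace ℝ E]
  [FiniteDimensional ℝ E] [Fintype ι] [DecidableEq ι]

/-- coordinates -/
noncomputable def co (L : Ell n E ι) (i : ι) : E →L[ℝ] ℝ :=
  LinearMap.toContinuousLinearMap (L.b.coord i)

/-- The operator. -/
noncomputable def op (L : Ell n E ι) (f : E → ℝ) (x : E) : ℝ :=
  ∑ i, ∑ j, L.c i j x * fderiv ℝ (fun x' => fderiv ℝ f x' (L.b j)) x (L.b i)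

/-- coefficient matrix -/
noncomputable def cm (L : Ell n E ι) (z : E) : Matrix ι ι ℝ := Matrix.of fun i j => L.c i j z

/-- inverse matrix -/
noncomputable def Bm (L : Ell n E ι) (z : E) : Matrix ι ι ℝ := (L.cm z)⁻¹

noncomputable def By (L : Ell n E ι) (z y : E) (i : ι) : ℝ := ∑ j, L.Bm z i j * L.co j y

noncomputable def Q (L : Ell n E ι) (z y : E) : ℝ := ∑ i, L.By z y i * L.co i y

noncomputable def a4 (L : Ell n E ι) (x z y : E) : ℝ :=
  ∑ i, ∑ j, L.c i j x * L.By z y i * L.By z y j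

noncomputable def tau (L : Ell n E ι) (x z : E) : ℝ := ∑ i, ∑ j, L.c i j x * L.Bm z i j

variable (L : Ell n E ι)

lemma co_b (i j : ι) : L.co i (L.b j) = if i = j then 1 else 0 := by
  simp [co, Finsupp.single_apply, eq_comm]

lemma cm_posDef (z : E) : (L.cm z).PosDef := by
  apply Matrix.PosDef.of_dotProduct_mulVec_pos
  · ext i j
    simp [cm, Matrix.conjTranspose, L.symm i j]
  · intro x hx
    have := L.pos z x hx
    refine this.trans_eq ?_
    simp only [dotProduct, Matrix.mulVec, cm, Finset.mul_sum]
    refine Finset.sum_congr rfl fun i _ => Finset.sum_congr rfl fun j _ => ?_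
    change _ = x i * (L.c i j z * x j)
    ring

lemma Bm_posDef (z : E) : (L.Bm z).PosDef := (L.cm_posDef z).inv

lemma Bm_symm (z : E) (i j : ι) : L.Bm z i j = L.Bm z j i := by
  have := (L.Bm_posDef z).isHermitian
  have := congrFun (congrFun this j) i
  simpa [Matrix.conjTranspose] using this

lemma cm_det_ne (z : E) : (L.cm z).det ≠ 0 := (L.cm_posDef z).det_pos.ne'

lemma cm_mul_Bm (z : E) : L.cm z * L.Bm z = 1 :=
  Matrix.mul_nonsing_inv _ (isUnit_iff_ne_zero.2 (L.cm_det_ne z))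

lemma sum_c_Bm (z : E) (i k : ι) : ∑ j, L.c i j z * L.Bm z j k = if i = k then 1 else 0 := by
  have := congrFun (congrFun (L.cm_mul_Bm z) i) k
  simpa [Matrix.mul_apply, cm, Matrix.one_apply] using this

lemma tau_self (z : E) : L.tau z z = 2 * n := by
  unfold tau
  have : ∀ i, ∑ j, L.c i j z * L.Bm z i j = 1 := by
    intro i
    have := L.sum_c_Bm z i i
    simp only [if_true] at this
    rw [← this]
    exact Finset.sum_congr rfl fun j _ => by rw [L.Bm_symm z i j]
  simp [this, L.card]

lemma a4_self (z y : E) : L.a4 z z y = L.Q z y := by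
  unfold a4 Q
  refine Finset.sum_congr rfl fun i _ => ?_
  have : ∑ j, L.c i j z * L.By z y j = L.co i y := by
    unfold By
    simp only [Finset.mul_sum]
    rw [Finset.sum_comm]
    have : ∀ k, ∑ j, L.c i j z * (L.Bm z j k * L.co k y) = (if i = k then 1 else 0) * L.co k y := by
      intro k
      rw [← L.sum_c_Bm z i k, Finset.sum_mul]
      exact Finset.sum_congr rfl fun j _ => by ring
    simp [this]
  rw [← this, Finset.mul_sum]
  exact Finset.sum_congr rfl fun j _ => by ring

lemma Q_pos (z y : E) (hy : y ≠ 0) : 0 < L.Q z y := by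
  have h : (fun i => L.co i y) ≠ 0 := by
    intro h
    apply hy
    apply L.b.ext_elem
    intro i
    have := congrFun h i
    simpa [co] using this
  have := (L.Bm_posDef z).dotProduct_mulVec_pos h
  refine this.trans_eq ?_
  simp only [Q, By, dotProduct, Matrix.mulVec]
  refine Finset.sum_congr rfl fun i _ => ?_
  change L.co i y * _ = _
  ring

lemma contDiff_det (M : E → Matrix ι ι ℝ) (h : ∀ i j, ContDiff ℝ 1 fun z => M z i j) :
    ContDiff ℝ 1 fun z => (M z).det := by
  simp only [Matrix.det_apply]
  refine ContDiff.sum fun σ _ => ?_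
  exact (contDiff_prod fun i _ => h _ _).const_smul _

lemma contDiff_Bm (i j : ι) : ContDiff ℝ 1 fun z => L.Bm z i j := by
  have h1 : ContDiff ℝ 1 fun z => (L.cm z).det := contDiff_det _ fun i j => L.hc i j
  have h2 : ContDiff ℝ 1 fun z => (L.cm z).adjugate i j := by
    simp only [Matrix.adjugate_apply]
    apply contDiff_det
    intro k l
    by_cases hk : k = j
    · subst hk
      simp [contDiff_const]
    · simp only [Matrix.updateRow_ne hk]
      exact L.hc k l
  have : (fun z => L.Bm z i j) = fun z => ((L.cm z).det)⁻¹ * (L.cm z).adjugate i j := by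
    ext z
    simp [Bm, Matrix.inv_def]
  rw [this]
  exact (h1.inv L.cm_det_ne).mul h2

lemma By_add (z y y' : E) (i : ι) : L.By z (y + y') i = L.By z y i + L.By z y' i := by
  simp [By, mul_add, Finset.sum_add_distrib]

lemma By_smul (z : E) (a : ℝ) (y : E) (i : ι) : L.By z (a • y) i = a * L.By z y i := by
  simp only [By, Finset.mul_sum, map_smul, smul_eq_mul]
  exact Finset.sum_congr rfl fun j _ => by ring

lemma By_neg (z y : E) (i : ι) : L.By z (-y) i = - L.By z y i := by
  simp [By]

lemma Q_smul (z : E) (a : ℝ) (y : E) : L.Q z (a • y) = a ^ 2 * L.Q z y := by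
  simp only [Q, Finset.mul_sum, By_smul, map_smul, smul_eq_mul]
  exact Finset.sum_congr rfl fun j _ => by ring

lemma Q_neg (z y : E) : L.Q z (-y) = L.Q z y := by simp [Q, By_neg]

lemma a4_neg (x z y : E) : L.a4 x z (-y) = L.a4 x z y := by simp [a4, By_neg]

lemma Q_nonneg (z y : E) : 0 ≤ L.Q z y := by
  by_cases hy : y = 0
  · simp [hy, Q]
  · exact (L.Q_pos z y hy).le

/-- The bounds package. -/
structure Bd (R C : ℝ) : Prop where
  one : 1 ≤ C
  lowQ : ∀ z y, ‖z‖ ≤ R → ‖y‖ ^ 2 ≤ C * L.Q z y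
  upQ : ∀ z y, ‖z‖ ≤ R → L.Q z y ≤ C * ‖y‖ ^ 2
  a4 : ∀ x z y, ‖x‖ ≤ R → ‖z‖ ≤ R → |L.a4 x z y - L.Q z y| ≤ C * ‖x - z‖ * ‖y‖ ^ 2
  tau : ∀ x z, ‖x‖ ≤ R → ‖z‖ ≤ R → |L.tau x z - 2 * n| ≤ C * ‖x - z‖
  Qz : ∀ x z y, ‖x‖ ≤ R → ‖z‖ ≤ R → |L.Q x y - L.Q z y| ≤ C * ‖x - z‖ * ‖y‖ ^ 2
  By : ∀ z y i, ‖z‖ ≤ R → |L.By z y i| ≤ C * ‖y‖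
  Byz : ∀ x z y i, ‖x‖ ≤ R → ‖z‖ ≤ R → |L.By x y i - L.By z y i| ≤ C * ‖x - z‖ * ‖y‖
  c : ∀ x i j, ‖x‖ ≤ R → |L.c i j x| ≤ C

lemma lip_of_contDiff (R : ℝ) (f : E → ℝ) (hf : ContDiff ℝ 1 f) :
    ∃ M, 1 ≤ M ∧ (∀ z, ‖z‖ ≤ R → |f z| ≤ M) ∧
      ∀ x z, ‖x‖ ≤ R → ‖z‖ ≤ R → |f x - f z| ≤ M * ‖x - z‖ := by
  have hK : IsCompact (closedBall (0 : E) R) := isCompact_closedBall 0 R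
  obtain ⟨M1, h1⟩ := hK.exists_bound_of_continuousOn hf.continuous.continuousOn
  obtain ⟨M2, h2⟩ := hK.exists_bound_of_continuousOn
    (hf.continuous_fderiv (by norm_num)).continuousOn
  refine ⟨max 1 (max M1 M2), le_max_left _ _, fun z hz => ?_, fun x z hx hz => ?_⟩
  · exact (h1 z (by simpa using hz)).trans ((le_max_left _ _).trans (le_max_right _ _))
  · have := (convex_closedBall (0 : E) R).norm_image_sub_le_of_norm_fderiv_le (𝕜 := ℝ) (f := f)
      (fun x _ => (hf.differentiable (by norm_num)) x) h2 (x := z) (y := x)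
      (by simpa using hz) (by simpa using hx)
    refine this.trans ?_
    gcongr
    exact (le_max_right _ _).trans (le_max_right _ _)

lemma exists_unif (R : ℝ) (f : ι → ι → E → ℝ) (hf : ∀ i j, ContDiff ℝ 1 (f i j)) :
    ∃ M, 1 ≤ M ∧ ∀ i j, (∀ z, ‖z‖ ≤ R → |f i j z| ≤ M) ∧
      ∀ x z, ‖x‖ ≤ R → ‖z‖ ≤ R → |f i j x - f i j z| ≤ M * ‖x - z‖ := by
  choose M h1 h2 h3 using fun i j => lip_of_contDiff R (f i j) (hf i j)
  have hle : ∀ i j, M i j ≤ 1 + ∑ i, ∑ j, M i j := by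
    intro i j
    have a : M i j ≤ ∑ j, M i j :=
      Finset.single_le_sum (f := fun j => M i j) (fun k _ => by linarith [h1 i k])
        (Finset.mem_univ j)
    have b : ∑ j, M i j ≤ ∑ i, ∑ j, M i j :=
      Finset.single_le_sum (f := fun i => ∑ j, M i j)
        (fun k _ => Finset.sum_nonneg fun l _ => by linarith [h1 k l])
        (Finset.mem_univ i)
    linarith
  refine ⟨1 + ∑ i, ∑ j, M i j, ?_, fun i j => ⟨fun z hz => (h2 i j z hz).trans (hle i j),
    fun x z hx hz => (h3 i j x z hx hz).trans ?_⟩⟩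
  · have : 0 ≤ ∑ i, ∑ j, M i j :=
      Finset.sum_nonneg fun k _ => Finset.sum_nonneg fun l _ => by linarith [h1 k l]
    linarith
  · gcongr
    exact hle i j

lemma co_bound : ∃ M, 1 ≤ M ∧ ∀ i y, |L.co i y| ≤ M * ‖y‖ := by
  refine ⟨1 + ∑ i, ‖L.co i‖, ?_, fun i y => ?_⟩
  · have : 0 ≤ ∑ i, ‖L.co i‖ := Finset.sum_nonneg fun _ _ => norm_nonneg _
    linarith
  · refine ((L.co i).le_opNorm y).trans ?_
    gcongr
    have : ‖L.co i‖ ≤ ∑ i, ‖L.co i‖ :=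
      Finset.single_le_sum (f := fun j => ‖L.co j‖) (fun k _ => norm_nonneg _)
        (Finset.mem_univ i)
    linarith

lemma cont_Bm (i j : ι) : Continuous fun z => L.Bm z i j := (L.contDiff_Bm i j).continuous
lemma cont_c (i j : ι) : Continuous (L.c i j) := (L.hc i j).continuous

lemma cont_By (i : ι) : Continuous fun p : E × E => L.By p.1 p.2 i := by
  unfold By
  refine continuous_finsetSum _ fun j _ => ?_
  exact ((L.cont_Bm i j).comp continuous_fst).mul ((L.co j).continuous.comp continuous_snd)

lemma cont_Q : Continuous fun p : E × E => L.Q p.1 p.2 := by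
  unfold Q
  exact continuous_finsetSum _ fun j _ => (L.cont_By j).mul
    ((L.co j).continuous.comp continuous_snd)

lemma cont_a4 : Continuous fun p : E × E × E => L.a4 p.1 p.2.1 p.2.2 := by
  unfold a4
  refine continuous_finsetSum _ fun i _ => continuous_finsetSum _ fun j _ => ?_
  exact (((L.cont_c i j).comp continuous_fst).mul ((L.cont_By i).comp continuous_snd)).mul
    ((L.cont_By j).comp continuous_snd)

lemma cont_tau : Continuous fun p : E × E => L.tau p.1 p.2 := by
  unfold tau
  refine continuous_finsetSum _ fun i _ => continuous_finsetSum _ fun j _ => ?_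
  exact ((L.cont_c i j).comp continuous_fst).mul ((L.cont_Bm i j).comp continuous_snd)

lemma lowQ_exists (R : ℝ) : ∃ C, 1 ≤ C ∧ ∀ z y, ‖z‖ ≤ R → ‖y‖ ^ 2 ≤ C * L.Q z y := by
  by_cases hne : (closedBall (0 : E) R ×ˢ sphere (0 : E) 1).Nonempty
  · have hK : IsCompact (closedBall (0 : E) R ×ˢ sphere (0 : E) 1) :=
      (isCompact_closedBall 0 R).prod (isCompact_sphere 0 1)
    obtain ⟨p, hp, hmin⟩ := hK.exists_isMinOn hne L.cont_Q.continuousOn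
    have hpos : 0 < L.Q p.1 p.2 := by
      apply L.Q_pos
      intro h
      have := hp.2
      simp [h] at this
    refine ⟨max 1 (L.Q p.1 p.2)⁻¹, le_max_left _ _, fun z y hz => ?_⟩
    by_cases hy : y = 0
    · simp [hy, Q]
    have hy' : 0 < ‖y‖ := norm_pos_iff.2 hy
    have h1 : L.Q p.1 p.2 ≤ L.Q z (‖y‖⁻¹ • y) := by
      have := hmin (show (z, ‖y‖⁻¹ • y) ∈ _ from ⟨by simpa using hz, by
        simp [norm_smul, hy'.ne']⟩)
      simpa using this
    rw [Q_smul] at h1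
    have h2 : L.Q p.1 p.2 * ‖y‖ ^ 2 ≤ L.Q z y := by
      have := mul_le_mul_of_nonneg_right h1 (sq_nonneg ‖y‖)
      refine this.trans (le_of_eq ?_)
      field_simp
    calc ‖y‖ ^ 2 = (L.Q p.1 p.2)⁻¹ * (L.Q p.1 p.2 * ‖y‖ ^ 2) := by field_simp
      _ ≤ (L.Q p.1 p.2)⁻¹ * L.Q z y := by gcongr
      _ ≤ _ := by
        gcongr
        · exact L.Q_nonneg z y
        · exact le_max_right _ _
  · refine ⟨1, le_rfl, fun z y hz => ?_⟩
    by_cases hy : y = 0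
    · simp [hy, Q]
    · exfalso
      apply hne
      exact ⟨(z, ‖y‖⁻¹ • y), by simpa using hz, by
        simp [norm_smul, (norm_pos_iff.2 hy).ne']⟩

lemma abs_sum_le_card (f : ι → ℝ) (M : ℝ) (h : ∀ i, |f i| ≤ M) :
    |∑ i, f i| ≤ Fintype.card ι * M := by
  refine (Finset.abs_sum_le_sum_abs _ _).trans ?_
  refine (Finset.sum_le_sum fun i _ => h i).trans ?_
  simp

lemma Bd.mono {R C C' : ℝ} (h : L.Bd R C) (hC : C ≤ C') : L.Bd R C' where
  one := h.one.trans hC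
  lowQ z y hz := (h.lowQ z y hz).trans (by gcongr; exact L.Q_nonneg z y)
  upQ z y hz := (h.upQ z y hz).trans (by gcongr)
  a4 x z y hx hz := (h.a4 x z y hx hz).trans (by gcongr)
  tau x z hx hz := (h.tau x z hx hz).trans (by gcongr)
  Qz x z y hx hz := (h.Qz x z y hx hz).trans (by gcongr)
  By z y i hz := (h.By z y i hz).trans (by gcongr)
  Byz x z y i hx hz := (h.Byz x z y i hx hz).trans (by gcongr)
  c x i j hx := (h.c x i j hx).trans hC

lemma exists_Bd (R : ℝ) : ∃ C, L.Bd R C := by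
  obtain ⟨Mc, hMc, Hc⟩ := exists_unif R L.c L.hc
  obtain ⟨MB, hMB, HB⟩ := exists_unif R (fun i j z => L.Bm z i j) L.contDiff_Bm
  obtain ⟨Mo, hMo, Ho⟩ := L.co_bound
  obtain ⟨Ml, hMl, Hl⟩ := L.lowQ_exists R
  set k : ℝ := (Fintype.card ι : ℝ) with hk
  have hk0 : 0 ≤ k := by positivity
  have hBy : ∀ z y i, ‖z‖ ≤ R → |L.By z y i| ≤ k * (MB * (Mo * ‖y‖)) := by
    intro z y i hz
    apply abs_sum_le_card
    intro j
    rw [abs_mul]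
    gcongr
    · exact (HB i j).1 z hz
    · exact Ho j y
  have hByz : ∀ x z y i, ‖x‖ ≤ R → ‖z‖ ≤ R →
      |L.By x y i - L.By z y i| ≤ k * ((MB * ‖x - z‖) * (Mo * ‖y‖)) := by
    intro x z y i hx hz
    have : L.By x y i - L.By z y i = ∑ j, (L.Bm x i j - L.Bm z i j) * L.co j y := by
      simp [By, sub_mul, Finset.sum_sub_distrib]
    rw [this]
    apply abs_sum_le_card
    intro j
    rw [abs_mul]
    gcongr
    · exact (HB i j).2 x z hx hz
    · exact Ho j y
  have hQz : ∀ x z y, ‖x‖ ≤ R → ‖z‖ ≤ R →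
      |L.Q x y - L.Q z y| ≤ k * ((k * ((MB * ‖x - z‖) * (Mo * ‖y‖))) * (Mo * ‖y‖)) := by
    intro x z y hx hz
    have : L.Q x y - L.Q z y = ∑ j, (L.By x y j - L.By z y j) * L.co j y := by
      simp [Q, sub_mul, Finset.sum_sub_distrib]
    rw [this]
    apply abs_sum_le_card
    intro j
    rw [abs_mul]
    gcongr
    · exact hByz x z y j hx hz
    · exact Ho j y
  have hupQ : ∀ z y, ‖z‖ ≤ R → L.Q z y ≤ k * ((k * (MB * (Mo * ‖y‖))) * (Mo * ‖y‖)) := by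
    intro z y hz
    refine (le_abs_self _).trans ?_
    apply abs_sum_le_card
    intro j
    rw [abs_mul]
    gcongr
    · exact hBy z y j hz
    · exact Ho j y
  have ha4 : ∀ x z y, ‖x‖ ≤ R → ‖z‖ ≤ R → |L.a4 x z y - L.Q z y| ≤
      k * (k * ((Mc * ‖x - z‖) * (k * (MB * (Mo * ‖y‖))) * (k * (MB * (Mo * ‖y‖))))) := by
    intro x z y hx hz
    rw [← L.a4_self z y]
    have : L.a4 x z y - L.a4 z z y
        = ∑ i, ∑ j, (L.c i j x - L.c i j z) * L.By z y i * L.By z y j := by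
      simp only [Ell.a4, sub_mul, Finset.sum_sub_distrib]
    rw [this]
    apply abs_sum_le_card
    intro i
    apply abs_sum_le_card
    intro j
    rw [abs_mul, abs_mul]
    gcongr
    · exact (Hc i j).2 x z hx hz
    · exact hBy z y i hz
    · exact hBy z y j hz
  have htau : ∀ x z, ‖x‖ ≤ R → ‖z‖ ≤ R → |L.tau x z - 2 * n| ≤
      k * (k * ((Mc * ‖x - z‖) * MB)) := by
    intro x z hx hz
    rw [← L.tau_self z]
    have : L.tau x z - L.tau z z
        = ∑ i, ∑ j, (L.c i j x - L.c i j z) * L.Bm z i j := by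
      simp only [Ell.tau, sub_mul, Finset.sum_sub_distrib]
    rw [this]
    apply abs_sum_le_card
    intro i
    apply abs_sum_le_card
    intro j
    rw [abs_mul]
    gcongr
    · exact (Hc i j).2 x z hx hz
    · exact (HB i j).1 z hz
  have e : ∀ M : ℝ, M ≤ |M| := le_abs_self
  let C := 1 + |Ml| + |k * k * MB * Mo * Mo| + |k ^ 4 * Mc * MB ^ 2 * Mo ^ 2| + |k * k * Mc * MB|
    + |k * MB * Mo| + |Mc|
  have c1 : Ml ≤ C := by
    have := abs_nonneg (k * k * MB * Mo * Mo); have := abs_nonneg (k ^ 4 * Mc * MB ^ 2 * Mo ^ 2)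
    have := abs_nonneg (k * k * Mc * MB); have := abs_nonneg (k * MB * Mo)
    have := abs_nonneg Mc; have := e Ml
    simp only [C]; linarith
  have c2 : k * k * MB * Mo * Mo ≤ C := by
    have := e (k * k * MB * Mo * Mo); have := abs_nonneg (k ^ 4 * Mc * MB ^ 2 * Mo ^ 2)
    have := abs_nonneg (k * k * Mc * MB); have := abs_nonneg (k * MB * Mo)
    have := abs_nonneg Mc; have := abs_nonneg Ml
    simp only [C]; linarith
  have c3 : k ^ 4 * Mc * MB ^ 2 * Mo ^ 2 ≤ C := by
    have := abs_nonneg (k * k * MB * Mo * Mo); have := e (k ^ 4 * Mc * MB ^ 2 * Mo ^ 2)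
    have := abs_nonneg (k * k * Mc * MB); have := abs_nonneg (k * MB * Mo)
    have := abs_nonneg Mc; have := abs_nonneg Ml
    simp only [C]; linarith
  have c4 : k * k * Mc * MB ≤ C := by
    have := abs_nonneg (k * k * MB * Mo * Mo); have := abs_nonneg (k ^ 4 * Mc * MB ^ 2 * Mo ^ 2)
    have := e (k * k * Mc * MB); have := abs_nonneg (k * MB * Mo)
    have := abs_nonneg Mc; have := abs_nonneg Ml
    simp only [C]; linarith
  have c5 : k * MB * Mo ≤ C := by
    have := abs_nonneg (k * k * MB * Mo * Mo); have := abs_nonneg (k ^ 4 * Mc * MB ^ 2 * Mo ^ 2)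
    have := abs_nonneg (k * k * Mc * MB); have := e (k * MB * Mo)
    have := abs_nonneg Mc; have := abs_nonneg Ml
    simp only [C]; linarith
  have c6 : Mc ≤ C := by
    have := abs_nonneg (k * k * MB * Mo * Mo); have := abs_nonneg (k ^ 4 * Mc * MB ^ 2 * Mo ^ 2)
    have := abs_nonneg (k * k * Mc * MB); have := abs_nonneg (k * MB * Mo)
    have := e Mc; have := abs_nonneg Ml
    simp only [C]; linarith
  refine ⟨C, ?_, ?_, ?_, ?_, ?_, ?_, ?_, ?_, ?_⟩
  · have := abs_nonneg (k * k * MB * Mo * Mo); have := abs_nonneg (k ^ 4 * Mc * MB ^ 2 * Mo ^ 2)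
    have := abs_nonneg (k * k * Mc * MB); have := abs_nonneg (k * MB * Mo)
    have := abs_nonneg Mc; have := abs_nonneg Ml
    simp only [C]; linarith
  · intro z y hz
    exact (Hl z y hz).trans (mul_le_mul_of_nonneg_right c1 (L.Q_nonneg z y))
  · intro z y hz
    refine (hupQ z y hz).trans ?_
    calc _ = (k * k * MB * Mo * Mo) * ‖y‖ ^ 2 := by ring
      _ ≤ _ := by gcongr
  · intro x z y hx hz
    refine (ha4 x z y hx hz).trans ?_
    calc _ = (k ^ 4 * Mc * MB ^ 2 * Mo ^ 2) * ‖x - z‖ * ‖y‖ ^ 2 := by ring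
      _ ≤ _ := by gcongr
  · intro x z hx hz
    refine (htau x z hx hz).trans ?_
    calc _ = (k * k * Mc * MB) * ‖x - z‖ := by ring
      _ ≤ _ := by gcongr
  · intro x z y hx hz
    refine (hQz x z y hx hz).trans ?_
    calc _ = (k * k * MB * Mo * Mo) * ‖x - z‖ * ‖y‖ ^ 2 := by ring
      _ ≤ _ := by gcongr
  · intro z y i hz
    refine (hBy z y i hz).trans ?_
    calc _ = (k * MB * Mo) * ‖y‖ := by ring
      _ ≤ _ := by gcongr
  · intro x z y i hx hz
    refine (hByz x z y i hx hz).trans ?_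
    calc _ = (k * MB * Mo) * ‖x - z‖ * ‖y‖ := by ring
      _ ≤ _ := by gcongr
  · intro x i j hx
    exact ((Hc i j).1 x hx).trans c6

end Ell

namespace Ell

/-- profile -/
noncomputable def q (s : ℝ) : ℝ := expNegInvGlue (1 - s)

/-- minus derivative of profile -/
noncomputable def q1 (s : ℝ) : ℝ := ((1 - s)⁻¹) ^ 2 * expNegInvGlue (1 - s)

lemma q_nonneg (s : ℝ) : 0 ≤ q s := expNegInvGlue.nonneg _
lemma q1_nonneg (s : ℝ) : 0 ≤ q1 s := mul_nonneg (sq_nonneg _) (expNegInvGlue.nonneg _)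
lemma q_zero {s : ℝ} (h : 1 ≤ s) : q s = 0 := expNegInvGlue.zero_of_nonpos (by linarith)
lemma q1_zero {s : ℝ} (h : 1 ≤ s) : q1 s = 0 := by
  simp [q1, expNegInvGlue.zero_of_nonpos (show 1 - s ≤ 0 by linarith)]

lemma q_le_one (s : ℝ) : q s ≤ 1 := by
  unfold q expNegInvGlue
  split_ifs with h
  · norm_num
  · apply Real.exp_le_one_iff.2
    have := inv_pos.2 (not_le.1 h)
    linarith

lemma q_le_q1 {s : ℝ} (h : 0 ≤ s) : q s ≤ q1 s := by
  by_cases h1 : 1 ≤ s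
  · rw [q_zero h1, q1_zero h1]
  · unfold q q1
    have h2 : 0 < 1 - s := by linarith
    have : 1 ≤ (1 - s)⁻¹ := (one_le_inv₀ h2).2 (by linarith)
    have : 1 ≤ ((1 - s)⁻¹) ^ 2 := one_le_pow₀ this
    nlinarith [expNegInvGlue.nonneg (1 - s)]

lemma q_smooth : ContDiff ℝ (⊤ : ℕ∞) q :=
  expNegInvGlue.contDiff.comp (contDiff_const.sub contDiff_id)

lemma q1_smooth : ContDiff ℝ (⊤ : ℕ∞) q1 := by
  have := expNegInvGlue.contDiff_polynomial_eval_inv_mul (n := (⊤ : ℕ∞))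
    (Polynomial.X ^ 2 : Polynomial ℝ)
  have := this.comp (contDiff_const.sub contDiff_id : ContDiff ℝ (⊤ : ℕ∞) fun s : ℝ => 1 - s)
  have e : q1 = (fun x => Polynomial.eval x⁻¹ (Polynomial.X ^ 2 : Polynomial ℝ) *
      expNegInvGlue x) ∘ fun x => 1 - x := by
    ext s
    simp [q1]
  rw [e]
  exact this

lemma q_hasDerivAt (s : ℝ) : HasDerivAt q (-q1 s) s := by
  have := expNegInvGlue.hasDerivAt_polynomial_eval_inv_mul (1 : Polynomial ℝ) (1 - s)
  have h2 : HasDerivAt (fun s : ℝ => 1 - s) (-1) s := by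
    simpa using (hasDerivAt_id s).const_sub 1
  have := HasDerivAt.comp s this h2
  refine (this.congr_deriv ?_).congr_of_eventuallyEq ?_
  · simp [q1]
  · filter_upwards with y
    simp [q, Function.comp]

lemma lip_of_smooth (f : ℝ → ℝ) (hf : ContDiff ℝ (⊤ : ℕ∞) f) (h0 : ∀ s, 1 ≤ s → f s = 0) :
    ∃ M, 1 ≤ M ∧ (∀ s, 0 ≤ s → |f s| ≤ M) ∧
      ∀ s t, 0 ≤ s → 0 ≤ t → |f s - f t| ≤ M * |s - t| := by
  have hK : IsCompact (Set.Icc (0 : ℝ) 1) := isCompact_Icc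
  obtain ⟨M1, h1⟩ := hK.exists_bound_of_continuousOn hf.continuous.continuousOn
  obtain ⟨M2, h2⟩ := hK.exists_bound_of_continuousOn
    (hf.continuous_deriv (by norm_num)).continuousOn
  have hl : ∀ s t, s ∈ Set.Icc (0 : ℝ) 1 → t ∈ Set.Icc (0 : ℝ) 1 →
      |f s - f t| ≤ M2 * |s - t| := fun s t hs ht =>
    (convex_Icc (0 : ℝ) 1).norm_image_sub_le_of_norm_deriv_le (𝕜 := ℝ) (f := f)
      (fun x _ => (hf.differentiable (by norm_num)) x) h2 ht hs
  have hM2 : 0 ≤ M2 := (norm_nonneg _).trans (h2 0 (by simp))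
  have hl' : ∀ s t, 0 ≤ s → s ≤ t → |f s - f t| ≤ M2 * |s - t| := by
    intro s t hs hst
    by_cases ht : t ≤ 1
    · exact hl s t ⟨hs, hst.trans ht⟩ ⟨hs.trans hst, ht⟩
    · push Not at ht
      by_cases hs1 : s ≤ 1
      · rw [h0 t ht.le, ← h0 1 le_rfl]
        refine (hl s 1 ⟨hs, hs1⟩ (by simp)).trans ?_
        refine mul_le_mul_of_nonneg_left ?_ hM2
        rw [abs_of_nonpos (by linarith), abs_of_nonpos (by linarith)]
        linarith
      · rw [h0 t ht.le, h0 s (by linarith)]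
        simp; positivity
  refine ⟨max 1 (max M1 M2), le_max_left _ _, fun s hs => ?_, fun s t hs ht => ?_⟩
  · by_cases hs1 : s ≤ 1
    · exact (h1 s ⟨hs, hs1⟩).trans ((le_max_left _ _).trans (le_max_right _ _))
    · rw [h0 s (by linarith)]
      simp
  · have : M2 ≤ max 1 (max M1 M2) := (le_max_right _ _).trans (le_max_right _ _)
    rcases le_total s t with h | h
    · exact (hl' s t hs h).trans (by gcongr)
    · rw [abs_sub_comm, abs_sub_comm s t]
      exact (hl' t s ht h).trans (by gcongr)

/-- constants for the profile -/
lemma q_consts : ∃ M, 1 ≤ M ∧ (∀ s, 0 ≤ s → q1 s ≤ M) ∧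
    (∀ s t, 0 ≤ s → 0 ≤ t → |q1 s - q1 t| ≤ M * |s - t|) ∧
    (∀ s t, 0 ≤ s → 0 ≤ t → |q s - q t| ≤ M * |s - t|) ∧
    (∀ s, 0 ≤ s → s ≤ 1 / 2 → M⁻¹ ≤ q1 s) := by
  obtain ⟨M1, h1, h2, h3⟩ := lip_of_smooth q1 q1_smooth fun s hs => q1_zero hs
  obtain ⟨M2, k1, k2, k3⟩ := lip_of_smooth q q_smooth fun s hs => q_zero hs
  refine ⟨M1 + M2 + Real.exp 2, ?_, ?_, ?_, ?_, ?_⟩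
  · have := Real.exp_pos 2; linarith
  · intro s hs
    have := h2 s hs
    have := le_abs_self (q1 s)
    have := Real.exp_pos 2; linarith
  · intro s t hs ht
    refine (h3 s t hs ht).trans ?_
    gcongr
    have := Real.exp_pos 2; linarith
  · intro s t hs ht
    refine (k3 s t hs ht).trans ?_
    gcongr
    have := Real.exp_pos 2; linarith
  · intro s hs hs2
    refine le_trans ?_ (q_le_q1 hs)
    have : (M1 + M2 + Real.exp 2)⁻¹ ≤ (Real.exp 2)⁻¹ := by
      gcongr
      linarith
    refine this.trans ?_
    unfold q expNegInvGlue
    rw [if_neg (by linarith), ← Real.exp_neg]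
    apply Real.exp_le_exp.2
    have h4 : 0 < 1 - s := by linarith
    have : (1 - s)⁻¹ ≤ 2 := by
      rw [inv_le_comm₀ h4 (by norm_num)]; linarith
    linarith

/-- first derivative of radial function -/
noncomputable def hd (n : ℕ) (r t : ℝ) : ℝ := -((t ^ n)⁻¹ * q (√t / r))

/-- second derivative of radial function -/
noncomputable def hdd (n : ℕ) (r t : ℝ) : ℝ :=
  (t ^ (n + 1))⁻¹ * (n * q (√t / r) + √t / (2 * r) * q1 (√t / r))

lemma hd_hasDerivAt (n : ℕ) {r t : ℝ} (hr : 0 < r) (ht : 0 < t) :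
    HasDerivAt (hd n r) (hdd n r t) t := by
  have hs : 0 < √t := Real.sqrt_pos.2 ht
  have h1 : HasDerivAt (fun t : ℝ => √t / r) (1 / (2 * √t) / r) t :=
    ((hasDerivAt_id t).sqrt ht.ne').div_const r
  have h2 := HasDerivAt.comp t (q_hasDerivAt (√t / r)) h1
  have h3 : HasDerivAt (fun t : ℝ => (t ^ n)⁻¹) (-(n * t ^ (n - 1)) / (t ^ n) ^ 2) t :=
    (hasDerivAt_pow n t).inv (pow_pos ht n).ne'
  have h4 := (h3.mul h2).neg
  refine (h4.congr_deriv ?_)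
  simp only [hdd, Function.comp]
  have : t = √t ^ 2 := (Real.sq_sqrt ht.le).symm
  set σ := √t
  rw [this]
  rcases n with _ | n
  · simp; field_simp
  · simp only [Nat.add_sub_cancel]
    push_cast
    field_simp
    ring

end Ell

namespace Ell

variable {n : ℕ} {E ι : Type} [NormedAddCommGroup E] [NormedSpace ℝ E]
  [FiniteDimensional ℝ E] [Fintype ι] [DecidableEq ι]

/-- the mean value kernel -/
noncomputable def ker (L : Ell n E ι) (r : ℝ) (z x : E) : ℝ :=
  4 * hdd n r (L.Q z (x - z)) * L.a4 x z (x - z) + 2 * hd n r (L.Q z (x - z)) * L.tau x z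

/-- model singularity -/
noncomputable def kap (n : ℕ) (y : E) : ℝ := (‖y‖ ^ (2 * n - 1))⁻¹

lemma kap_nonneg (n : ℕ) (y : E) : 0 ≤ kap n y := by unfold kap; positivity

lemma kap_neg (n : ℕ) (y : E) : kap n (-y) = kap n y := by simp [kap]

lemma kap_zero (hn : 1 ≤ n) : kap n (0 : E) = 0 := by
  have : 2 * n - 1 ≠ 0 := by omega
  simp [kap, this]

/-- frozen kernel -/
noncomputable def m0 (n : ℕ) (r σ : ℝ) : ℝ := 2 * (σ ^ (2 * n - 1))⁻¹ * q1 (σ / r) / r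

lemma m0_nonneg {r σ : ℝ} (hr : 0 < r) (hσ : 0 ≤ σ) : 0 ≤ m0 n r σ := by
  unfold m0
  have := q1_nonneg (σ / r)
  positivity

lemma ker_scalar (hn : 1 ≤ n) {r σ A a4 tau : ℝ} (hr : 0 < r) (hσ : 0 < σ)
    (h1 : |a4 - σ ^ 2| ≤ A * σ ^ 3) (h2 : |tau - 2 * n| ≤ A * σ) :
    |4 * hdd n r (σ ^ 2) * a4 + 2 * hd n r (σ ^ 2) * tau - m0 n r σ|
      ≤ A * (2 * n + 2) * r * m0 n r σ := by
  have hA : 0 ≤ A := by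
    have := (abs_nonneg _).trans h2
    by_contra h
    push Not at h
    nlinarith
  by_cases hσr : r ≤ σ
  · have : 1 ≤ σ / r := (one_le_div hr).2 hσr
    simp [hdd, hd, m0, Real.sqrt_sq hσ.le, q_zero this, q1_zero this]
  push Not at hσr
  obtain ⟨k, rfl⟩ : ∃ k, n = k + 1 := ⟨n - 1, by omega⟩
  have e : 4 * hdd (k + 1) r (σ ^ 2) * a4 + 2 * hd (k + 1) r (σ ^ 2) * tau - m0 (k + 1) r σ
      = m0 (k + 1) r σ * ((a4 - σ ^ 2) / σ ^ 2)
        + (σ ^ (2 * (k + 1)))⁻¹ * q (σ / r) *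
          (4 * (k + 1) * ((a4 - σ ^ 2) / σ ^ 2) - 2 * (tau - 2 * ((k + 1 : ℕ) : ℝ))) := by
    simp only [hdd, hd, m0, Real.sqrt_sq hσ.le]
    have : 2 * (k + 1) - 1 = 2 * k + 1 := by omega
    rw [this]
    push_cast
    field_simp
    ring
  have hm0 := m0_nonneg (n := k + 1) hr hσ.le
  have hq := q_nonneg (σ / r)
  have hqq : q (σ / r) ≤ q1 (σ / r) := q_le_q1 (by positivity)
  have b1 : |(a4 - σ ^ 2) / σ ^ 2| ≤ A * σ := by
    rw [abs_div, abs_of_pos (by positivity : 0 < σ ^ 2), div_le_iff₀ (by positivity)]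
    linarith [h1, show A * σ * σ ^ 2 = A * σ ^ 3 by ring]
  have b2 : |4 * (k + 1) * ((a4 - σ ^ 2) / σ ^ 2) - 2 * (tau - 2 * ((k + 1 : ℕ) : ℝ))|
      ≤ (4 * (k + 1) + 2) * (A * σ) := by
    refine (abs_sub _ _).trans ?_
    rw [abs_mul (4 * ((k : ℝ) + 1)), abs_mul 2, abs_of_pos (by positivity : (0 : ℝ) < 4 * (k + 1)),
      abs_of_pos (by positivity : (0 : ℝ) < 2), add_mul]
    gcongr
  have b3 : (σ ^ (2 * (k + 1)))⁻¹ * q (σ / r) * σ ≤ m0 (k + 1) r σ * r / 2 := by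
    have : m0 (k + 1) r σ * r / 2 = (σ ^ (2 * (k + 1)))⁻¹ * q1 (σ / r) * σ := by
      simp only [m0]
      have : 2 * (k + 1) - 1 = 2 * k + 1 := by omega
      rw [this]
      field_simp
      ring
    rw [this]
    gcongr
  rw [e]
  refine (abs_add_le _ _).trans ?_
  rw [abs_mul, abs_mul, abs_of_nonneg hm0,
    abs_of_nonneg (by positivity : 0 ≤ (σ ^ (2 * (k + 1)))⁻¹ * q (σ / r))]
  calc _ ≤ m0 (k + 1) r σ * (A * r)
        + (σ ^ (2 * (k + 1)))⁻¹ * q (σ / r) * ((4 * (k + 1) + 2) * (A * σ)) := by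
        gcongr
        exact b1.trans (by gcongr)
    _ = m0 (k + 1) r σ * (A * r)
        + (4 * (k + 1) + 2) * A * ((σ ^ (2 * (k + 1)))⁻¹ * q (σ / r) * σ) := by ring
    _ ≤ m0 (k + 1) r σ * (A * r) + (4 * (k + 1) + 2) * A * (m0 (k + 1) r σ * r / 2) := by
        gcongr
    _ = _ := by push_cast; ring

lemma inv_pow_sub {N : ℕ} {C k s t δ : ℝ} (hk : 0 < k) (hC : 1 ≤ C)
    (hs : k ≤ C * s) (hs' : s ≤ C * k) (ht : k ≤ C * t) (ht' : t ≤ C * k) (hδ : |s - t| ≤ δ) :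
    |(s ^ (N + 1))⁻¹ - (t ^ (N + 1))⁻¹| ≤ (N + 1) * C ^ (3 * N + 2) * δ * k⁻¹ * (k ^ (N + 1))⁻¹ := by
  have hC0 : 0 < C := by linarith
  have hs0 : 0 < s := by
    by_contra h
    push Not at h
    nlinarith
  have ht0 : 0 < t := by
    by_contra h
    push Not at h
    nlinarith
  have hδ0 : 0 ≤ δ := (abs_nonneg _).trans hδ
  have e : (s ^ (N + 1))⁻¹ - (t ^ (N + 1))⁻¹
      = (t ^ (N + 1) - s ^ (N + 1)) * ((s ^ (N + 1))⁻¹ * (t ^ (N + 1))⁻¹) := by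
    field_simp
  have h1 := abs_pow_sub_pow_le t s (N + 1)
  have i1 : ∀ u : ℝ, 0 < u → k ≤ C * u → (u ^ (N + 1))⁻¹ ≤ C ^ (N + 1) * (k ^ (N + 1))⁻¹ := by
    intro u hu h
    rw [← div_eq_mul_inv, ← div_pow, ← inv_pow]
    gcongr
    rw [inv_le_comm₀ hu (by positivity), inv_div, div_le_iff₀ hC0]
    linarith
  rw [e, abs_mul, abs_of_nonneg (by positivity : 0 ≤ (s ^ (N + 1))⁻¹ * (t ^ (N + 1))⁻¹)]
  calc _ ≤ (|t - s| * (N + 1 : ℕ) * max |t| |s| ^ (N + 1 - 1)) *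
        ((C ^ (N + 1) * (k ^ (N + 1))⁻¹) * (C ^ (N + 1) * (k ^ (N + 1))⁻¹)) := by
        gcongr
        · exact i1 s hs0 hs
        · exact i1 t ht0 ht
    _ ≤ (δ * (N + 1 : ℕ) * (C * k) ^ N) *
        ((C ^ (N + 1) * (k ^ (N + 1))⁻¹) * (C ^ (N + 1) * (k ^ (N + 1))⁻¹)) := by
        rw [Nat.add_sub_cancel]
        gcongr
        · rw [abs_sub_comm]; exact hδ
        · rw [abs_of_pos ht0, abs_of_pos hs0]
          exact max_le ht' hs'
    _ = _ := by
        push_cast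
        field_simp
        ring

/-- Kernel bounds -/
structure KB (L : Ell n E ι) (R C r0 : ℝ) : Prop where
  one : 1 ≤ C
  r0pos : 0 < r0
  zero : ∀ r x z, 0 < r → ‖z‖ ≤ R → C * r ≤ ‖x - z‖ → L.ker r z x = 0
  nonneg : ∀ r x z, 0 < r → r ≤ r0 → ‖x‖ ≤ R → ‖z‖ ≤ R → 0 ≤ L.ker r z x
  up : ∀ r x z, 0 < r → r ≤ r0 → ‖x‖ ≤ R → ‖z‖ ≤ R → L.ker r z x ≤ C / r * kap n (x - z)
  low : ∀ r x z, 0 < r → r ≤ r0 → ‖x‖ ≤ R → ‖z‖ ≤ R → ‖x - z‖ ≤ r / C →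
    kap n (x - z) / (C * r) ≤ L.ker r z x
  diff : ∀ r x z, 0 < r → r ≤ r0 → ‖x‖ ≤ R → ‖z‖ ≤ R →
    |L.ker r z x - L.ker r x z| ≤ C * kap n (x - z)

variable (L : Ell n E ι)

lemma Bd.sig_le {R C : ℝ} (h : L.Bd R C) (z y : E) (hz : ‖z‖ ≤ R) : √(L.Q z y) ≤ C * ‖y‖ := by
  have h1 := h.upQ z y hz
  have h2 := h.one
  apply Real.sqrt_le_iff.2
  refine ⟨by positivity, h1.trans ?_⟩
  rw [mul_pow]
  gcongr
  nlinarith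

lemma Bd.le_sig {R C : ℝ} (h : L.Bd R C) (z y : E) (hz : ‖z‖ ≤ R) : ‖y‖ ≤ C * √(L.Q z y) := by
  have h1 := h.lowQ z y hz
  have h2 := h.one
  apply abs_le_of_sq_le_sq' _ (by positivity) |>.2
  rw [mul_pow, Real.sq_sqrt (L.Q_nonneg z y)]
  refine h1.trans ?_
  have := L.Q_nonneg z y
  gcongr
  nlinarith

lemma ker_self (r : ℝ) (z : E) : L.ker r z z = 0 := by
  have : L.Q z (z - z) = 0 := by simp [Q]
  have hn0 : n ≠ 0 := by have := L.hn; omega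
  unfold ker
  rw [this]
  simp [hdd, hd, hn0]

set_option maxHeartbeats 1000000 in
lemma exists_KB (R : ℝ) : ∃ C r0, L.KB R C r0 := by
  obtain ⟨C, hB⟩ := L.exists_Bd R
  obtain ⟨M, hM1, hM2, hM3, hM4, hM5⟩ := q_consts
  have hn := L.hn
  have hC := hB.one
  have hC0 : 0 < C := by linarith
  obtain ⟨N, hN⟩ : ∃ N, 2 * n - 1 = N + 1 := ⟨2 * n - 2, by omega⟩
  -- frozen bounds
  set A := C ^ 4 with hA
  set A1 := A * (2 * n + 2) with hA1
  have hA1p : 0 < A1 := by positivity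
  have hA' : C ≤ C ^ 2 := by nlinarith
  -- approx of ker by m0
  have key : ∀ r x z, 0 < r → ‖x‖ ≤ R → ‖z‖ ≤ R → x ≠ z →
      |L.ker r z x - m0 n r √(L.Q z (x - z))| ≤ A1 * r * m0 n r √(L.Q z (x - z)) := by
    intro r x z hr hx hz hxz
    have hy : x - z ≠ 0 := sub_ne_zero.2 hxz
    have hQ := L.Q_pos z _ hy
    set σ := √(L.Q z (x - z)) with hσ
    have hσ0 : 0 < σ := Real.sqrt_pos.2 hQ
    have hσ2 : L.Q z (x - z) = σ ^ 2 := (Real.sq_sqrt hQ.le).symm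
    have hk := hB.le_sig L z (x - z) hz
    rw [← hσ] at hk
    have h1 : |L.a4 x z (x - z) - σ ^ 2| ≤ A * σ ^ 3 := by
      rw [← hσ2]
      refine (hB.a4 x z _ hx hz).trans ?_
      calc C * ‖x - z‖ * ‖x - z‖ ^ 2 ≤ C * (C * σ) * (C * σ) ^ 2 := by gcongr
        _ = _ := by ring
    have h2 : |L.tau x z - 2 * n| ≤ A * σ := by
      refine (hB.tau x z hx hz).trans ?_
      calc C * ‖x - z‖ ≤ C * (C * σ) := by gcongr
        _ = C ^ 2 * σ := by ring
        _ ≤ C ^ 4 * σ := by gcongr; norm_num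
    have := ker_scalar hn hr hσ0 h1 h2
    unfold ker
    rw [hσ2]
    exact this
  have kapup : ∀ z y, ‖z‖ ≤ R → y ≠ 0 → (√(L.Q z y) ^ (N + 1))⁻¹ ≤ C ^ (N + 1) * kap n y := by
    intro z y hz hy
    have hk := hB.le_sig L z y hz
    have hσ0 : 0 < √(L.Q z y) := Real.sqrt_pos.2 (L.Q_pos z y hy)
    have : 0 < ‖y‖ := norm_pos_iff.2 hy
    unfold kap
    rw [hN, ← div_eq_mul_inv, ← div_pow, ← inv_pow]
    gcongr
    rw [inv_le_comm₀ hσ0 (by positivity), inv_div, div_le_iff₀ hC0]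
    linarith
  have kaplow : ∀ z y, ‖z‖ ≤ R → y ≠ 0 → kap n y ≤ C ^ (N + 1) * (√(L.Q z y) ^ (N + 1))⁻¹ := by
    intro z y hz hy
    have hk := hB.sig_le L z y hz
    have hσ0 : 0 < √(L.Q z y) := Real.sqrt_pos.2 (L.Q_pos z y hy)
    have : 0 < ‖y‖ := norm_pos_iff.2 hy
    unfold kap
    rw [hN, ← div_eq_mul_inv, ← div_pow, ← inv_pow]
    gcongr
    rw [inv_le_comm₀ this (by positivity), inv_div, div_le_iff₀ hC0]
    linarith
  have m0up : ∀ r z y, 0 < r → ‖z‖ ≤ R → y ≠ 0 →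
      m0 n r √(L.Q z y) ≤ 2 * C ^ (N + 1) * M / r * kap n y := by
    intro r z y hr hz hy
    unfold m0
    rw [hN]
    calc _ ≤ 2 * (C ^ (N + 1) * kap n y) * M / r := by
          have := kapup z y hz hy
          have := hM2 (√(L.Q z y) / r) (by positivity)
          have := q1_nonneg (√(L.Q z y) / r)
          have := kap_nonneg n y
          gcongr
      _ = _ := by ring
  have ker_self : ∀ r z, L.ker r z z = 0 := by
    intro r z
    exact L.ker_self r z
  set K3 := 2 * M * ((N + 1) * C ^ (3 * N + 2) * C ^ 3 + C ^ (N + 1) * C ^ 4) +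
    4 * A1 * C ^ (N + 1) * M with hK3
  set C' := 2 + C + 4 * C ^ (N + 1) * M + K3 with hC'
  have hK3p : 0 ≤ K3 := by positivity
  have hpp : 0 ≤ C ^ (N + 1) * M := by positivity
  have r0p : 0 < (2 * A1)⁻¹ := by positivity
  have half : ∀ r, 0 < r → r ≤ (2 * A1)⁻¹ → A1 * r ≤ 1 / 2 := by
    intro r hr h
    calc A1 * r ≤ A1 * (2 * A1)⁻¹ := by gcongr
      _ = 1 / 2 := by field_simp
  refine ⟨C', (2 * A1)⁻¹, ?_, r0p, ?_, ?_, ?_, ?_, ?_⟩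
  · simp only [hC']; linarith
  · intro r x z hr hz h
    have hk := hB.sig_le L z (x - z) hz
    have hk' := hB.le_sig L z (x - z) hz
    have : 1 ≤ √(L.Q z (x - z)) / r := by
      rw [one_le_div hr]
      have : C * r ≤ C * √(L.Q z (x - z)) := by
        refine le_trans ?_ (h.trans hk')
        gcongr
        simp only [hC']; linarith
      exact le_of_mul_le_mul_left this hC0
    simp [ker, hd, hdd, q_zero this, q1_zero this]
  · intro r x z hr hr0 hx hz
    by_cases hxz : x = z
    · rw [hxz, ker_self]
    have h1 := key r x z hr hx hz hxz
    have h2 := m0_nonneg (n := n) hr (Real.sqrt_nonneg (L.Q z (x - z)))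
    have h3 := half r hr hr0
    have := abs_le.1 h1
    nlinarith
  · intro r x z hr hr0 hx hz
    by_cases hxz : x = z
    · rw [hxz, ker_self, sub_self, kap_zero hn]; simp
    have h1 := key r x z hr hx hz hxz
    have h2 := m0_nonneg (n := n) hr (Real.sqrt_nonneg (L.Q z (x - z)))
    have h3 := half r hr hr0
    have h4 := (abs_le.1 h1).2
    have h5 := m0up r z (x - z) hr hz (sub_ne_zero.2 hxz)
    have : L.ker r z x ≤ 2 * m0 n r √(L.Q z (x - z)) := by nlinarith
    refine this.trans ?_
    calc _ ≤ 2 * (2 * C ^ (N + 1) * M / r * kap n (x - z)) := by gcongr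
      _ = 4 * C ^ (N + 1) * M / r * kap n (x - z) := by ring
      _ ≤ _ := by
        have := kap_nonneg n (x - z)
        gcongr
        simp only [hC']; linarith
  · intro r x z hr hr0 hx hz hle
    by_cases hxz : x = z
    · rw [hxz, ker_self, sub_self, kap_zero hn]; simp
    have h1 := key r x z hr hx hz hxz
    have h2 := m0_nonneg (n := n) hr (Real.sqrt_nonneg (L.Q z (x - z)))
    have h3 := half r hr hr0
    have h4 := (abs_le.1 h1).1
    have h5 := kaplow z (x - z) hz (sub_ne_zero.2 hxz)
    have h6 : m0 n r √(L.Q z (x - z)) / 2 ≤ L.ker r z x := by nlinarith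
    refine le_trans ?_ h6
    have hC'p : 0 < C' := by simp only [hC']; linarith
    have h7 : √(L.Q z (x - z)) / r ≤ 1 / 2 := by
      rw [div_le_iff₀ hr]
      refine (hB.sig_le L z _ hz).trans ?_
      have : C * C ≤ C ^ (N + 1) * M * C := by
        have : C ≤ C ^ (N + 1) * M := by
          calc C = C ^ 1 * 1 := by ring
            _ ≤ _ := by gcongr; omega
        gcongr
      have : 2 * C ≤ C' := by
        have : C ≤ C ^ (N + 1) * M := by
          calc C = C ^ 1 * 1 := by ring
            _ ≤ _ := by gcongr; omega
        simp only [hC']; linarith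
      calc C * ‖x - z‖ ≤ C * (r / C') := by gcongr
        _ = (C / C') * r := by ring
        _ ≤ 1 / 2 * r := by
          refine mul_le_mul_of_nonneg_right ?_ hr.le
          rw [div_le_iff₀ hC'p]; linarith
    have h8 := hM5 _ (by positivity) h7
    have e1 : m0 n r √(L.Q z (x - z)) / 2
      = (√(L.Q z (x - z)) ^ (N + 1))⁻¹ * q1 (√(L.Q z (x - z)) / r) / r := by
      unfold m0; rw [hN]; ring
    rw [e1]
    calc kap n (x - z) / (C' * r)
        ≤ (C ^ (N + 1) * (√(L.Q z (x - z)) ^ (N + 1))⁻¹) / (C' * r) := by gcongr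
      _ ≤ (C ^ (N + 1) * (√(L.Q z (x - z)) ^ (N + 1))⁻¹) / ((C ^ (N + 1) * M) * r) := by
        gcongr
        simp only [hC']; linarith
      _ = (√(L.Q z (x - z)) ^ (N + 1))⁻¹ * M⁻¹ / r := by field_simp
      _ ≤ _ := by gcongr
  · intro r x z hr hr0 hx hz
    by_cases hxz : x = z
    · rw [hxz, ker_self]; simp [kap_nonneg]
      have : 0 ≤ C' := by simp only [hC']; linarith
      exact mul_nonneg this (kap_nonneg _ _)
    have hy := sub_ne_zero.2 hxz
    have h1 := key r x z hr hx hz hxz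
    have h2 := key r z x hr hz hx (Ne.symm hxz)
    have eQ : L.Q x (z - x) = L.Q x (x - z) := by rw [← L.Q_neg, neg_sub]
    rw [eQ] at h2
    have u1 := m0up r z (x - z) hr hz hy
    have u2 := m0up r x (x - z) hr hx hy
    set y := x - z with hydef
    set k := ‖y‖ with hk
    have hkp : 0 < k := norm_pos_iff.2 hy
    set σ := √(L.Q z y) with hσ
    set σ' := √(L.Q x y) with hσ'
    have hkap := kap_nonneg n y
    -- difference of sigmas
    have s1 := hB.sig_le L z y hz
    have s2 := hB.le_sig L z y hz
    have s3 := hB.sig_le L x y hx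
    have s4 := hB.le_sig L x y hx
    rw [← hσ, ← hk] at s1 s2
    rw [← hσ', ← hk] at s3 s4
    have hσp : 0 < σ := Real.sqrt_pos.2 (L.Q_pos z y hy)
    have hσp' : 0 < σ' := Real.sqrt_pos.2 (L.Q_pos x y hy)
    have dσ : |σ - σ'| ≤ C ^ 2 * k ^ 2 := by
      have := hB.Qz x z y hx hz
      rw [← Real.sq_sqrt (L.Q_nonneg x y), ← Real.sq_sqrt (L.Q_nonneg z y), ← hσ, ← hσ',
        ← hydef, ← hk] at this
      have e : σ' ^ 2 - σ ^ 2 = (σ' - σ) * (σ' + σ) := by ring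
      rw [e, abs_mul, abs_of_pos (by positivity : 0 < σ' + σ)] at this
      have h3 : k / C ≤ σ' + σ := by
        rw [div_le_iff₀ hC0]
        have := mul_pos hσp' hC0
        linarith [s2, add_mul σ' σ C, mul_comm C σ]
      have h4 : |σ' - σ| * (k / C) ≤ C * k * k ^ 2 := by
        refine le_trans ?_ this
        gcongr
      rw [abs_sub_comm]
      have h5 : |σ' - σ| * (k / C) ≤ (C ^ 2 * k ^ 2) * (k / C) := by
        refine h4.trans (le_of_eq ?_)
        field_simp
      exact le_of_mul_le_mul_right h5 (by positivity)
    have main : |m0 n r σ - m0 n r σ'| ≤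
        2 * M * ((N + 1) * C ^ (3 * N + 2) * C ^ 3 + C ^ (N + 1) * C ^ 4) * kap n y := by
      by_cases hkr : k ≤ C * r
      · have d1 := inv_pow_sub (N := N) hkp hC s2 s1 s4 s3 dσ
        have d2 := hM3 (σ / r) (σ' / r) (by positivity) (by positivity)
        have d3 : |σ / r - σ' / r| ≤ C ^ 2 * k ^ 2 / r := by
          rw [← sub_div, abs_div, abs_of_pos hr]; gcongr
        have e : m0 n r σ - m0 n r σ' = 2 / r * (((σ ^ (N + 1))⁻¹ - (σ' ^ (N + 1))⁻¹) * q1 (σ / r)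
            + (σ' ^ (N + 1))⁻¹ * (q1 (σ / r) - q1 (σ' / r))) := by
          unfold m0; rw [hN]; ring
        have kk := kapup x y hx hy
        rw [← hσ'] at kk
        have hkapdef : (k ^ (N + 1))⁻¹ = kap n y := by unfold kap; rw [hN]
        rw [hkapdef] at d1
        rw [e, abs_mul, abs_of_pos (by positivity : 0 < 2 / r)]
        have h6 : |((σ ^ (N + 1))⁻¹ - (σ' ^ (N + 1))⁻¹) * q1 (σ / r)
            + (σ' ^ (N + 1))⁻¹ * (q1 (σ / r) - q1 (σ' / r))|
            ≤ ((N + 1) * C ^ (3 * N + 2) * (C ^ 2 * k ^ 2) * k⁻¹ * kap n y) * M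
              + (C ^ (N + 1) * kap n y) * (M * (C ^ 2 * k ^ 2 / r)) := by
          refine (abs_add_le _ _).trans ?_
          rw [abs_mul, abs_mul, abs_of_nonneg (q1_nonneg (σ / r)),
            abs_of_pos (by positivity : 0 < (σ' ^ (N + 1))⁻¹)]
          have := q1_nonneg (σ / r)
          gcongr
          · exact hM2 _ (by positivity)
          · exact d2.trans (by gcongr)
        have h7 : k ^ 2 * k⁻¹ ≤ C * r := by
          rw [pow_two, mul_assoc, mul_inv_cancel₀ hkp.ne', mul_one]; exact hkr
        have h8 : k ^ 2 / r ≤ C ^ 2 * r := by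
          rw [div_le_iff₀ hr]
          calc k ^ 2 ≤ (C * r) ^ 2 := by gcongr
            _ = _ := by ring
        calc _ ≤ 2 / r * (((N + 1) * C ^ (3 * N + 2) * (C ^ 2 * k ^ 2) * k⁻¹ * kap n y) * M
              + (C ^ (N + 1) * kap n y) * (M * (C ^ 2 * k ^ 2 / r))) := by gcongr
          _ = 2 / r * (((N + 1) * C ^ (3 * N + 2) * (C ^ 2 * (k ^ 2 * k⁻¹)) * kap n y) * M
              + (C ^ (N + 1) * kap n y) * (M * (C ^ 2 * (k ^ 2 / r)))) := by ring
          _ ≤ 2 / r * (((N + 1) * C ^ (3 * N + 2) * (C ^ 2 * (C * r)) * kap n y) * M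
              + (C ^ (N + 1) * kap n y) * (M * (C ^ 2 * (C ^ 2 * r)))) := by gcongr
          _ = _ := by field_simp
      · have : 1 ≤ σ / r := by
          rw [one_le_div hr]
          push Not at hkr
          exact le_of_mul_le_mul_left (hkr.le.trans s2) hC0
        have h' : 1 ≤ σ' / r := by
          rw [one_le_div hr]
          push Not at hkr
          exact le_of_mul_le_mul_left (hkr.le.trans s4) hC0
        simp only [m0, q1_zero this, q1_zero h']
        simp only [mul_zero, zero_div, sub_self, abs_zero]
        positivity
    have t1 : A1 * r * m0 n r σ ≤ 2 * A1 * C ^ (N + 1) * M * kap n y := by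
      calc _ ≤ A1 * r * (2 * C ^ (N + 1) * M / r * kap n y) := by gcongr
        _ = _ := by field_simp
    have t2 : A1 * r * m0 n r σ' ≤ 2 * A1 * C ^ (N + 1) * M * kap n y := by
      calc _ ≤ A1 * r * (2 * C ^ (N + 1) * M / r * kap n y) := by gcongr
        _ = _ := by field_simp
    have fin : |L.ker r z x - L.ker r x z| ≤ K3 * kap n y := by
      have e : L.ker r z x - L.ker r x z = (L.ker r z x - m0 n r σ) + (m0 n r σ - m0 n r σ')
        - (L.ker r x z - m0 n r σ') := by ring
      rw [e]
      refine (abs_sub _ _).trans ?_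
      have := abs_add_le (L.ker r z x - m0 n r σ) (m0 n r σ - m0 n r σ')
      rw [hK3, add_mul]
      linarith
    refine fin.trans ?_
    gcongr
    simp only [hC']; linarith

end Ell

namespace Ell

variable {n : ℕ} {E ι : Type} [NormedAddCommGroup E] [NormedSpace ℝ E]
  [FiniteDimensional ℝ E] [Fintype ι] [DecidableEq ι] [MeasurableSpace E] [BorelSpace E]
  (μ : Measure E) [μ.IsAddHaarMeasure]

/-- gradient pairing -/
noncomputable def gr (L : Ell n E ι) (f g : E → ℝ) (x : E) : ℝ :=
  ∑ i, ∑ j, L.c i j x * fderiv ℝ f x (L.b i) * fderiv ℝ g x (L.b j)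

variable (L : Ell n E ι)

lemma finrank_eq (L : Ell n E ι) : Module.finrank ℝ E = 2 * n := by
  rw [Module.finrank_eq_card_basis L.b, L.card]

lemma nontriv (L : Ell n E ι) : Nontrivial E := by
  apply Module.nontrivial_of_finrank_pos (R := ℝ)
  rw [L.finrank_eq]
  have := L.hn
  omega

lemma kap_int (L : Ell n E ι) : ∃ c, 0 < c ∧ ∀ ρ, 0 < ρ →
    IntegrableOn (fun y : E => kap n y) (ball 0 ρ) μ ∧ ∫ y in ball (0 : E) ρ, kap n y ∂μ = c * ρ := by
  have := L.nontriv
  have hn := L.hn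
  have hd : Module.finrank ℝ E - 1 = 2 * n - 1 := by rw [L.finrank_eq]
  have hs : ∀ y : ℝ, 0 < y → y ^ (2 * n - 1) • (y ^ (2 * n - 1))⁻¹ = 1 := by
    intro y hy
    have := (pow_pos hy (2 * n - 1)).ne'
    simp [this]
  refine ⟨(2 * n) * μ.real (ball (0 : E) 1), ?_, fun ρ hρ => ⟨?_, ?_⟩⟩
  · have h1 : 0 < μ.real (ball (0 : E) 1) := by
      rw [measureReal_def]
      exact ENNReal.toReal_pos (measure_ball_pos μ _ one_pos).ne' measure_ball_lt_top.ne
    have : (0 : ℝ) < n := by exact_mod_cast hn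
    positivity
  · unfold kap
    rw [integrableOn_fun_norm_addHaar μ (f := fun s => (s ^ (2 * n - 1))⁻¹), hd]
    refine (integrableOn_congr_fun (g := fun _ => (1 : ℝ)) ?_ measurableSet_Ioo).2 ?_
    · intro y hy
      exact hs y hy.1
    · simp
  · have e : ∫ y in ball (0 : E) ρ, kap n y ∂μ
        = ∫ y, (Set.Iio ρ).indicator (fun s : ℝ => (s ^ (2 * n - 1))⁻¹) ‖y‖ ∂μ := by
      rw [← integral_indicator measurableSet_ball]
      congr 1
      ext y
      simp [Set.indicator, kap]
    rw [e, integral_fun_norm_addHaar, hd, L.finrank_eq]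
    have e2 : ∫ y in Set.Ioi (0 : ℝ), y ^ (2 * n - 1) •
        (Set.Iio ρ).indicator (fun s : ℝ => (s ^ (2 * n - 1))⁻¹) y = ρ := by
      have : ∀ y ∈ Set.Ioi (0 : ℝ), y ^ (2 * n - 1) •
        (Set.Iio ρ).indicator (fun s : ℝ => (s ^ (2 * n - 1))⁻¹) y
          = (Set.Iio ρ).indicator (fun _ => (1 : ℝ)) y := by
        intro y hy
        by_cases h : y < ρ
        · simp only [Set.indicator, Set.mem_Iio, h, if_true]
          exact hs y hy
        · simp [Set.indicator, h]
      rw [setIntegral_congr_fun measurableSet_Ioi this, integral_indicator measurableSet_Iio]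
      rw [Measure.restrict_restrict measurableSet_Iio]
      simp [Set.Iio_inter_Ioi, hρ.le]
    rw [e2]
    simp
    ring

lemma green_aux (f g : E → ℝ) (hf : ContDiff ℝ 1 f) (hg : ContDiff ℝ 2 g)
    (hcs : HasCompactSupport f ∨ HasCompactSupport g) :
    Integrable (fun x => f x * L.op g x) μ ∧ Integrable (L.gr f g) μ ∧
    ∫ x, f x * L.op g x ∂μ = - ∫ x, L.gr f g x ∂μ := by
  have hdg : ∀ j, ContDiff ℝ 1 fun x => fderiv ℝ g x (L.b j) := fun j =>
    (hg.fderiv_right (m := 1) (by norm_num)).clm_apply contDiff_const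
  have hfc : ∀ i j, ContDiff ℝ 1 fun x => f x * L.c i j x := fun i j => hf.mul (L.hc i j)
  have csdg : HasCompactSupport g → ∀ j, HasCompactSupport fun x => fderiv ℝ g x (L.b j) :=
    fun h j => h.fderiv_apply (𝕜 := ℝ) _
  have csfc : HasCompactSupport f → ∀ i j, HasCompactSupport fun x => f x * L.c i j x :=
    fun h i j => h.mul_right
  have cfd : ∀ (u : E → ℝ), ContDiff ℝ 1 u → ∀ v, Continuous fun x => fderiv ℝ u x v :=
    fun u hu v => (hu.continuous_fderiv (by norm_num)).clm_apply continuous_const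
  have i1 : ∀ i j, Integrable (fun x => fderiv ℝ (fun x => f x * L.c i j x) x (L.b i) *
      fderiv ℝ g x (L.b j)) μ := by
    intro i j
    apply Continuous.integrable_of_hasCompactSupport
    · exact (cfd _ (hfc i j) _).mul (hdg j).continuous
    · rcases hcs with h | h
      · exact ((csfc h i j).fderiv_apply (𝕜 := ℝ) _).mul_right
      · exact (csdg h j).mul_left
  have i2 : ∀ i j, Integrable (fun x => f x * L.c i j x *
      fderiv ℝ (fun x => fderiv ℝ g x (L.b j)) x (L.b i)) μ := by
    intro i j
    apply Continuous.integrable_of_hasCompactSupport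
    · exact (hfc i j).continuous.mul (cfd _ (hdg j) _)
    · rcases hcs with h | h
      · exact (csfc h i j).mul_right
      · exact ((csdg h j).fderiv_apply (𝕜 := ℝ) _).mul_left
  have i3 : ∀ i j, Integrable (fun x => f x * L.c i j x * fderiv ℝ g x (L.b j)) μ := by
    intro i j
    apply Continuous.integrable_of_hasCompactSupport
    · exact (hfc i j).continuous.mul (hdg j).continuous
    · rcases hcs with h | h
      · exact (csfc h i j).mul_right
      · exact (csdg h j).mul_left
  have ibp : ∀ i j, ∫ x, f x * L.c i j x *
      fderiv ℝ (fun x => fderiv ℝ g x (L.b j)) x (L.b i) ∂μ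
      = - ∫ x, fderiv ℝ (fun x => f x * L.c i j x) x (L.b i) * fderiv ℝ g x (L.b j) ∂μ :=
    fun i j => integral_mul_fderiv_eq_neg_fderiv_mul_of_integrable (i1 i j) (i2 i j) (i3 i j)
      (fun x _ => (hfc i j).differentiable (by norm_num) x)
      (fun x _ => (hdg j).differentiable (by norm_num) x)
  have e1 : (fun x => f x * L.op g x) = fun x => ∑ i, ∑ j, f x * L.c i j x *
      fderiv ℝ (fun x => fderiv ℝ g x (L.b j)) x (L.b i) := by
    ext x
    simp only [op, Finset.mul_sum]
    exact Finset.sum_congr rfl fun i _ => Finset.sum_congr rfl fun j _ => by ring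
  have e2 : L.gr f g = fun x => ∑ i, ∑ j,
      fderiv ℝ (fun x => f x * L.c i j x) x (L.b i) * fderiv ℝ g x (L.b j) := by
    ext x
    have hd : ∀ i j, fderiv ℝ (fun x => f x * L.c i j x) x (L.b i)
        = f x * fderiv ℝ (L.c i j) x (L.b i) + L.c i j x * fderiv ℝ f x (L.b i) := by
      intro i j
      rw [fderiv_fun_mul (hf.differentiable (by norm_num) x)
        ((L.hc i j).differentiable (by norm_num) x)]
      simp
    simp only [hd, add_mul, Finset.sum_add_distrib, gr]
    rw [Finset.sum_comm (f := fun i j => f x * fderiv ℝ (L.c i j) x (L.b i) * _)]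
    have : ∀ j, ∑ i, f x * fderiv ℝ (L.c i j) x (L.b i) * fderiv ℝ g x (L.b j) = 0 := by
      intro j
      rw [← Finset.sum_mul, ← Finset.mul_sum, L.div j x]
      simp
    simp [this]
  refine ⟨?_, ?_, ?_⟩
  · rw [e1]
    exact integrable_finsetSum _ fun i _ => integrable_finsetSum _ fun j _ => i2 i j
  · rw [e2]
    exact integrable_finsetSum _ fun i _ => integrable_finsetSum _ fun j _ => i1 i j
  · rw [e1, e2, integral_finsetSum _ fun i _ => integrable_finsetSum _ fun j _ => i2 i j,
      integral_finsetSum _ fun i _ => integrable_finsetSum _ fun j _ => i1 i j,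
      ← Finset.sum_neg_distrib]
    refine Finset.sum_congr rfl fun i _ => ?_
    rw [integral_finsetSum _ fun j _ => i2 i j, integral_finsetSum _ fun j _ => i1 i j,
      ← Finset.sum_neg_distrib]
    exact Finset.sum_congr rfl fun j _ => ibp i j

lemma gr_comm (f g : E → ℝ) (x : E) : L.gr f g x = L.gr g f x := by
  unfold gr
  rw [Finset.sum_comm]
  refine Finset.sum_congr rfl fun i _ => Finset.sum_congr rfl fun j _ => ?_
  rw [L.symm j i]
  ring

lemma green (f g : E → ℝ) (hf : ContDiff ℝ 2 f) (hg : ContDiff ℝ 2 g)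
    (hcs : HasCompactSupport f ∨ HasCompactSupport g) :
    ∫ x, f x * L.op g x ∂μ = ∫ x, g x * L.op f x ∂μ := by
  rw [(L.green_aux μ f g (hf.of_le (by norm_num)) hg hcs).2.2,
    (L.green_aux μ g f (hg.of_le (by norm_num)) hf hcs.symm).2.2]
  congr 2
  ext x
  exact L.gr_comm f g x

lemma op_cont (g : E → ℝ) (hg : ContDiff ℝ 2 g) : Continuous (L.op g) := by
  unfold op
  refine continuous_finsetSum _ fun i _ => continuous_finsetSum _ fun j _ => ?_
  refine (L.cont_c i j).mul ?_
  have : ContDiff ℝ 1 fun x => fderiv ℝ g x (L.b j) :=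
    (hg.fderiv_right (m := 1) (by norm_num)).clm_apply contDiff_const
  exact (this.continuous_fderiv (by norm_num)).clm_apply continuous_const

lemma op_cs (g : E → ℝ) (hcs : HasCompactSupport g) : HasCompactSupport (L.op g) := by
  unfold op
  have : ∀ i j, HasCompactSupport fun x => L.c i j x *
      fderiv ℝ (fun x' => fderiv ℝ g x' (L.b j)) x (L.b i) := fun i j =>
    HasCompactSupport.mul_left ((hcs.fderiv_apply (𝕜 := ℝ) (L.b j)).fderiv_apply (𝕜 := ℝ) (L.b i))
  apply HasCompactSupport.intro hcs.isCompact
  intro x hx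
  refine Finset.sum_eq_zero fun i _ => Finset.sum_eq_zero fun j _ => ?_
  have h1 : x ∉ tsupport (fun x' => fderiv ℝ g x' (L.b j)) :=
    fun h => hx (tsupport_fderiv_apply_subset ℝ _ h)
  have h2 : x ∉ tsupport (fun x' => fderiv ℝ (fun x' => fderiv ℝ g x' (L.b j)) x' (L.b i)) :=
    fun h => h1 (tsupport_fderiv_apply_subset ℝ _ h)
  rw [image_eq_zero_of_notMem_tsupport h2, mul_zero]

lemma op_eq_zero (g : E → ℝ) (x : E) (hx : x ∉ tsupport g) : L.op g x = 0 := by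
  refine Finset.sum_eq_zero fun i _ => Finset.sum_eq_zero fun j _ => ?_
  have h1 : x ∉ tsupport (fun x' => fderiv ℝ g x' (L.b j)) :=
    fun h => hx (tsupport_fderiv_apply_subset ℝ _ h)
  have h2 : x ∉ tsupport (fun x' => fderiv ℝ (fun x' => fderiv ℝ g x' (L.b j)) x' (L.b i)) :=
    fun h => h1 (tsupport_fderiv_apply_subset ℝ _ h)
  rw [image_eq_zero_of_notMem_tsupport h2, mul_zero]

lemma int_op (g : E → ℝ) (hg : ContDiff ℝ 2 g) (hcs : HasCompactSupport g) :
    ∫ x, L.op g x ∂μ = 0 := by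
  have := L.green μ (fun _ => (1 : ℝ)) g contDiff_const hg (Or.inr hcs)
  simp only [one_mul] at this
  rw [this]
  simp [op]

end Ell

namespace Ell

/-- cut off radial density -/
noncomputable def kk (n : ℕ) (s r t : ℝ) : ℝ :=
  (t ^ n)⁻¹ * q (√t / r) * Real.smoothTransition (4 * (t / s ^ 2) - 1)

/-- its derivative -/
noncomputable def kkd (n : ℕ) (s r t : ℝ) : ℝ :=
  -hdd n r t * Real.smoothTransition (4 * (t / s ^ 2) - 1) +
    (t ^ n)⁻¹ * q (√t / r) * (deriv Real.smoothTransition (4 * (t / s ^ 2) - 1) * (4 / s ^ 2))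

/-- radial primitive -/
noncomputable def hh (n : ℕ) (s r t : ℝ) : ℝ := -∫ τ in (r ^ 2)..t, kk n s r τ

section
variable {n : ℕ} {s r : ℝ}

lemma kk_zero_of_lt (hs : 0 < s) {t : ℝ} (ht : t ≤ s ^ 2 / 4) : kk n s r t = 0 := by
  unfold kk
  rw [Real.smoothTransition.zero_of_nonpos, mul_zero]
  have : t / s ^ 2 ≤ 1 / 4 := by rw [div_le_iff₀ (by positivity)]; linarith
  linarith

lemma kk_zero_of_ge (hr : 0 < r) {t : ℝ} (ht : r ^ 2 ≤ t) : kk n s r t = 0 := by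
  unfold kk
  rw [q_zero]
  · simp
  · rw [one_le_div hr]
    exact Real.le_sqrt_of_sq_le ht

lemma kk_nonneg (hs : 0 < s) (t : ℝ) : 0 ≤ kk n s r t := by
  by_cases h : t ≤ s ^ 2 / 4
  · rw [kk_zero_of_lt hs h]
  · push Not at h
    have : 0 < t := lt_of_le_of_lt (by positivity) h
    have := q_nonneg (√t / r)
    have := Real.smoothTransition.nonneg (4 * (t / s ^ 2) - 1)
    unfold kk
    positivity

lemma kk_eq (hs : 0 < s) {t : ℝ} (ht : s ^ 2 / 2 ≤ t) : kk n s r t = - hd n r t := by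
  unfold kk hd
  rw [Real.smoothTransition.one_of_one_le]
  · ring
  · have : 1 / 2 ≤ t / s ^ 2 := by rw [le_div_iff₀ (by positivity)]; linarith
    linarith

lemma kk_le (hs : 0 < s) {t : ℝ} (ht : 0 ≤ t) : kk n s r t ≤ - hd n r t := by
  unfold kk hd
  have := q_nonneg (√t / r)
  have := Real.smoothTransition.le_one (4 * (t / s ^ 2) - 1)
  rw [neg_neg]
  apply mul_le_of_le_one_right (by positivity) this

lemma kk_smooth (hs : 0 < s) : ContDiff ℝ (⊤ : ℕ∞) (kk n s r) := by
  rw [contDiff_iff_contDiffAt]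
  intro t
  by_cases h : t < s ^ 2 / 4
  · have : kk n s r =ᶠ[𝓝 t] fun _ => 0 := by
      filter_upwards [Iio_mem_nhds h] with u hu
      exact kk_zero_of_lt hs (le_of_lt hu)
    exact contDiffAt_const.congr_of_eventuallyEq this
  · push Not at h
    have ht : 0 < t := lt_of_lt_of_le (by positivity) h
    unfold kk
    refine ((((contDiff_id.pow n).contDiffAt).inv (by simp; intro h; exact absurd h ht.ne')).mul ?_).mul ?_
    · exact q_smooth.contDiffAt.comp t ((contDiffAt_id.sqrt ht.ne').div_const r)
    · apply (Real.smoothTransition.contDiff (n := ⊤)).contDiffAt.comp t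
      exact (contDiffAt_const.mul (contDiffAt_id.div_const _)).sub contDiffAt_const

lemma kk_hasDerivAt (hs : 0 < s) (hr : 0 < r) {t : ℝ} (ht : 0 < t) :
    HasDerivAt (kk n s r) (kkd n s r t) t := by
  have h1 := (hd_hasDerivAt n hr ht).neg
  have h2 : HasDerivAt (fun t : ℝ => 4 * (t / s ^ 2) - 1) (4 / s ^ 2) t := by
    have := (((hasDerivAt_id t).div_const (s ^ 2)).const_mul 4).sub_const 1
    simpa [div_eq_mul_inv] using this
  have h3 : HasDerivAt Real.smoothTransition _ (4 * (t / s ^ 2) - 1) :=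
    (((Real.smoothTransition.contDiff (n := 1)).differentiable (by norm_num)) _).hasDerivAt
  have h4 := h1.mul (HasDerivAt.comp t h3 h2)
  have e : kk n s r = (-hd n r) * (Real.smoothTransition ∘ fun t : ℝ => 4 * (t / s ^ 2) - 1) := by
    ext u
    simp [kk, hd]
  rw [e]
  refine h4.congr_deriv ?_
  simp [kkd, hd]

lemma hh_hasDerivAt (hs : 0 < s) (t : ℝ) : HasDerivAt (hh n s r) (-kk n s r t) t := by
  have hc : Continuous (kk n s r) := (kk_smooth hs).continuous
  exact (intervalIntegral.integral_hasDerivAt_right (hc.intervalIntegrable _ _)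
    (hc.stronglyMeasurableAtFilter _ _) hc.continuousAt).neg

lemma hh_smooth (hs : 0 < s) : ContDiff ℝ (⊤ : ℕ∞) (hh n s r) := by
  have e : deriv (hh n s r) = fun t => -kk n s r t := by
    ext t; exact (hh_hasDerivAt hs t).deriv
  refine contDiff_infty_iff_deriv.2 ⟨fun t => (hh_hasDerivAt hs t).differentiableAt, ?_⟩
  rw [e]
  exact (kk_smooth hs).neg

lemma hh_zero (hs : 0 < s) (hr : 0 < r) {t : ℝ} (ht : r ^ 2 ≤ t) : hh n s r t = 0 := by
  unfold hh
  rw [intervalIntegral.integral_congr (g := fun _ => (0 : ℝ))]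
  · simp
  · intro u hu
    rw [Set.uIcc_of_le ht] at hu
    exact kk_zero_of_ge hr hu.1

lemma hh_nonneg (hs : 0 < s) (hr : 0 < r) (t : ℝ) : 0 ≤ hh n s r t := by
  rcases le_total (r ^ 2) t with h | h
  · rw [hh_zero hs hr h]
  · unfold hh
    rw [← intervalIntegral.integral_symm]
    exact intervalIntegral.integral_nonneg h fun u _ => kk_nonneg hs u

lemma kkd_eq (hs : 0 < s) (hr : 0 < r) {t : ℝ} (ht : s ^ 2 ≤ t) : kkd n s r t = - hdd n r t := by
  have hp : 0 < s ^ 2 := by positivity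
  have h1 := kk_hasDerivAt (n := n) hs hr (lt_of_lt_of_le hp ht)
  have h2 := (hd_hasDerivAt n hr (lt_of_lt_of_le hp ht)).neg
  refine h1.unique (h2.congr_of_eventuallyEq ?_)
  filter_upwards [Ioi_mem_nhds (show s ^ 2 / 2 < t by linarith)] with u hu
  exact kk_eq hs (le_of_lt hu)

lemma deriv_kk (hs : 0 < s) (hr : 0 < r) (t : ℝ) :
    deriv (kk n s r) t = if t < s ^ 2 / 4 then 0 else kkd n s r t := by
  split_ifs with h
  · have : kk n s r =ᶠ[𝓝 t] fun _ => 0 := by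
      filter_upwards [Iio_mem_nhds h] with u hu
      exact kk_zero_of_lt hs (le_of_lt hu)
    rw [this.deriv_eq]
    simp
  · push Not at h
    exact (kk_hasDerivAt hs hr (lt_of_lt_of_le (by positivity) h)).deriv

end

lemma kk_bounds (n : ℕ) : ∃ M, 0 < M ∧ ∀ s r t, 0 < s → s ≤ r → t < s ^ 2 →
    kk n s r t ≤ M * (s ^ (2 * n))⁻¹ ∧ |deriv (kk n s r) t| * s ^ 2 ≤ M * (s ^ (2 * n))⁻¹ := by
  obtain ⟨M, hM1, hM2, -⟩ := q_consts
  obtain ⟨M3, hM3⟩ := (isCompact_Icc (a := (0 : ℝ)) (b := 3)).exists_bound_of_continuousOn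
    ((Real.smoothTransition.contDiff (n := 1)).continuous_deriv (by norm_num)).continuousOn
  have hM30 : 0 ≤ M3 := (norm_nonneg _).trans (hM3 0 (by norm_num))
  refine ⟨4 ^ (n + 1) * (n + M) + 4 ^ (n + 1) * M3 + 1, by positivity, ?_⟩
  intro s r t hs hsr ht
  have hr : 0 < r := hs.trans_le hsr
  by_cases h : t < s ^ 2 / 4
  · rw [deriv_kk hs hr, if_pos h, kk_zero_of_lt hs h.le]
    simp only [abs_zero, zero_mul]
    constructor <;> positivity
  rw [deriv_kk hs hr, if_neg h]
  push Not at h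
  have ht0 : 0 < t := lt_of_lt_of_le (by positivity) h
  have hinv : ∀ m : ℕ, (t ^ m)⁻¹ ≤ 4 ^ m * (s ^ (2 * m))⁻¹ := by
    intro m
    rw [pow_mul, ← div_eq_mul_inv, ← div_pow, ← inv_pow]
    gcongr
    rw [inv_le_comm₀ ht0 (by positivity), inv_div]
    exact h
  have hst : √t / r ≤ 1 := by
    rw [div_le_one hr]
    refine le_trans ?_ hsr
    rw [Real.sqrt_le_iff]
    exact ⟨hs.le, ht.le⟩
  have hq0 := q_nonneg (√t / r)
  have hq1 := q_le_one (√t / r)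
  have hsm0 := Real.smoothTransition.nonneg (4 * (t / s ^ 2) - 1)
  have hsm1 := Real.smoothTransition.le_one (4 * (t / s ^ 2) - 1)
  have hX : 4 * (t / s ^ 2) - 1 ∈ Set.Icc (0 : ℝ) 3 := by
    have h1 : 1 / 4 ≤ t / s ^ 2 := by rw [le_div_iff₀ (by positivity)]; linarith
    have h2 : t / s ^ 2 ≤ 1 := by rw [div_le_iff₀ (by positivity)]; linarith
    constructor <;> linarith
  have hhdd : 0 ≤ hdd n r t := by
    unfold hdd
    have := q1_nonneg (√t / r)
    positivity
  have hhdd' : hdd n r t ≤ 4 ^ (n + 1) * (s ^ (2 * (n + 1)))⁻¹ * (n * 1 + 1 * M) := by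
    unfold hdd
    have h3 := hM2 (√t / r) (by positivity)
    have h4 := q1_nonneg (√t / r)
    have h5 : √t / (2 * r) ≤ 1 := by
      have : √t / (2 * r) = (√t / r) / 2 := by field_simp
      linarith
    gcongr
    exact hinv (n + 1)
  constructor
  · calc kk n s r t ≤ (4 ^ n * (s ^ (2 * n))⁻¹) * 1 * 1 := by
          unfold kk
          gcongr
          exact hinv n
      _ = 4 ^ n * (s ^ (2 * n))⁻¹ := by ring
      _ ≤ _ := by
          gcongr
          have : (4 : ℝ) ^ n ≤ 4 ^ (n + 1) * (n + M) := by
            rw [pow_succ, mul_assoc]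
            apply le_mul_of_one_le_right (by positivity)
            have : (0 : ℝ) ≤ n := by positivity
            linarith
          have : 0 ≤ 4 ^ (n + 1) * M3 := by positivity
          linarith
  · have h6 : |kkd n s r t| ≤ 4 ^ (n + 1) * (s ^ (2 * (n + 1)))⁻¹ * (n * 1 + 1 * M)
        + (4 ^ n * (s ^ (2 * n))⁻¹) * 1 * (M3 * (4 / s ^ 2)) := by
      unfold kkd
      refine (abs_add_le _ _).trans ?_
      gcongr
      · rw [abs_mul, abs_neg, abs_of_nonneg hhdd, abs_of_nonneg hsm0]
        calc _ ≤ hdd n r t * 1 := by gcongr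
          _ ≤ _ := by rw [mul_one]; exact hhdd'
      · rw [abs_mul, abs_mul, abs_mul, abs_of_nonneg hq0,
          abs_of_pos (by positivity : 0 < (t ^ n)⁻¹), abs_of_pos (by positivity : 0 < 4 / s ^ 2)]
        gcongr
        · exact hinv n
        · exact hM3 _ hX
    calc |kkd n s r t| * s ^ 2 ≤ (4 ^ (n + 1) * (s ^ (2 * (n + 1)))⁻¹ * (n * 1 + 1 * M)
        + (4 ^ n * (s ^ (2 * n))⁻¹) * 1 * (M3 * (4 / s ^ 2))) * s ^ 2 := by gcongr
      _ = (4 ^ (n + 1) * (n + M) + 4 ^ (n + 1) * M3) * (s ^ (2 * n))⁻¹ := by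
        have : s ^ (2 * (n + 1)) = s ^ (2 * n) * s ^ 2 := by ring
        rw [this]
        field_simp
        ring
      _ ≤ _ := mul_le_mul_of_nonneg_right (by linarith) (by positivity)

variable {n : ℕ} {E ι : Type} [NormedAddCommGroup E] [NormedSpace ℝ E]
  [FiniteDimensional ℝ E] [Fintype ι] [DecidableEq ι]

variable (L : Ell n E ι)

/-- derivative of the quadratic form -/
noncomputable def dQ (z y : E) : E →L[ℝ] ℝ := ∑ i, (2 * L.By z y i) • L.co i

lemma dQ_b (z y : E) (j : ι) : L.dQ z y (L.b j) = 2 * L.By z y j := by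
  simp [dQ, co_b]

lemma By_hasFDerivAt (z x : E) (i : ι) :
    HasFDerivAt (fun x => L.By z (x - z) i) (∑ j, L.Bm z i j • L.co j) x := by
  unfold By
  refine HasFDerivAt.fun_sum fun j _ => ?_
  have h : HasFDerivAt (fun x => L.co j (x - z)) (L.co j) x := by
    have := (L.co j).hasFDerivAt.comp x ((hasFDerivAt_id x).sub_const z)
    exact this.congr_fderiv (by ext; rfl)
  simpa using h.const_mul (L.Bm z i j)

lemma Q_hasFDerivAt (z x : E) : HasFDerivAt (fun x => L.Q z (x - z)) (L.dQ z (x - z)) x := by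
  have h : ∀ i, HasFDerivAt (fun x => L.By z (x - z) i * L.co i (x - z))
      (L.By z (x - z) i • L.co i + L.co i (x - z) • ∑ j, L.Bm z i j • L.co j) x := by
    intro i
    have h1 : HasFDerivAt (fun x => L.co i (x - z)) (L.co i) x := by
      have := (L.co i).hasFDerivAt.comp x ((hasFDerivAt_id x).sub_const z)
      exact this.congr_fderiv (by ext; rfl)
    exact (L.By_hasFDerivAt z x i).mul h1
  have h2 := HasFDerivAt.fun_sum (u := Finset.univ) fun i _ => h i
  refine h2.congr_fderiv ?_
  ext v
  simp only [dQ, ContinuousLinearMap.sum_apply, ContinuousLinearMap.add_apply,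
    ContinuousLinearMap.smul_apply, smul_eq_mul, Finset.sum_add_distrib]
  have : ∑ i, L.co i (x - z) * ∑ j, L.Bm z i j * L.co j v = ∑ i, L.By z (x - z) i * L.co i v := by
    simp only [By, Finset.mul_sum, Finset.sum_mul]
    rw [Finset.sum_comm]
    refine Finset.sum_congr rfl fun i _ => Finset.sum_congr rfl fun j _ => ?_
    rw [L.Bm_symm z i j]
    ring
  rw [this, ← Finset.sum_add_distrib]
  exact Finset.sum_congr rfl fun i _ => by ring

lemma Q_smooth (z : E) : ContDiff ℝ (⊤ : ℕ∞) fun x => L.Q z (x - z) := by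
  unfold Q By
  have h : ∀ j, ContDiff ℝ (⊤ : ℕ∞) fun x => L.co j (x - z) := fun j =>
    (L.co j).contDiff.comp (contDiff_id.sub contDiff_const)
  exact ContDiff.sum fun i _ => (ContDiff.sum fun j _ => contDiff_const.mul (h j)).mul (h i)

lemma radial_fderiv (h h' : ℝ → ℝ) (hh : ∀ t, HasDerivAt h (h' t) t) (z x : E) (j : ι) :
    fderiv ℝ (fun x => h (L.Q z (x - z))) x (L.b j) =
      h' (L.Q z (x - z)) * (2 * L.By z (x - z) j) := by
  have := (hh (L.Q z (x - z))).comp_hasFDerivAt x (L.Q_hasFDerivAt z x)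
  have e := this.fderiv
  simp only [Function.comp_def] at e
  rw [e]
  simp [dQ_b]

lemma radial_op (h h' h'' : ℝ → ℝ) (hh : ∀ t, HasDerivAt h (h' t) t)
    (hh' : ∀ t, HasDerivAt h' (h'' t) t) (z x : E) :
    L.op (fun x => h (L.Q z (x - z))) x = 4 * h'' (L.Q z (x - z)) * L.a4 x z (x - z)
      + 2 * h' (L.Q z (x - z)) * L.tau x z := by
  unfold op
  have e : ∀ i j, fderiv ℝ (fun x' => fderiv ℝ (fun x => h (L.Q z (x - z))) x' (L.b j)) x (L.b i)
      = 4 * h'' (L.Q z (x - z)) * (L.By z (x - z) i * L.By z (x - z) j)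
        + 2 * h' (L.Q z (x - z)) * L.Bm z i j := by
    intro i j
    have e1 : (fun x' => fderiv ℝ (fun x => h (L.Q z (x - z))) x' (L.b j))
        = fun x => h' (L.Q z (x - z)) * (2 * L.By z (x - z) j) := by
      ext x'
      exact L.radial_fderiv h h' hh z x' j
    rw [e1]
    have h1 := (hh' (L.Q z (x - z))).comp_hasFDerivAt x (L.Q_hasFDerivAt z x)
    have h2 := (L.By_hasFDerivAt z x j).const_mul 2
    have h3 := (h1.mul h2).fderiv
    change fderiv ℝ (fun x => h' (L.Q z (x - z)) * (2 * L.By z (x - z) j)) x = _ at h3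
    rw [h3]
    simp only [ContinuousLinearMap.add_apply, ContinuousLinearMap.smul_apply, dQ_b, smul_eq_mul,
      ContinuousLinearMap.sum_apply, co_b, Function.comp]
    simp
    rw [L.Bm_symm z j i]
    ring
  simp only [e, a4, tau, Finset.mul_sum, mul_add, Finset.sum_add_distrib]
  congr 1
  · exact Finset.sum_congr rfl fun i _ => Finset.sum_congr rfl fun j _ => by ring
  · exact Finset.sum_congr rfl fun i _ => Finset.sum_congr rfl fun j _ => by ring

/-- test function -/
noncomputable def tf (s r : ℝ) (z x : E) : ℝ := hh n s r (L.Q z (x - z))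

variable {s r : ℝ}

lemma tf_smooth (hs : 0 < s) (z : E) : ContDiff ℝ (⊤ : ℕ∞) (L.tf s r z) :=
  (hh_smooth hs).comp (L.Q_smooth z)

lemma tf_nonneg (hs : 0 < s) (hr : 0 < r) (z x : E) : 0 ≤ L.tf s r z x := hh_nonneg hs hr _

lemma tf_op (hs : 0 < s) (z x : E) : L.op (L.tf s r z) x =
    4 * (-deriv (kk n s r) (L.Q z (x - z))) * L.a4 x z (x - z)
      + 2 * (-kk n s r (L.Q z (x - z))) * L.tau x z := by
  have h2 : ∀ t, HasDerivAt (fun t => -kk n s r t) (-deriv (kk n s r) t) t := fun t =>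
    (((kk_smooth hs).differentiable (by norm_num)) t).hasDerivAt.neg
  exact L.radial_op (hh n s r) _ _ (fun t => hh_hasDerivAt hs t) h2 z x

lemma tf_op_eq (hs : 0 < s) (hr : 0 < r) (z x : E) (h : s ^ 2 ≤ L.Q z (x - z)) :
    L.op (L.tf s r z) x = L.ker r z x := by
  have hp : 0 < s ^ 2 := by positivity
  rw [L.tf_op hs, deriv_kk hs hr, if_neg (by linarith), kkd_eq hs hr h,
    kk_eq hs (by linarith)]
  simp [ker]

lemma tf_tsupport {R C : ℝ} (hB : L.Bd R C) (hs : 0 < s) (hr : 0 < r) (z : E) (hz : ‖z‖ ≤ R) :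
    tsupport (L.tf s r z) ⊆ closedBall z (C * r) := by
  apply closure_minimal _ isClosed_closedBall
  intro x hx
  rw [mem_closedBall, dist_eq_norm]
  by_contra h
  push Not at h
  apply hx
  apply hh_zero hs hr
  have h1 := hB.le_sig L z (x - z) hz
  have hC := hB.one
  have h2 : r ≤ √(L.Q z (x - z)) := le_of_mul_le_mul_left (h.le.trans h1) (by linarith)
  calc r ^ 2 ≤ √(L.Q z (x - z)) ^ 2 := by gcongr
    _ = _ := Real.sq_sqrt (L.Q_nonneg z _)

lemma tf_cs {R C : ℝ} (hB : L.Bd R C) (hs : 0 < s) (hr : 0 < r) (z : E) (hz : ‖z‖ ≤ R) :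
    HasCompactSupport (L.tf s r z) :=
  (isCompact_closedBall z (C * r)).of_isClosed_subset (isClosed_tsupport _)
    (L.tf_tsupport hB hs hr z hz)

lemma tf_op_bound {R C : ℝ} (hB : L.Bd R C) : ∃ M, 0 < M ∧ ∀ s r x z, 0 < s → s ≤ r → ‖x‖ ≤ R →
    ‖z‖ ≤ R → L.Q z (x - z) < s ^ 2 → |L.op (L.tf s r z) x| ≤ M * (s ^ (2 * n))⁻¹ := by
  obtain ⟨M, hM0, hM⟩ := kk_bounds n
  have hC := hB.one
  refine ⟨M * (4 * (1 + C * (2 * R) * C) + 2 * (2 * n + C * (2 * R))) + 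
    |M * (4 * (1 + C * (2 * R) * C) + 2 * (2 * n + C * (2 * R)))| + 1, ?_, ?_⟩
  · have := neg_abs_le (M * (4 * (1 + C * (2 * R) * C) + 2 * (2 * n + C * (2 * R))))
    linarith
  intro s r x z hs hsr hx hz hQ
  obtain ⟨h1, h2⟩ := hM s r _ hs hsr hQ
  have hxz : ‖x - z‖ ≤ 2 * R := (norm_sub_le _ _).trans (by linarith)
  have hR : 0 ≤ R := (norm_nonneg _).trans hx
  have ha : |L.a4 x z (x - z)| ≤ (1 + C * (2 * R) * C) * s ^ 2 := by
    have h3 := hB.a4 x z (x - z) hx hz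
    have h4 := hB.lowQ z (x - z) hz
    have h5 := L.Q_nonneg z (x - z)
    have h6 : |L.a4 x z (x - z)| ≤ |L.a4 x z (x - z) - L.Q z (x - z)| + |L.Q z (x - z)| := by
      have := abs_add_le (L.a4 x z (x - z) - L.Q z (x - z)) (L.Q z (x - z))
      simpa using this
    rw [abs_of_nonneg h5] at h6
    have h7 : C * ‖x - z‖ * ‖x - z‖ ^ 2 ≤ C * (2 * R) * (C * s ^ 2) := by
      gcongr
      exact h4.trans (by gcongr)
    linarith
  have ht : |L.tau x z| ≤ 2 * n + C * (2 * R) := by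
    have h3 := hB.tau x z hx hz
    have h6 : |L.tau x z| ≤ |L.tau x z - 2 * n| + |(2 * n : ℝ)| := by
      have := abs_add_le (L.tau x z - 2 * n) (2 * n)
      simpa using this
    rw [abs_of_nonneg (by positivity : (0 : ℝ) ≤ 2 * n)] at h6
    have : C * ‖x - z‖ ≤ C * (2 * R) := by gcongr
    linarith
  rw [L.tf_op hs]
  set D := |deriv (kk n s r) (L.Q z (x - z))|
  have h0 := kk_nonneg (n := n) (r := r) hs (L.Q z (x - z))
  have hS : 0 ≤ (s ^ (2 * n))⁻¹ := by positivity
  calc _ ≤ 4 * D * |L.a4 x z (x - z)| + 2 * kk n s r (L.Q z (x - z)) * |L.tau x z| := by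
        refine (abs_add_le _ _).trans ?_
        simp only [abs_mul, abs_neg, abs_of_nonneg h0, D]
        norm_num
    _ ≤ 4 * D * ((1 + C * (2 * R) * C) * s ^ 2) + 
        2 * (M * (s ^ (2 * n))⁻¹) * (2 * n + C * (2 * R)) := by
        gcongr
    _ = 4 * (D * s ^ 2) * (1 + C * (2 * R) * C) + 
        2 * (M * (s ^ (2 * n))⁻¹) * (2 * n + C * (2 * R)) := by ring
    _ ≤ 4 * (M * (s ^ (2 * n))⁻¹) * (1 + C * (2 * R) * C) + 
        2 * (M * (s ^ (2 * n))⁻¹) * (2 * n + C * (2 * R)) := by gcongr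
    _ = (M * (4 * (1 + C * (2 * R) * C) + 2 * (2 * n + C * (2 * R)))) * (s ^ (2 * n))⁻¹ := by ring
    _ ≤ _ := by
        gcongr
        have := abs_nonneg (M * (4 * (1 + C * (2 * R) * C) + 2 * (2 * n + C * (2 * R))))
        linarith

end Ell

namespace Ell

variable {n : ℕ} {E ι : Type} [NormedAddCommGroup E] [NormedSpace ℝ E]
  [FiniteDimensional ℝ E] [Fintype ι] [DecidableEq ι] [MeasurableSpace E] [BorelSpace E]
  (μ : Measure E) [μ.IsAddHaarMeasure]

variable (L : Ell n E ι)

lemma KB.mono {R C C' r0 : ℝ} (h : L.KB R C r0) (hC : C ≤ C') : L.KB R C' r0 where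
  one := h.one.trans hC
  r0pos := h.r0pos
  zero r x z hr hz hx := h.zero r x z hr hz (le_trans (by gcongr) hx)
  nonneg := h.nonneg
  up r x z hr hr0 hx hz := (h.up r x z hr hr0 hx hz).trans
    (mul_le_mul_of_nonneg_right (by gcongr) (kap_nonneg n _))
  low r x z hr hr0 hx hz hxz := by
    have := h.one
    refine le_trans ?_ (h.low r x z hr hr0 hx hz (hxz.trans ?_))
    · exact div_le_div_of_nonneg_left (kap_nonneg n _) (by positivity) (by gcongr)
    · gcongr
  diff r x z hr hr0 hx hz := (h.diff r x z hr hr0 hx hz).trans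
    (mul_le_mul_of_nonneg_right hC (kap_nonneg n _))

lemma exists_BK (R : ℝ) : ∃ C r0, L.Bd R C ∧ L.KB R C r0 := by
  obtain ⟨C1, h1⟩ := L.exists_Bd R
  obtain ⟨C2, r0, h2⟩ := L.exists_KB R
  exact ⟨max C1 C2, r0, Bd.mono L h1 (le_max_left _ _), KB.mono L h2 (le_max_right _ _)⟩

lemma measurable_hd (n : ℕ) (r : ℝ) : Measurable (hd n r) := by
  unfold hd
  have := q_smooth.continuous.measurable
  fun_prop

lemma measurable_hdd (n : ℕ) (r : ℝ) : Measurable (hdd n r) := by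
  unfold hdd
  have := q_smooth.continuous.measurable
  have := q1_smooth.continuous.measurable
  fun_prop

lemma measurable_ker (r : ℝ) (z : E) : Measurable (L.ker r z) := by
  unfold ker
  have h1 : Measurable fun x => L.Q z (x - z) := by
    have := L.cont_Q.comp (f := fun x : E => (z, x - z)) (by fun_prop)
    exact this.measurable
  have h2 : Measurable fun x => L.a4 x z (x - z) := by
    have := L.cont_a4.comp (f := fun x : E => (x, z, x - z)) (by fun_prop)
    exact this.measurable
  have h3 : Measurable fun x => L.tau x z := by
    have := L.cont_tau.comp (f := fun x : E => (x, z)) (by fun_prop)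
    exact this.measurable
  exact ((((measurable_hdd n r).comp h1).const_mul 4).mul h2).add
    ((((measurable_hd n r).comp h1).const_mul 2).mul h3)

lemma continuousAt_hd {r t : ℝ} (ht : 0 < t) : ContinuousAt (hd n r) t := by
  unfold hd
  have h := q_smooth.continuous
  have : ContinuousAt (fun t : ℝ => (t ^ n)⁻¹) t :=
    ContinuousAt.inv₀ (by fun_prop) (by positivity)
  have h2 : ContinuousAt (fun t : ℝ => q (√t / r)) t := by fun_prop
  exact (this.mul h2).neg

lemma continuousAt_hdd {r t : ℝ} (ht : 0 < t) : ContinuousAt (hdd n r) t := by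
  unfold hdd
  have h := q_smooth.continuous
  have h' := q1_smooth.continuous
  have : ContinuousAt (fun t : ℝ => (t ^ (n + 1))⁻¹) t :=
    ContinuousAt.inv₀ (by fun_prop) (by positivity)
  refine this.mul ?_
  fun_prop

lemma continuousAt_ker (r : ℝ) (z x : E) (hxz : x ≠ z) :
    ContinuousAt (fun z => L.ker r z x) z := by
  unfold ker
  have h1 : Continuous fun z => L.Q z (x - z) :=
    L.cont_Q.comp (f := fun z : E => (z, x - z)) (by fun_prop)
  have h2 : Continuous fun z => L.a4 x z (x - z) :=
    L.cont_a4.comp (f := fun z : E => (x, z, x - z)) (by fun_prop)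
  have h3 : Continuous fun z => L.tau x z :=
    L.cont_tau.comp (f := fun z : E => (x, z)) (by fun_prop)
  have hp : 0 < L.Q z (x - z) := L.Q_pos z _ (sub_ne_zero.2 hxz)
  have a1 : ContinuousAt (fun z => hdd n r (L.Q z (x - z))) z :=
    ContinuousAt.comp (f := fun z => L.Q z (x - z)) (continuousAt_hdd hp) h1.continuousAt
  have a2 : ContinuousAt (fun z => hd n r (L.Q z (x - z))) z :=
    ContinuousAt.comp (f := fun z => L.Q z (x - z)) (continuousAt_hd hp) h1.continuousAt
  exact ((continuousAt_const.mul a1).mul h2.continuousAt).add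
    ((continuousAt_const.mul a2).mul h3.continuousAt)

section
variable {R C r0 : ℝ} (hK : L.KB R C r0) {r : ℝ} (hr : 0 < r) (hr0 : r ≤ r0) (hCr : C * r ≤ 1)
  {z : E} (hz : ‖z‖ ≤ R - 1)

lemma ker_nonneg (hK : L.KB R C r0) (hr : 0 < r) (hr0 : r ≤ r0) (hCr : C * r ≤ 1)
    (hz : ‖z‖ ≤ R - 1) (x : E) : 0 ≤ L.ker r z x := by
  by_cases h : C * r ≤ ‖x - z‖
  · rw [hK.zero r x z hr (by linarith) h]
  · have : ‖x‖ ≤ ‖x - z‖ + ‖z‖ := by simpa using norm_add_le (x - z) z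
    push Not at h
    exact hK.nonneg r x z hr hr0 (by linarith) (by linarith)

lemma ker_le (hK : L.KB R C r0) (hr : 0 < r) (hr0 : r ≤ r0) (hCr : C * r ≤ 1)
    (hz : ‖z‖ ≤ R - 1) (x : E) :
    L.ker r z x ≤ C / r * (ball (0 : E) (C * r)).indicator (kap n) (x - z) := by
  by_cases h : C * r ≤ ‖x - z‖
  · rw [hK.zero r x z hr (by linarith) h, Set.indicator_of_notMem (by simpa using h)]
    simp
  · have : ‖x‖ ≤ ‖x - z‖ + ‖z‖ := by simpa using norm_add_le (x - z) z
    push Not at h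
    rw [Set.indicator_of_mem (by simpa using h)]
    exact hK.up r x z hr hr0 (by linarith) (by linarith)

lemma kap_ind_int (L : Ell n E ι) (ρ : ℝ) (hρ : 0 < ρ) (z : E) :
    Integrable (fun x => (ball (0 : E) ρ).indicator (kap n) (x - z)) μ := by
  obtain ⟨c, hc, h⟩ := L.kap_int μ
  exact ((integrable_indicator_iff measurableSet_ball).2 (h ρ hρ).1).comp_sub_right z

lemma ker_int (hK : L.KB R C r0) (hr : 0 < r) (hr0 : r ≤ r0) (hCr : C * r ≤ 1)
    (hz : ‖z‖ ≤ R - 1) : Integrable (L.ker r z) μ := by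
  have hC := hK.one
  refine ((L.kap_ind_int μ (C * r) (by positivity) z).const_mul (C / r)).mono'
    (L.measurable_ker r z).aestronglyMeasurable (ae_of_all _ fun x => ?_)
  rw [Real.norm_of_nonneg (L.ker_nonneg hK hr hr0 hCr hz x)]
  exact L.ker_le hK hr hr0 hCr hz x

lemma ker_low (hK : L.KB R C r0) : ∃ m, 0 < m ∧ ∀ (r : ℝ) (z : E), 0 < r → r ≤ r0 → C * r ≤ 1 →
    ‖z‖ ≤ R - 1 → m ≤ ∫ x, L.ker r z x ∂μ := by
  have hC := hK.one
  obtain ⟨c, hc, h⟩ := L.kap_int μ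
  refine ⟨c / C ^ 2, by positivity, fun r z hr hr0 hCr hz => ?_⟩
  have hρ : 0 < r / C := by positivity
  have h1 : ∫ x, (ball (0 : E) (r / C)).indicator (kap n) (x - z) ∂μ = c * (r / C) := by
    rw [integral_sub_right_eq_self, integral_indicator measurableSet_ball, (h _ hρ).2]
  have h2 : ∫ x, (C * r)⁻¹ * (ball (0 : E) (r / C)).indicator (kap n) (x - z) ∂μ ≤
      ∫ x, L.ker r z x ∂μ := by
    refine integral_mono ((L.kap_ind_int μ _ hρ z).const_mul _)
      (L.ker_int μ hK hr hr0 hCr hz) fun x => ?_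
    by_cases hx : x - z ∈ ball (0 : E) (r / C)
    · have hx' := hx
      rw [mem_ball_zero_iff] at hx'
      have h3 : r / C ≤ 1 := by
        rw [div_le_iff₀ (by linarith)]
        nlinarith
      have : ‖x‖ ≤ ‖x - z‖ + ‖z‖ := by simpa using norm_add_le (x - z) z
      have := hK.low r x z hr hr0 (by linarith) (by linarith) hx'.le
      simp only [Set.indicator_of_mem hx]
      rwa [div_eq_inv_mul] at this
    · simp only [Set.indicator_of_notMem hx, mul_zero]
      exact L.ker_nonneg hK hr hr0 hCr hz x
  rw [integral_const_mul, h1] at h2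
  refine le_trans (le_of_eq ?_) h2
  field_simp

lemma ker_pos (hK : L.KB R C r0) (hr : 0 < r) (hr0 : r ≤ r0) (hCr : C * r ≤ 1)
    (hz : ‖z‖ ≤ R - 1) : 0 < ∫ x, L.ker r z x ∂μ := by
  obtain ⟨m, hm, h⟩ := L.ker_low μ hK
  exact hm.trans_le (h r z hr hr0 hCr hz)

lemma ker_mul_int (hK : L.KB R C r0) (hr : 0 < r) (hr0 : r ≤ r0) (hCr : C * r ≤ 1)
    (hz : ‖z‖ ≤ R - 1) (w : E → ℝ) (hw : Measurable w) (M : ℝ) (hM : ∀ x, |w x| ≤ M) :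
    Integrable (fun x => w x * L.ker r z x) μ :=
  (L.ker_int μ hK hr hr0 hCr hz).bdd_mul hw.aestronglyMeasurable (ae_of_all _ hM)

/-- cutoff away from the origin -/
noncomputable def cut (δ : ℝ) (y : E) : ℝ := min 1 (max 0 (‖y‖ / δ - 1))

lemma cut_nonneg (δ : ℝ) (y : E) : 0 ≤ cut δ y := le_min zero_le_one (le_max_left _ _)
lemma cut_le (δ : ℝ) (y : E) : cut δ y ≤ 1 := min_le_left _ _
lemma cut_zero {δ : ℝ} (hδ : 0 < δ) {y : E} (h : ‖y‖ ≤ δ) : cut δ y = 0 := by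
  unfold cut
  have : ‖y‖ / δ - 1 ≤ 0 := by
    rw [sub_nonpos, div_le_one hδ]; exact h
  rw [max_eq_left this]; simp
lemma cut_one {δ : ℝ} (hδ : 0 < δ) {y : E} (h : 2 * δ ≤ ‖y‖) : cut δ y = 1 := by
  unfold cut
  have : 1 ≤ ‖y‖ / δ - 1 := by
    rw [le_sub_iff_add_le, le_div_iff₀ hδ]; linarith
  rw [min_eq_left (this.trans (le_max_right _ _))]

lemma ker_cont (hK : L.KB R C r0) (hr : 0 < r) (hr0 : r ≤ r0) (hCr : C * r ≤ 1)
    (hz : ‖z‖ < R - 1) (w : E → ℝ) (hw : Measurable w) (M : ℝ) (hM : ∀ x, |w x| ≤ M) :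
    ContinuousAt (fun z => ∫ x, w x * L.ker r z x ∂μ) z := by
  have hC := hK.one
  have hM0 : 0 ≤ M := (abs_nonneg _).trans (hM 0)
  obtain ⟨c, hc, hkap⟩ := L.kap_int μ
  have hnear : ∀ᶠ z' in 𝓝 z, ‖z'‖ < R - 1 := (continuous_norm.tendsto z).eventually_lt_const hz
  -- cutoff integrals are continuous
  have h1 : ∀ δ, 0 < δ → ContinuousAt
      (fun z => ∫ x, w x * L.ker r z x * cut δ (x - z) ∂μ) z := by
    intro δ hδ
    refine continuousAt_of_dominated (bound := fun x => (ball (0 : E) R).indicator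
      (fun _ => M * (C / r * (δ ^ (2 * n - 1))⁻¹)) x) ?_ ?_ ?_ ?_
    · filter_upwards with z'
      have : Measurable fun x : E => cut δ (x - z') := by unfold cut; fun_prop
      exact ((hw.mul (L.measurable_ker r z')).mul this).aestronglyMeasurable
    · filter_upwards [hnear] with z' hz'
      refine ae_of_all _ fun x => ?_
      have k0 := L.ker_nonneg hK hr hr0 hCr hz'.le x
      have k1 := L.ker_le hK hr hr0 hCr hz'.le x
      by_cases hx : x - z' ∈ ball (0 : E) (C * r)
      · have hx' := hx
        rw [mem_ball_zero_iff] at hx'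
        have : ‖x‖ ≤ ‖x - z'‖ + ‖z'‖ := by simpa using norm_add_le (x - z') z'
        rw [Set.indicator_of_mem (by rw [mem_ball_zero_iff]; linarith)]
        rw [Set.indicator_of_mem hx] at k1
        by_cases hd : ‖x - z'‖ ≤ δ
        · rw [cut_zero hδ hd]
          simp
          positivity
        · push Not at hd
          rw [norm_mul, norm_mul, Real.norm_eq_abs, Real.norm_of_nonneg k0,
            Real.norm_of_nonneg (cut_nonneg _ _), mul_assoc]
          apply mul_le_mul (hM x) _ (mul_nonneg k0 (cut_nonneg _ _)) hM0
          calc _ ≤ L.ker r z' x * 1 := by gcongr; exact cut_le _ _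
            _ ≤ C / r * kap n (x - z') := by rw [mul_one]; exact k1
            _ ≤ _ := by unfold kap; gcongr
      · rw [Set.indicator_of_notMem hx, mul_zero] at k1
        have : L.ker r z' x = 0 := le_antisymm k1 k0
        rw [this]
        simp only [mul_zero, zero_mul, norm_zero]
        apply Set.indicator_nonneg
        intro x _
        positivity
    · exact (integrable_indicator_iff measurableSet_ball).2
        (integrableOn_const measure_ball_lt_top.ne)
    · have : ∀ᵐ x ∂μ, x ≠ z := by
        have := L.nontriv
        have : μ {z} = 0 := measure_singleton z
        rw [ae_iff]; simp
      filter_upwards [this] with x hx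
      have hc : Continuous fun z : E => cut δ (x - z) := by unfold cut; fun_prop
      exact (continuousAt_const.mul (L.continuousAt_ker r z x hx)).mul hc.continuousAt
  -- error
  have h2 : ∀ δ, 0 < δ → ∀ z', ‖z'‖ < R - 1 →
      |∫ x, w x * L.ker r z' x ∂μ - ∫ x, w x * L.ker r z' x * cut δ (x - z') ∂μ| ≤
        M * (C / r * (c * (2 * δ))) := by
    intro δ hδ z' hz'
    have i1 := L.ker_mul_int μ hK hr hr0 hCr hz'.le w hw M hM
    have mc : Measurable fun x : E => cut δ (x - z') := by unfold cut; fun_prop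
    have i2 : Integrable (fun x => w x * L.ker r z' x * cut δ (x - z')) μ := by
      refine i1.mul_bdd (c := 1) mc.aestronglyMeasurable (ae_of_all _ fun x => ?_)
      rw [Real.norm_of_nonneg (cut_nonneg _ _)]
      exact cut_le _ _
    rw [← integral_sub i1 i2, ← Real.norm_eq_abs]
    have e : ∫ x, M * (C / r * (ball (0 : E) (2 * δ)).indicator (kap n) (x - z')) ∂μ =
        M * (C / r * (c * (2 * δ))) := by
      rw [integral_const_mul, integral_const_mul, integral_sub_right_eq_self,
        integral_indicator measurableSet_ball, (hkap _ (by positivity)).2]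
    rw [← e]
    refine norm_integral_le_of_norm_le
      (((L.kap_ind_int μ _ (by positivity) z').const_mul _).const_mul _) (ae_of_all _ fun x => ?_)
    have k0 := L.ker_nonneg hK hr hr0 hCr hz'.le x
    have k1 := L.ker_le hK hr hr0 hCr hz'.le x
    have k2 : L.ker r z' x ≤ C / r * kap n (x - z') := by
      refine k1.trans ?_
      gcongr
      exact Set.indicator_le_self' (fun _ _ => kap_nonneg n _) _
    have e2 : w x * L.ker r z' x - w x * L.ker r z' x * cut δ (x - z') =
      w x * (L.ker r z' x * (1 - cut δ (x - z'))) := by ring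
    rw [e2]
    by_cases hx : x - z' ∈ ball (0 : E) (2 * δ)
    · rw [Set.indicator_of_mem hx, norm_mul, norm_mul, Real.norm_eq_abs, Real.norm_of_nonneg k0,
        Real.norm_of_nonneg (sub_nonneg.2 (cut_le _ _))]
      have := sub_nonneg.2 (cut_le δ (x - z'))
      apply mul_le_mul (hM x) _ (by positivity) hM0
      calc _ ≤ L.ker r z' x * 1 := by
            gcongr
            have := cut_nonneg δ (x - z'); linarith
        _ ≤ _ := by rw [mul_one]; exact k2
    · rw [Set.indicator_of_notMem hx, cut_one hδ (by simpa using hx)]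
      simp
  -- conclude
  rw [Metric.continuousAt_iff']
  intro ε hε
  set B := M * (C / r * (c * 2)) with hB
  have hB0 : 0 ≤ B := by positivity
  set δ := ε / (4 * (B + 1)) with hδ
  have hδ0 : 0 < δ := by positivity
  have hBδ : M * (C / r * (c * (2 * δ))) ≤ ε / 4 := by
    have : M * (C / r * (c * (2 * δ))) = B * δ := by rw [hB]; ring
    rw [this, hδ]
    rw [mul_div_assoc', div_le_div_iff₀ (by positivity) (by positivity)]
    nlinarith
  have h3 := Metric.continuousAt_iff'.1 (h1 δ hδ0) (ε / 2) (by positivity)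
  filter_upwards [h3, hnear] with z' h3 hz'
  have a := h2 δ hδ0 z' hz'
  have b := h2 δ hδ0 z hz
  rw [Real.dist_eq] at h3 ⊢
  rw [abs_lt] at h3 ⊢
  rw [abs_le] at a b
  constructor <;> linarith [h3.1, h3.2, a.1, a.2, b.1, b.2]

end

end Ell

namespace Ell

variable {n : ℕ} {E ι : Type} [NormedAddCommGroup E] [NormedSpace ℝ E]
  [FiniteDimensional ℝ E] [Fintype ι] [DecidableEq ι] [MeasurableSpace E] [BorelSpace E]
  (μ : Measure E) [μ.IsAddHaarMeasure]

/-- Lebesgue points, normalised by the volume scale -/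
def LebPt (n : ℕ) (u : E → ℝ) (x : E) : Prop :=
  Tendsto (fun s : ℝ => (s ^ (2 * n))⁻¹ * ∫ y in closedBall x s, |u y - u x| ∂μ) (𝓝[>] 0) (𝓝 0)

lemma lebPt_congr (n : ℕ) {u u' : E → ℝ} {x : E} (h : ∀ᶠ y in 𝓝 x, u y = u' y)
    (hx : LebPt μ n u x) : LebPt μ n u' x := by
  unfold LebPt at *
  refine hx.congr' ?_
  obtain ⟨ε, hε, hb⟩ := Metric.eventually_nhds_iff_ball.1 h
  have : ∀ᶠ s : ℝ in 𝓝[>] 0, s < ε := nhdsWithin_le_nhds (eventually_lt_nhds hε)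
  filter_upwards [this] with s hs
  congr 1
  refine setIntegral_congr_fun measurableSet_closedBall fun y hy => ?_
  have h1 := hb y (closedBall_subset_ball hs hy)
  have h2 := hb x (mem_ball_self hε)
  simp only [h1, h2]

variable (L : Ell n E ι)

lemma lebPt_ae (L : Ell n E ι) {u : E → ℝ} (hu : LocallyIntegrable u μ) : ∀ᵐ x ∂μ, LebPt μ n u x := by
  have := L.nontriv
  filter_upwards [IsUnifLocDoublingMeasure.ae_tendsto_average_norm_sub (μ := μ) hu 1] with x hx
  have h1 := hx (l := 𝓝[>] (0 : ℝ)) (fun _ => x) (fun s => s) tendsto_id (by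
    filter_upwards [self_mem_nhdsWithin] with s hs
    simp at hs ⊢
    exact hs.le)
  have h2 := h1.const_mul (μ.real (ball (0 : E) 1))
  rw [mul_zero] at h2
  refine h2.congr' ?_
  filter_upwards [self_mem_nhdsWithin] with s hs
  have hs : 0 < s := hs
  rw [setAverage_eq]
  simp only [measureReal_def]
  rw [Measure.addHaar_closedBall _ _ hs.le, L.finrank_eq]
  have hb : (μ (ball (0 : E) 1)).toReal ≠ 0 :=
    (ENNReal.toReal_pos (measure_ball_pos μ _ one_pos).ne' measure_ball_lt_top.ne).ne'
  rw [ENNReal.toReal_mul, ENNReal.toReal_ofReal (by positivity), smul_eq_mul]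
  simp only [Real.norm_eq_abs]
  field_simp

lemma lebPt_D (L : Ell n E ι) {u : E → ℝ} {D : Set E} (hD : IsOpen D)
    (hu : LocallyIntegrableOn u D μ) : ∀ᵐ x ∂μ, x ∈ D → LebPt μ n u x := by
  rw [ae_iff]
  apply measure_null_of_locally_null
  intro x hx
  simp only [Set.mem_ofPred_eq, Classical.not_imp] at hx
  obtain ⟨ε, hε, hb⟩ := Metric.nhds_basis_closedBall.mem_iff.1 (hD.mem_nhds hx.1)
  have h1 : IntegrableOn u (closedBall x ε) μ :=
    hu.integrableOn_compact_subset hb (isCompact_closedBall x ε)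
  have h2 : Integrable ((closedBall x ε).indicator u) μ :=
    (integrable_indicator_iff measurableSet_closedBall).2 h1
  have h3 := lebPt_ae μ L h2.locallyIntegrable
  refine ⟨ball x ε ∩ {x | ¬ (x ∈ D → LebPt μ n u x)}, ?_, ?_⟩
  · rw [Set.inter_comm]
    exact inter_mem self_mem_nhdsWithin (nhdsWithin_le_nhds (ball_mem_nhds x hε))
  · refine measure_mono_null ?_ (ae_iff.1 h3)
    rintro y ⟨hy, hy'⟩ h4
    simp only [Set.mem_ofPred_eq, Classical.not_imp] at hy'
    apply hy'.2
    refine lebPt_congr μ n ?_ h4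
    filter_upwards [isOpen_ball.mem_nhds hy] with w hw
    exact Set.indicator_of_mem (ball_subset_closedBall hw) u

/-- distributional subsolution -/
structure Sub (L : Ell n E ι) (D : Set E) (u : E → ℝ) : Prop where
  li : LocallyIntegrableOn u D μ
  pos : ∀ φ : E → ℝ, ContDiff ℝ (⊤ : ℕ∞) φ → HasCompactSupport φ → tsupport φ ⊆ D →
    (∀ z, 0 ≤ φ z) → 0 ≤ ∫ z in D, u z * L.op φ z ∂μ

lemma op_integrable (φ : E → ℝ) (hφ : ContDiff ℝ 2 φ) (hcs : HasCompactSupport φ) :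
    Integrable (L.op φ) μ :=
  (L.op_cont φ hφ).integrable_of_hasCompactSupport (L.op_cs φ hcs)

lemma mul_op_integrable {D : Set E} (hD : IsOpen D) {u : E → ℝ} (hu : LocallyIntegrableOn u D μ)
    (φ : E → ℝ) (hφ : ContDiff ℝ 2 φ)
    (hcs : HasCompactSupport φ) (hs : tsupport φ ⊆ D) :
    IntegrableOn (fun x => u x * L.op φ x) D μ := by
  have h1 : IntegrableOn u (tsupport φ) μ := hu.integrableOn_compact_subset hs hcs
  have h2 : IntegrableOn (fun x => u x * L.op φ x) (tsupport φ) μ :=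
    h1.mul_continuousOn (L.op_cont φ hφ).continuousOn hcs
  refine (IntegrableOn.of_forall_sdiff_eq_zero h2 hD.measurableSet ?_ : _)
  intro x hx
  rw [L.op_eq_zero φ x hx.2, mul_zero]

lemma int_op_D {D : Set E} (φ : E → ℝ) (hφ : ContDiff ℝ 2 φ)
    (hcs : HasCompactSupport φ) (hs : tsupport φ ⊆ D) : ∫ x in D, L.op φ x ∂μ = 0 := by
  rw [setIntegral_eq_integral_of_forall_compl_eq_zero, L.int_op μ φ hφ hcs]
  intro x hx
  exact L.op_eq_zero φ x fun h => hx (hs h)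

variable {R C r0 : ℝ} {r : ℝ} {z : E}

lemma mean_leb {D : Set E} (hD : IsOpen D) (hB : L.Bd R C) (hK : L.KB R C r0) (hr : 0 < r) (hr0 : r ≤ r0)
    (hCr : C * r ≤ 1) (hz : ‖z‖ ≤ R - 1) (hDz : closedBall z (C * r) ⊆ D) {u : E → ℝ}
    (hu : L.Sub μ D u) (hL : LebPt μ n u z) (w : E → ℝ) (hw : Measurable w) (M : ℝ)
    (hM : ∀ x, |w x| ≤ M) (huw : ∀ x ∈ D, u x ≤ w x) :
    u z * ∫ x, L.ker r z x ∂μ ≤ ∫ x, w x * L.ker r z x ∂μ := by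
  have hC := hK.one
  have hzR : ‖z‖ ≤ R := by linarith
  obtain ⟨M1, hM1, hop⟩ := L.tf_op_bound hB
  set F : E → ℝ := fun x => (w x - u z) * L.ker r z x with hF
  have iF : Integrable F μ := by
    refine L.ker_mul_int μ hK hr hr0 hCr hz (fun x => w x - u z) (hw.sub_const _) (M + |u z|) ?_
    intro x
    exact (abs_sub _ _).trans (add_le_add (hM x) le_rfl)
  let A : ℝ → Set E := fun s => {x | s ^ 2 ≤ L.Q z (x - z)}
  have cQ : Continuous fun x => L.Q z (x - z) :=
    L.cont_Q.comp (f := fun x : E => (z, x - z)) (by fun_prop)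
  have mA : ∀ s, MeasurableSet (A s) := fun s => (isClosed_le continuous_const cQ).measurableSet
  have key : ∀ s, 0 < s → s ≤ r → 0 ≤ ∫ x, (A s).indicator F x ∂μ +
      M1 * C ^ (2 * n) * (((C * s) ^ (2 * n))⁻¹ * ∫ y in closedBall z (C * s), |u y - u z| ∂μ) := by
    intro s hs hsr
    set φ := L.tf s r z with hφ
    have sm := L.tf_smooth (r := r) hs z
    have sm2 : ContDiff ℝ 2 φ := sm.of_le (by norm_cast)
    have ts := L.tf_tsupport hB hs hr z hzR
    have cs := L.tf_cs hB hs hr z hzR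
    have p0 := hu.pos φ sm cs (ts.trans hDz) (L.tf_nonneg hs hr z)
    have i1 := L.mul_op_integrable μ hD hu.li φ sm2 cs (ts.trans hDz)
    have i2 : IntegrableOn (fun x => u z * L.op φ x) D μ :=
      ((L.op_integrable μ φ sm2 cs).const_mul _).integrableOn
    have e1 : ∫ x in D, u x * L.op φ x ∂μ = ∫ x in D, (u x - u z) * L.op φ x ∂μ := by
      have : ∫ x in D, (u x - u z) * L.op φ x ∂μ =
          ∫ x in D, (u x * L.op φ x - u z * L.op φ x) ∂μ := by
        congr 1; ext x; ring
      rw [this, integral_sub i1 i2, integral_const_mul, L.int_op_D μ φ sm2 cs (ts.trans hDz)]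
      simp
    rw [e1] at p0
    have hCs : closedBall z (C * s) ⊆ D := (closedBall_subset_closedBall (by gcongr)).trans hDz
    have iu : IntegrableOn (fun y => |u y - u z|) (closedBall z (C * s)) μ := by
      have : IntegrableOn u (closedBall z (C * s)) μ :=
        hu.li.integrableOn_compact_subset hCs (isCompact_closedBall _ _)
      exact (this.sub (integrableOn_const measure_closedBall_lt_top.ne)).abs
    have e2 : M1 * C ^ (2 * n) * (((C * s) ^ (2 * n))⁻¹ * ∫ y in closedBall z (C * s), |u y - u z| ∂μ)
        = ∫ x, (closedBall z (C * s)).indicator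
          (fun y => M1 * (s ^ (2 * n))⁻¹ * |u y - u z|) x ∂μ := by
      rw [integral_indicator measurableSet_closedBall, integral_const_mul, mul_pow]
      have : C ^ (2 * n) ≠ 0 := by positivity
      field_simp
    rw [e2, ← integral_add (iF.indicator (mA s))
      ((integrable_indicator_iff measurableSet_closedBall).2 (iu.const_mul _))]
    refine p0.trans ?_
    rw [← integral_indicator hD.measurableSet]
    have i3 : IntegrableOn (fun x => (u x - u z) * L.op φ x) D μ := by
      refine (i1.sub i2).congr_fun (fun x _ => ?_) hD.measurableSet
      simp; ring
    refine integral_mono ((integrable_indicator_iff hD.measurableSet).2 i3)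
      ((iF.indicator (mA s)).add
        ((integrable_indicator_iff measurableSet_closedBall).2 (iu.const_mul _))) fun x => ?_
    have n2 : 0 ≤ (closedBall z (C * s)).indicator
        (fun y => M1 * (s ^ (2 * n))⁻¹ * |u y - u z|) x :=
      Set.indicator_nonneg (fun y _ => by positivity) x
    by_cases hxA : x ∈ A s
    · simp only [Pi.add_apply, Set.indicator_of_mem hxA]
      by_cases hxD : x ∈ D
      · rw [Set.indicator_of_mem hxD]
        have e3 : L.op φ x = L.ker r z x := L.tf_op_eq hs hr z x hxA
        have k0 := L.ker_nonneg hK hr hr0 hCr hz x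
        simp only [e3, hF]
        have := mul_le_mul_of_nonneg_right (sub_le_sub_right (huw x hxD) (u z)) k0
        linarith
      · rw [Set.indicator_of_notMem hxD]
        have e3 : L.ker r z x = 0 := by
          apply hK.zero r x z hr hzR
          by_contra h
          push Not at h
          exact hxD (hDz (by rw [mem_closedBall, dist_eq_norm]; exact h.le))
        simp only [hF, e3, mul_zero, zero_add]
        exact n2
    · simp only [Pi.add_apply, Set.indicator_of_notMem hxA, zero_add]
      have hQ : L.Q z (x - z) < s ^ 2 := by simpa [A] using hxA
      have h1 : ‖x - z‖ ≤ C * s := by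
        refine (hB.le_sig L z (x - z) hzR).trans ?_
        gcongr
        exact Real.sqrt_le_iff.2 ⟨hs.le, hQ.le⟩
      have hxb : x ∈ closedBall z (C * s) := by rw [mem_closedBall, dist_eq_norm]; exact h1
      rw [Set.indicator_of_mem (hCs hxb), Set.indicator_of_mem hxb]
      have hxR : ‖x‖ ≤ R := by
        have : ‖x‖ ≤ ‖x - z‖ + ‖z‖ := by simpa using norm_add_le (x - z) z
        have : C * s ≤ C * r := by gcongr
        linarith
      have h2 := hop s r x z hs hsr hxR hzR hQ
      refine (le_abs_self _).trans ?_
      rw [abs_mul, mul_comm]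
      exact mul_le_mul_of_nonneg_right h2 (abs_nonneg _)
  -- limit
  have hs0 : ∀ᶠ s : ℝ in 𝓝[>] 0, 0 < s ∧ s ≤ r := by
    filter_upwards [self_mem_nhdsWithin, nhdsWithin_le_nhds (eventually_le_nhds hr)] with s h1 h2
    exact ⟨h1, h2⟩
  have lim1 : Tendsto (fun s => ∫ x, (A s).indicator F x ∂μ) (𝓝[>] 0) (𝓝 (∫ x, F x ∂μ)) := by
    refine tendsto_integral_filter_of_dominated_convergence (fun x => ‖F x‖) ?_ ?_ iF.norm ?_
    · filter_upwards with s
      exact (iF.indicator (mA s)).aestronglyMeasurable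
    · filter_upwards with s
      exact ae_of_all _ fun x => norm_indicator_le_norm_self _ _
    · have := L.nontriv
      have : ∀ᵐ x ∂μ, x ≠ z := by rw [ae_iff]; simp
      filter_upwards [this] with x hx
      have hp := L.Q_pos z (x - z) (sub_ne_zero.2 hx)
      apply tendsto_const_nhds.congr'
      have h3 : ∀ᶠ s : ℝ in 𝓝[>] 0, s ^ 2 < L.Q z (x - z) := by
        apply nhdsWithin_le_nhds
        have : Tendsto (fun s : ℝ => s ^ 2) (𝓝 0) (𝓝 (0 ^ 2)) := (continuous_pow 2).tendsto 0
        exact this.eventually_lt_const (by simpa using hp)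
      filter_upwards [h3] with s hs
      exact (Set.indicator_of_mem (show x ∈ A s from hs.le) F).symm
  have lim2 : Tendsto (fun s => ((C * s) ^ (2 * n))⁻¹ *
      ∫ y in closedBall z (C * s), |u y - u z| ∂μ) (𝓝[>] 0) (𝓝 0) := by
    have : Tendsto (fun s : ℝ => C * s) (𝓝[>] 0) (𝓝[>] 0) := by
      refine tendsto_nhdsWithin_iff.2 ⟨?_, ?_⟩
      · have : Tendsto (fun s : ℝ => C * s) (𝓝 0) (𝓝 (C * 0)) := tendsto_id.const_mul C
        rw [mul_zero] at this
        exact this.mono_left nhdsWithin_le_nhds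
      · filter_upwards [self_mem_nhdsWithin] with s hs
        have hs : 0 < s := hs
        exact mul_pos (by linarith) hs
    exact Tendsto.comp (f := fun s : ℝ => C * s) hL this
  have lim3 := lim1.add (lim2.const_mul (M1 * C ^ (2 * n)))
  have h4 := ge_of_tendsto lim3 (hs0.mono fun s hs => key s hs.1 hs.2)
  rw [mul_zero, add_zero] at h4
  have e5 : ∫ x, F x ∂μ = ∫ x, w x * L.ker r z x ∂μ - u z * ∫ x, L.ker r z x ∂μ := by
    rw [← integral_const_mul, ← integral_sub (L.ker_mul_int μ hK hr hr0 hCr hz w hw M hM)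
      ((L.ker_int μ hK hr hr0 hCr hz).const_mul _)]
    congr 1; ext x; simp only [hF]; ring
  linarith

lemma mean_all {D : Set E} (hD : IsOpen D) (hB : L.Bd R C) (hK : L.KB R C r0) (hr : 0 < r) (hr0 : r ≤ r0)
    (hCr : C * r ≤ 1) (hz : ‖z‖ < R - 1) (hDz : closedBall z (2 * (C * r)) ⊆ D) {u : E → ℝ}
    (hu : L.Sub μ D u)
    (hsu : ∀ S : Set E, (∃ N ∈ 𝓝 z, μ (N \ S) = 0) → ∀ c : ℝ,
      (∀ᶠ y in 𝓝[S] z, u y ≤ c) → u z ≤ c)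
    (w : E → ℝ) (hw : Measurable w) (M : ℝ)
    (hM : ∀ x, |w x| ≤ M) (huw : ∀ x ∈ D, u x ≤ w x) :
    u z * ∫ x, L.ker r z x ∂μ ≤ ∫ x, w x * L.ker r z x ∂μ := by
  have hC := hK.one
  have kp := L.ker_pos μ hK hr hr0 hCr hz.le
  rw [← le_div_iff₀ kp]
  apply le_of_forall_gt_imp_ge_of_dense
  intro c hc
  have c1 := L.ker_cont μ hK hr hr0 hCr hz w hw M hM
  have c2 := L.ker_cont μ hK hr hr0 hCr hz (fun _ => 1) measurable_const 1 (by simp)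
  simp only [one_mul] at c2
  have c3 := c1.div c2 kp.ne'
  have h1 := c3.eventually_lt_const hc
  refine hsu {x | LebPt μ n u x} ⟨D, hD.mem_nhds (hDz (mem_closedBall_self (by positivity))), ?_⟩ c ?_
  · have := lebPt_D μ L hD hu.li
    rw [ae_iff] at this
    refine measure_mono_null ?_ this
    rintro x ⟨h1, h2⟩
    simp only [Set.mem_ofPred_eq, Classical.not_imp]
    exact ⟨h1, h2⟩
  · filter_upwards [self_mem_nhdsWithin, nhdsWithin_le_nhds h1,
      nhdsWithin_le_nhds ((continuous_norm.tendsto z).eventually_lt_const hz),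
      nhdsWithin_le_nhds (ball_mem_nhds z (show 0 < C * r by positivity))] with y y1 y2 y3 y4
    have k := L.mean_leb μ hD hB hK hr hr0 hCr y3.le (u := u) (z := y) ?_ hu y1 w hw M hM huw
    · have kp' := L.ker_pos μ hK hr hr0 hCr y3.le
      rw [← le_div_iff₀ kp'] at k
      exact k.trans y2.le
    · refine (closedBall_subset_closedBall' ?_).trans hDz
      rw [mem_ball] at y4
      linarith

end Ell

namespace Ell

variable {n : ℕ} {E ι : Type} [NormedAddCommGroup E] [NormedSpace ℝ E]
  [FiniteDimensional ℝ E] [Fintype ι] [DecidableEq ι] [MeasurableSpace E] [BorelSpace E]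
  (μ : Measure E) [μ.IsAddHaarMeasure]

variable (L : Ell n E ι) {R C r0 : ℝ} {z : E}

lemma le_of_mean_leb (hK : L.KB R C r0) (hz : ‖z‖ ≤ R - 1) (W : E → ℝ) (hW : Measurable W) (M : ℝ)
    (hM : ∀ x, |W x| ≤ M) (hL : LebPt μ n W z) (v : ℝ) (r1 : ℝ) (hr1 : 0 < r1)
    (hv : ∀ r, 0 < r → r ≤ r1 → v * ∫ x, L.ker r z x ∂μ ≤ ∫ x, W x * L.ker r z x ∂μ) :
    v ≤ W z := by
  have hC := hK.one
  have hC0 : 0 < C := by linarith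
  have hn := L.hn
  have hr0p := hK.r0pos
  have hM0 : 0 ≤ M := (abs_nonneg _).trans (hM 0)
  obtain ⟨m, hm, hlow⟩ := L.ker_low μ hK
  obtain ⟨c, hc, hkap⟩ := L.kap_int μ
  by_contra hlt
  push Not at hlt
  set d := v - W z with hd
  have hd0 : 0 < d := by linarith
  have key : ∀ η, 0 < η → ∀ r, 0 < r → r ≤ r1 → r ≤ r0 → C * r ≤ 1 →
      d * m ≤ C / r * (2 * M * (c * (η * r))) + C * (η ^ (2 * n - 1))⁻¹ * C ^ (2 * n) *
        (((C * r) ^ (2 * n))⁻¹ * ∫ y in closedBall z (C * r), |W y - W z| ∂μ) := by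
    intro η hη r hr hrr1 hrr0 hCr
    have iW : IntegrableOn (fun y => |W y - W z|) (closedBall z (C * r)) μ := by
      refine Measure.integrableOn_of_bounded (M := 2 * M) measure_closedBall_lt_top.ne
        ((hW.sub_const _).abs).aestronglyMeasurable (ae_of_all _ fun y => ?_)
      rw [Real.norm_eq_abs, abs_abs]
      have := (abs_sub (W y) (W z)).trans (add_le_add (hM y) (hM z))
      linarith
    have h1 : d * m ≤ d * ∫ x, L.ker r z x ∂μ := by
      have := hlow r z hr hrr0 hCr hz
      gcongr
    have i1 := L.ker_mul_int μ hK hr hrr0 hCr hz W hW M hM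
    have i2 := (L.ker_int μ hK hr hrr0 hCr hz).const_mul (W z)
    have h2 : d * ∫ x, L.ker r z x ∂μ ≤ ∫ x, (W x * L.ker r z x - W z * L.ker r z x) ∂μ := by
      rw [integral_sub i1 i2, integral_const_mul, hd, sub_mul]
      have := hv r hr hrr1
      linarith
    refine h1.trans (h2.trans ?_)
    have e1 : C / r * (2 * M * (c * (η * r))) = ∫ x, C / r * (2 * M *
        (ball (0 : E) (η * r)).indicator (kap n) (x - z)) ∂μ := by
      rw [integral_const_mul, integral_const_mul, integral_sub_right_eq_self,
        integral_indicator measurableSet_ball, (hkap _ (by positivity)).2]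
    have e2 : C * (η ^ (2 * n - 1))⁻¹ * C ^ (2 * n) *
        (((C * r) ^ (2 * n))⁻¹ * ∫ y in closedBall z (C * r), |W y - W z| ∂μ) =
        ∫ x, (closedBall z (C * r)).indicator
          (fun y => C / r * ((η * r) ^ (2 * n - 1))⁻¹ * |W y - W z|) x ∂μ := by
      rw [integral_indicator measurableSet_closedBall, integral_const_mul, mul_pow, mul_pow]
      obtain ⟨N, hN⟩ : ∃ N, 2 * n = N + 1 := ⟨2 * n - 1, by omega⟩
      have : 2 * n - 1 = N := by omega
      rw [this, hN, pow_succ r]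
      have : C ^ (N + 1) ≠ 0 := by positivity
      field_simp
    rw [e1, e2, ← integral_add (((L.kap_ind_int μ _ (by positivity) z).const_mul _).const_mul _)
      ((integrable_indicator_iff measurableSet_closedBall).2 (iW.const_mul _))]
    refine integral_mono (i1.sub i2)
      ((((L.kap_ind_int μ _ (by positivity) z).const_mul _).const_mul _).add
      ((integrable_indicator_iff measurableSet_closedBall).2 (iW.const_mul _))) fun x => ?_
    have k0 := L.ker_nonneg hK hr hrr0 hCr hz x
    have k1 := L.ker_le hK hr hrr0 hCr hz x
    have n1 : 0 ≤ C / r * (2 * M * (ball (0 : E) (η * r)).indicator (kap n) (x - z)) := by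
      have : 0 ≤ (ball (0 : E) (η * r)).indicator (kap n) (x - z) :=
        Set.indicator_nonneg (fun _ _ => kap_nonneg n _) _
      positivity
    have n2 : 0 ≤ (closedBall z (C * r)).indicator
          (fun y => C / r * ((η * r) ^ (2 * n - 1))⁻¹ * |W y - W z|) x :=
      Set.indicator_nonneg (fun _ _ => by positivity) _
    by_cases hx : x - z ∈ ball (0 : E) (C * r)
    · rw [Set.indicator_of_mem hx] at k1
      have hx' := hx
      rw [mem_ball_zero_iff] at hx'
      have e3 : W x * L.ker r z x - W z * L.ker r z x ≤ |W x - W z| * (C / r * kap n (x - z)) := by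
        rw [← sub_mul]
        exact mul_le_mul (le_abs_self _) k1 k0 (abs_nonneg _)
      refine e3.trans ?_
      by_cases hx2 : x - z ∈ ball (0 : E) (η * r)
      · rw [Set.indicator_of_mem hx2] at n1
        simp only [Set.indicator_of_mem hx2]
        have : |W x - W z| ≤ 2 * M := by
          have := (abs_sub (W x) (W z)).trans (add_le_add (hM x) (hM z))
          linarith
        have h5 : |W x - W z| * (C / r * kap n (x - z)) ≤ 2 * M * (C / r * kap n (x - z)) :=
          mul_le_mul_of_nonneg_right this (mul_nonneg (by positivity) (kap_nonneg n _))
        linarith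
      · have hx3 : η * r ≤ ‖x - z‖ := by simpa using hx2
        have hx4 : x ∈ closedBall z (C * r) := by
          rw [mem_closedBall, dist_eq_norm]; exact hx'.le
        simp only [Set.indicator_of_notMem hx2, Set.indicator_of_mem hx4]
        rw [mul_zero, mul_zero, zero_add, mul_comm]
        gcongr
        unfold kap
        gcongr
    · rw [Set.indicator_of_notMem hx, mul_zero] at k1
      have : L.ker r z x = 0 := le_antisymm k1 k0
      simp only [this, mul_zero, sub_zero]
      exact add_nonneg n1 n2
  have key2 : ∀ η, 0 < η → d * m ≤ C * (2 * M * c) * η := by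
    intro η hη
    have lim2 : Tendsto (fun s => ((C * s) ^ (2 * n))⁻¹ *
      ∫ y in closedBall z (C * s), |W y - W z| ∂μ) (𝓝[>] 0) (𝓝 0) := by
      have : Tendsto (fun s : ℝ => C * s) (𝓝[>] 0) (𝓝[>] 0) := by
        refine tendsto_nhdsWithin_iff.2 ⟨?_, ?_⟩
        · have : Tendsto (fun s : ℝ => C * s) (𝓝 0) (𝓝 (C * 0)) := tendsto_id.const_mul C
          rw [mul_zero] at this
          exact this.mono_left nhdsWithin_le_nhds
        · filter_upwards [self_mem_nhdsWithin] with s hs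
          have hs : 0 < s := hs
          exact mul_pos (by linarith) hs
      exact Tendsto.comp (f := fun s : ℝ => C * s) hL this
    have lim3 := (lim2.const_mul (C * (η ^ (2 * n - 1))⁻¹ * C ^ (2 * n))).const_add
      (C * (2 * M * c) * η)
    rw [mul_zero, add_zero] at lim3
    refine ge_of_tendsto lim3 ?_
    filter_upwards [self_mem_nhdsWithin, nhdsWithin_le_nhds (eventually_le_nhds hr1),
      nhdsWithin_le_nhds (eventually_le_nhds hr0p),
      nhdsWithin_le_nhds (eventually_le_nhds (show 0 < 1 / C by positivity))] with r h1 h2 h3 h4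
    have h1 : 0 < r := h1
    have := key η hη r h1 h2 h3 (by rw [le_div_iff₀ hC0] at h4; linarith)
    refine this.trans (le_of_eq ?_)
    congr 1
    field_simp
  have lim4 : Tendsto (fun η : ℝ => C * (2 * M * c) * η) (𝓝[>] 0) (𝓝 (C * (2 * M * c) * 0)) :=
    ((continuous_const.mul continuous_id).tendsto 0).mono_left nhdsWithin_le_nhds
  have h6 := ge_of_tendsto lim4 (by
    filter_upwards [self_mem_nhdsWithin] with η hη using key2 η hη)
  rw [mul_zero] at h6
  have : 0 < d * m := by positivity
  linarith

/-- the mean inequality gives strong upper semicontinuity -/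
lemma strong_of_mean (hK : L.KB R C r0) (hz : ‖z‖ ≤ R - 1) (W v : E → ℝ) (hW : Measurable W) (M : ℝ)
    (hM : ∀ x, |W x| ≤ M) (D : Set E) (hD : IsOpen D) (hzD : z ∈ D) (hWv : ∀ x ∈ D, W x ≤ v x)
    (r1 : ℝ) (hr1 : 0 < r1)
    (hv : ∀ r, 0 < r → r ≤ r1 → v z * ∫ x, L.ker r z x ∂μ ≤ ∫ x, W x * L.ker r z x ∂μ)
    (S : Set E) (hS : ∃ N ∈ 𝓝 z, μ (N \ S) = 0) (c : ℝ) (hc : ∀ᶠ y in 𝓝[S] z, v y ≤ c) :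
    v z ≤ c := by
  have hC := hK.one
  have hC0 : 0 < C := by linarith
  have hr0p := hK.r0pos
  obtain ⟨N, hN, hN0⟩ := hS
  rw [eventually_nhdsWithin_iff] at hc
  obtain ⟨ε, hε, hb⟩ := Metric.nhds_basis_ball.mem_iff.1 (inter_mem (inter_mem hN hc) (hD.mem_nhds hzD))
  set r := min (min r1 r0) (min (1 / C) (ε / C)) with hr
  have hrp : 0 < r := by
    rw [hr]
    have : 0 < 1 / C := by positivity
    have : 0 < ε / C := by positivity
    simp [*]
  have a1 : r ≤ r1 := (min_le_left _ _).trans (min_le_left _ _)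
  have a2 : r ≤ r0 := (min_le_left _ _).trans (min_le_right _ _)
  have a3 : C * r ≤ 1 := by
    have : r ≤ 1 / C := (min_le_right _ _).trans (min_le_left _ _)
    rw [le_div_iff₀ hC0] at this; linarith
  have a4 : C * r ≤ ε := by
    have : r ≤ ε / C := (min_le_right _ _).trans (min_le_right _ _)
    rw [le_div_iff₀ hC0] at this; linarith
  have kp := L.ker_pos μ hK hrp a2 a3 hz
  have h1 := hv r hrp a1
  have h2 : ∫ x, W x * L.ker r z x ∂μ ≤ ∫ x, c * L.ker r z x ∂μ := by
    refine integral_mono_ae (L.ker_mul_int μ hK hrp a2 a3 hz W hW M hM)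
      ((L.ker_int μ hK hrp a2 a3 hz).const_mul _) ?_
    have : ∀ᵐ x ∂μ, x ∉ N \ S := measure_eq_zero_iff_ae_notMem.1 hN0
    filter_upwards [this] with x hx
    have k0 := L.ker_nonneg hK hrp a2 a3 hz x
    by_cases hxb : x ∈ ball z ε
    · obtain ⟨⟨b1, b2⟩, b3⟩ := hb hxb
      have hxS : x ∈ S := by
        by_contra h
        exact hx ⟨b1, h⟩
      exact mul_le_mul_of_nonneg_right ((hWv x b3).trans (b2 hxS)) k0
    · have : L.ker r z x = 0 := by
        apply hK.zero r x z hrp (by linarith)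
        rw [mem_ball, dist_eq_norm] at hxb
        push Not at hxb
        linarith
      simp [this]
  rw [integral_const_mul] at h2
  exact le_of_mul_le_mul_right (h1.trans h2) kp

end Ell

namespace Ell

variable {n : ℕ} {E ι : Type} [NormedAddCommGroup E] [NormedSpace ℝ E]
  [FiniteDimensional ℝ E] [Fintype ι] [DecidableEq ι] [MeasurableSpace E] [BorelSpace E]
  (μ : Measure E) [μ.IsAddHaarMeasure]

/-- scalar convolution -/
noncomputable def cv (u η : E → ℝ) (x : E) : ℝ := ∫ y, u y * η (x - y) ∂μ

lemma cv_eq (u η : E → ℝ) : cv μ u η = convolution u η (ContinuousLinearMap.mul ℝ ℝ) μ := by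
  ext x
  simp [cv, convolution]

lemma cv_int {u η : E → ℝ} (hu : Integrable u μ) (hcs : HasCompactSupport η) (hη : Continuous η)
    (x : E) : Integrable (fun y => u y * η (x - y)) μ := by
  obtain ⟨C, hC⟩ := hη.bounded_above_of_compact_support hcs
  exact hu.mul_bdd (c := C) (by fun_prop) (Eventually.of_forall fun y => hC _)

lemma cv_smooth {u η : E → ℝ} (hu : Integrable u μ) (hcs : HasCompactSupport η)
    (hη : ContDiff ℝ (⊤ : ℕ∞) η) : ContDiff ℝ (⊤ : ℕ∞) (cv μ u η) := by
  rw [cv_eq]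
  exact hcs.contDiff_convolution_right _ hu.locallyIntegrable hη

lemma cv_fderiv {u η : E → ℝ} (hu : Integrable u μ) (hcs : HasCompactSupport η)
    (hη : ContDiff ℝ (⊤ : ℕ∞) η) (x v : E) :
    fderiv ℝ (cv μ u η) x v = cv μ u (fun z => fderiv ℝ η z v) x := by
  have h := hcs.hasFDerivAt_convolution_right (ContinuousLinearMap.mul ℝ ℝ) (μ := μ)
    hu.locallyIntegrable (hη.of_le (by exact_mod_cast le_top)) x
  rw [cv_eq, h.fderiv]
  have hc : Continuous (fderiv ℝ η) := hη.continuous_fderiv (by simp)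
  have hex : ConvolutionExistsAt u (fderiv ℝ η) x
      ((ContinuousLinearMap.mul ℝ ℝ).precompR E) μ :=
    (hcs.fderiv (𝕜 := ℝ)).convolutionExists_right _ hu.locallyIntegrable hc x
  unfold convolution cv
  rw [ContinuousLinearMap.integral_apply hex]
  simp [ContinuousLinearMap.precompR_apply]

lemma smooth_fd {η : E → ℝ} (hη : ContDiff ℝ (⊤ : ℕ∞) η) (v : E) :
    ContDiff ℝ (⊤ : ℕ∞) (fun z => fderiv ℝ η z v) :=
  (hη.fderiv_right (m := ((⊤ : ℕ∞) : WithTop ℕ∞)) (by norm_cast)).clm_apply contDiff_const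

variable (L : Ell n E ι)

/-- the commutator field -/
noncomputable def dG (u η : E → ℝ) (k : ι) (x : E) : ℝ :=
  ∑ l, (L.c k l x * cv μ u (fun z => fderiv ℝ η z (L.b l)) x
    - cv μ (fun y => L.c k l y * u y) (fun z => fderiv ℝ η z (L.b l)) x)

lemma dG_cont {u η : E → ℝ} (hu : Integrable u μ)
    (hcu : ∀ k l, Integrable (fun y => L.c k l y * u y) μ) (hcs : HasCompactSupport η)
    (hη : ContDiff ℝ (⊤ : ℕ∞) η) (k : ι) : Continuous (L.dG μ u η k) := by
  unfold dG
  refine continuous_finsetSum _ fun l _ => ?_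
  refine ((L.cont_c k l).mul ?_).sub ?_
  · exact (cv_smooth μ hu (hcs.fderiv_apply (𝕜 := ℝ) _) (smooth_fd hη _)).continuous
  · exact (cv_smooth μ (hcu k l) (hcs.fderiv_apply (𝕜 := ℝ) _) (smooth_fd hη _)).continuous

lemma op_reflect {η : E → ℝ} (hη : ContDiff ℝ (⊤ : ℕ∞) η) (x y : E) :
    L.op (fun y' => η (x - y')) y = ∑ k, ∑ l, L.c k l y *
      fderiv ℝ (fun z => fderiv ℝ η z (L.b l)) (x - y) (L.b k) := by
  have key : ∀ f : E → ℝ, Differentiable ℝ f → ∀ y v, fderiv ℝ (fun y' => f (x - y')) y v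
      = - fderiv ℝ f (x - y) v := by
    intro f hf y v
    have h1 : HasFDerivAt (fun y' : E => x - y') (-(ContinuousLinearMap.id ℝ E)) y :=
      (hasFDerivAt_id y).const_sub x
    have h2 := (hf (x - y)).hasFDerivAt.comp y h1
    have : fderiv ℝ (fun y' => f (x - y')) y = _ := h2.fderiv
    rw [this]
    simp
  unfold op
  refine Finset.sum_congr rfl fun k _ => Finset.sum_congr rfl fun l _ => ?_
  congr 1
  have e : (fun x' => fderiv ℝ (fun y' => η (x - y')) x' (L.b l))
      = fun x' => (fun z => - fderiv ℝ η z (L.b l)) (x - x') := by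
    ext x'
    exact key η (hη.differentiable (by simp)) x' _
  have d1 : Differentiable ℝ (fun z => fderiv ℝ η z (L.b l)) :=
    (smooth_fd hη (L.b l)).differentiable (by simp)
  have e2 := key (fun z => - fderiv ℝ η z (L.b l)) d1.neg y (L.b k)
  rw [e, e2]
  rw [fderiv_fun_neg]
  simp

lemma star {u η : E → ℝ} (hu : Integrable u μ)
    (hcu : ∀ k l, Integrable (fun y => L.c k l y * u y) μ) (hcs : HasCompactSupport η)
    (hη : ContDiff ℝ (⊤ : ℕ∞) η) (K1 : Set E)
    (hpos : ∀ x ∈ K1, 0 ≤ ∫ y, u y * L.op (fun y' => η (x - y')) y ∂μ)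
    {ζ : E → ℝ} (hζ : ContDiff ℝ 1 ζ) (hζc : HasCompactSupport ζ) (hζ0 : ∀ x, 0 ≤ ζ x)
    (hζs : tsupport ζ ⊆ K1) :
    ∫ x, L.gr ζ (cv μ u η) x ∂μ ≤ ∫ x, ∑ k, L.dG μ u η k x * fderiv ℝ ζ x (L.b k) ∂μ := by
  set h : ι → E → ℝ := fun k x => ∑ l, cv μ (fun y => L.c k l y * u y)
    (fun z => fderiv ℝ η z (L.b l)) x with hh
  have cη : ∀ v, HasCompactSupport fun z => fderiv ℝ η z v := fun v => hcs.fderiv_apply (𝕜 := ℝ) v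
  have hsm : ∀ k, ContDiff ℝ (⊤ : ℕ∞) (h k) := fun k =>
    ContDiff.sum fun l _ => cv_smooth μ (hcu k l) (cη _) (smooth_fd hη _)
  have dζ : ∀ k, Continuous fun x => fderiv ℝ ζ x (L.b k) := fun k =>
    (hζ.continuous_fderiv (by norm_num)).clm_apply continuous_const
  have cζ : ∀ v, HasCompactSupport fun z => fderiv ℝ ζ z v := fun v => hζc.fderiv_apply (𝕜 := ℝ) v
  have dh : ∀ k, Continuous fun x => fderiv ℝ (h k) x (L.b k) := fun k =>
    (smooth_fd (hsm k) _).continuous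
  have i1 : ∀ k, Integrable (fun x => fderiv ℝ ζ x (L.b k) * h k x) μ := fun k =>
    ((dζ k).mul (hsm k).continuous).integrable_of_hasCompactSupport ((cζ _).mul_right)
  have i2 : ∀ k, Integrable (fun x => ζ x * fderiv ℝ (h k) x (L.b k)) μ := fun k =>
    (hζ.continuous.mul (dh k)).integrable_of_hasCompactSupport hζc.mul_right
  have i3 : ∀ k, Integrable (fun x => ζ x * h k x) μ := fun k =>
    (hζ.continuous.mul (hsm k).continuous).integrable_of_hasCompactSupport hζc.mul_right
  have i4 : Integrable (fun x => ∑ k, L.dG μ u η k x * fderiv ℝ ζ x (L.b k)) μ :=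
    integrable_finsetSum _ fun k _ => ((L.dG_cont μ hu hcu hcs hη k).mul
      (dζ k)).integrable_of_hasCompactSupport (cζ _).mul_left
  have e1 : ∀ x, L.gr ζ (cv μ u η) x = (∑ k, L.dG μ u η k x * fderiv ℝ ζ x (L.b k))
      + ∑ k, fderiv ℝ ζ x (L.b k) * h k x := by
    intro x
    rw [← Finset.sum_add_distrib]
    unfold gr
    refine Finset.sum_congr rfl fun k _ => ?_
    simp only [cv_fderiv μ hu hcs hη, hh, dG, Finset.sum_mul, Finset.mul_sum]
    rw [← Finset.sum_add_distrib]
    refine Finset.sum_congr rfl fun l _ => ?_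
    ring
  have e2 : ∫ x, ∑ k, fderiv ℝ ζ x (L.b k) * h k x ∂μ
      = - ∫ x, ζ x * ∑ k, fderiv ℝ (h k) x (L.b k) ∂μ := by
    simp only [Finset.mul_sum]
    rw [integral_finsetSum _ fun k _ => i1 k, integral_finsetSum _ fun k _ => i2 k,
      ← Finset.sum_neg_distrib]
    refine Finset.sum_congr rfl fun k _ => ?_
    rw [integral_mul_fderiv_eq_neg_fderiv_mul_of_integrable (i1 k) (i2 k) (i3 k)
      (fun x _ => hζ.differentiable (by norm_num) x)
      (fun x _ => (hsm k).differentiable (by simp) x)]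
    simp
  have e3 : ∀ x, ∑ k, fderiv ℝ (h k) x (L.b k) = ∫ y, u y * L.op (fun y' => η (x - y')) y ∂μ := by
    intro x
    simp only [L.op_reflect hη, Finset.mul_sum]
    have ii : ∀ k l, Integrable (fun y => u y * (L.c k l y *
        fderiv ℝ (fun z => fderiv ℝ η z (L.b l)) (x - y) (L.b k))) μ := by
      intro k l
      have := cv_int μ (hcu k l) ((cη (L.b l)).fderiv_apply (𝕜 := ℝ) (L.b k))
        (smooth_fd (smooth_fd hη _) _).continuous x
      refine this.congr (Eventually.of_forall fun y => ?_)
      simp only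
      ring
    rw [integral_finsetSum _ fun k _ => integrable_finsetSum _ fun l _ => ii k l]
    refine Finset.sum_congr rfl fun k _ => ?_
    rw [integral_finsetSum _ fun l _ => ii k l]
    simp only [hh]
    rw [fderiv_fun_sum fun l _ => (cv_smooth μ (hcu k l) (cη _) (smooth_fd hη _)).differentiable
      (by simp) x]
    rw [_root_.sum_apply]
    refine Finset.sum_congr rfl fun l _ => ?_
    rw [cv_fderiv μ (hcu k l) (cη _) (smooth_fd hη _)]
    unfold cv
    congr 1
    ext y
    ring
  simp only [e1]
  rw [integral_add i4 (integrable_finsetSum _ fun k _ => i1 k), e2]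
  have : 0 ≤ ∫ x, ζ x * ∑ k, fderiv ℝ (h k) x (L.b k) ∂μ := by
    refine integral_nonneg fun x => ?_
    by_cases hx : x ∈ tsupport ζ
    · exact mul_nonneg (hζ0 x) (by rw [e3]; exact hpos x (hζs hx))
    · simp [image_eq_zero_of_notMem_tsupport hx]
  linarith

end Ell

namespace Ell

variable {n : ℕ} {E ι : Type} [NormedAddCommGroup E] [NormedSpace ℝ E]
  [FiniteDimensional ℝ E] [Fintype ι] [DecidableEq ι] [MeasurableSpace E] [BorelSpace E]
  (μ : Measure E) [μ.IsAddHaarMeasure]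

/-- a fixed bump -/
noncomputable def bump0 (E : Type) [NormedAddCommGroup E] [NormedSpace ℝ E]
    [FiniteDimensional ℝ E] : ContDiffBump (0 : E) := ⟨1, 2, by norm_num, by norm_num⟩

/-- rescaled bump -/
noncomputable def mo (n : ℕ) (s : ℝ) (z : E) : ℝ := (s ^ (2 * n))⁻¹ * bump0 E (s⁻¹ • z)

lemma mo_smooth (n : ℕ) (s : ℝ) : ContDiff ℝ (⊤ : ℕ∞) (mo n s : E → ℝ) := by
  unfold mo
  exact contDiff_const.mul ((bump0 E).contDiff.comp (contDiff_const_smul _))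

lemma mo_nonneg (n : ℕ) {s : ℝ} (hs : 0 < s) (z : E) : 0 ≤ mo n s z := by
  unfold mo
  have := (bump0 E).nonneg (x := s⁻¹ • z)
  positivity

lemma mo_le (n : ℕ) {s : ℝ} (hs : 0 < s) (z : E) : mo n s z ≤ (s ^ (2 * n))⁻¹ := by
  unfold mo
  have := (bump0 E).le_one (x := s⁻¹ • z)
  exact mul_le_of_le_one_right (by positivity) this

lemma mo_zero (n : ℕ) {s : ℝ} (hs : 0 < s) (z : E) (hz : 2 * s ≤ ‖z‖) : mo n s z = 0 := by
  unfold mo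
  rw [(bump0 E).zero_of_le_dist, mul_zero]
  rw [dist_zero_right, norm_smul, norm_inv, Real.norm_of_nonneg hs.le]
  change (2 : ℝ) ≤ _
  rw [inv_mul_eq_div, le_div_iff₀ hs]
  exact hz

lemma mo_in (n : ℕ) {s : ℝ} (hs : 0 < s) (z : E) (hz : ‖z‖ ≤ s) : mo n s z = (s ^ (2 * n))⁻¹ := by
  unfold mo
  rw [(bump0 E).one_of_mem_closedBall, mul_one]
  rw [mem_closedBall, dist_zero_right, norm_smul, norm_inv, Real.norm_of_nonneg hs.le]
  change _ ≤ (1 : ℝ)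
  rw [inv_mul_eq_div, div_le_one hs]
  exact hz

lemma mo_tsupport (n : ℕ) {s : ℝ} (hs : 0 < s) : tsupport (mo n s : E → ℝ) ⊆ closedBall 0 (2 * s) := by
  refine closure_minimal ?_ isClosed_closedBall
  intro z hz
  by_contra h
  apply hz
  apply mo_zero n hs
  rw [mem_closedBall, dist_zero_right] at h
  exact (not_le.1 h).le

lemma mo_cs (n : ℕ) {s : ℝ} (hs : 0 < s) : HasCompactSupport (mo n s : E → ℝ) :=
  (isCompact_closedBall _ _).of_isClosed_subset (isClosed_tsupport _) (mo_tsupport n hs)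

lemma mo_fd (n : ℕ) (v : E) : ∃ B, 0 ≤ B ∧ ∀ s, 0 < s → ∀ z : E,
    |fderiv ℝ (mo n s) z v| ≤ B * (s ^ (2 * n))⁻¹ * s⁻¹ := by
  have hb : ContDiff ℝ (⊤ : ℕ∞) (bump0 E : E → ℝ) := (bump0 E).contDiff
  obtain ⟨B, hB⟩ := (smooth_fd hb v).continuous.bounded_above_of_compact_support
    ((bump0 E).hasCompactSupport.fderiv_apply (𝕜 := ℝ) v)
  refine ⟨B, (norm_nonneg _).trans (hB 0), fun s hs z => ?_⟩
  have h1 : HasFDerivAt (fun z : E => s⁻¹ • z) (s⁻¹ • ContinuousLinearMap.id ℝ E) z :=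
    (hasFDerivAt_id z).const_smul s⁻¹
  have h2 := ((hb.differentiable (by simp) (s⁻¹ • z)).hasFDerivAt.comp z h1).const_mul
    ((s ^ (2 * n))⁻¹)
  have h3 : fderiv ℝ (mo n s) z = _ := h2.fderiv
  rw [h3]
  have : ((s ^ (2 * n))⁻¹ • (fderiv ℝ (bump0 E : E → ℝ) (s⁻¹ • z)).comp
      (s⁻¹ • ContinuousLinearMap.id ℝ E)) v
      = (s ^ (2 * n))⁻¹ * s⁻¹ * fderiv ℝ (bump0 E : E → ℝ) (s⁻¹ • z) v := by
    simp; ring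
  rw [this, abs_mul, abs_of_nonneg (by positivity : 0 ≤ (s ^ (2 * n))⁻¹ * s⁻¹)]
  have := hB (s⁻¹ • z)
  rw [Real.norm_eq_abs] at this
  calc _ ≤ (s ^ (2 * n))⁻¹ * s⁻¹ * B := by gcongr
    _ = _ := by ring

lemma mo_fd_zero (n : ℕ) (v : E) {s : ℝ} (hs : 0 < s) (z : E) (hz : 2 * s < ‖z‖) :
    fderiv ℝ (mo n s) z v = 0 := by
  have : z ∉ tsupport (fun z => fderiv ℝ (mo n s) z v) := by
    intro h
    have := mo_tsupport n hs (tsupport_fderiv_apply_subset ℝ v h)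
    rw [mem_closedBall, dist_zero_right] at this
    linarith
  exact image_eq_zero_of_notMem_tsupport (f := fun z => fderiv ℝ (mo n s) z v) this

lemma mo_integral (L : Ell n E ι) {s : ℝ} (hs : 0 < s) (x : E) :
    ∫ y, mo n s (x - y) ∂μ = ∫ y, bump0 E y ∂μ := by
  rw [integral_sub_left_eq_self (mo n s) μ x]
  unfold mo
  rw [integral_const_mul, Measure.integral_comp_inv_smul_of_nonneg μ _ hs.le, L.finrank_eq,
    smul_eq_mul, ← mul_assoc, inv_mul_cancel₀ (by positivity), one_mul]

variable (L : Ell n E ι)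

/-- kernel of the commutator -/
noncomputable def gk (η : E → ℝ) (k : ι) (x y : E) : ℝ :=
  ∑ l, (L.c k l x - L.c k l y) * fderiv ℝ η (x - y) (L.b l)

lemma dG_eq {u η : E → ℝ} (hu : Integrable u μ)
    (hcu : ∀ k l, Integrable (fun y => L.c k l y * u y) μ) (hcs : HasCompactSupport η)
    (hη : ContDiff ℝ (⊤ : ℕ∞) η) (k : ι) (x : E) :
    Integrable (fun y => u y * L.gk η k x y) μ ∧
    L.dG μ u η k x = ∫ y, u y * L.gk η k x y ∂μ := by
  have cη : ∀ v, HasCompactSupport fun z => fderiv ℝ η z v := fun v => hcs.fderiv_apply (𝕜 := ℝ) v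
  have i1 := fun l => cv_int μ hu (cη (L.b l)) (smooth_fd hη _).continuous x
  have i2 := fun l => cv_int μ (hcu k l) (cη (L.b l)) (smooth_fd hη _).continuous x
  have e : (fun y => u y * L.gk η k x y) = fun y => ∑ l, (L.c k l x *
      (u y * fderiv ℝ η (x - y) (L.b l)) - (L.c k l y * u y) * fderiv ℝ η (x - y) (L.b l)) := by
    ext y
    simp only [gk, Finset.mul_sum]
    exact Finset.sum_congr rfl fun l _ => by ring
  rw [e]
  have i3 : ∀ l, Integrable (fun y => L.c k l x *
      (u y * fderiv ℝ η (x - y) (L.b l)) - (L.c k l y * u y) * fderiv ℝ η (x - y) (L.b l)) μ :=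
    fun l => ((i1 l).const_mul _).sub (i2 l)
  refine ⟨integrable_finsetSum _ fun l _ => i3 l, ?_⟩
  rw [integral_finsetSum _ fun l _ => i3 l]
  unfold dG cv
  refine Finset.sum_congr rfl fun l _ => ?_
  rw [integral_sub ((i1 l).const_mul _) (i2 l), integral_const_mul]

lemma gk_int {η : E → ℝ} (hcs : HasCompactSupport η)
    (hη : ContDiff ℝ (⊤ : ℕ∞) η) (k : ι) (x : E) :
    Integrable (fun y => L.gk η k x y) μ ∧ ∫ y, L.gk η k x y ∂μ = 0 := by
  set F : E → ℝ := fun y => η (x - y) with hF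
  have hFs : ContDiff ℝ (⊤ : ℕ∞) F := hη.comp (contDiff_const.sub contDiff_id)
  have hFc : HasCompactSupport F := hcs.comp_homeomorph (Homeomorph.subLeft x)
  have key : ∀ y v, fderiv ℝ F y v = - fderiv ℝ η (x - y) v := by
    intro y v
    have h1 : HasFDerivAt (fun y' : E => x - y') (-(ContinuousLinearMap.id ℝ E)) y :=
      (hasFDerivAt_id y).const_sub x
    have h2 := (hη.differentiable (by simp) (x - y)).hasFDerivAt.comp y h1
    have : fderiv ℝ F y = _ := h2.fderiv
    rw [this]
    simp
  have iF : ∀ v, Integrable (fun y => fderiv ℝ F y v) μ := fun v =>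
    (smooth_fd hFs v).continuous.integrable_of_hasCompactSupport (hFc.fderiv_apply (𝕜 := ℝ) v)
  have i0 : ∀ v, ∫ y, fderiv ℝ F y v ∂μ = 0 := by
    intro v
    have := integral_mul_fderiv_eq_neg_fderiv_mul_of_integrable (μ := μ) (f := fun _ : E => (1 : ℝ))
      (g := F) (v := v) (by simp) (by simpa using iF v)
      (by simpa using hFs.continuous.integrable_of_hasCompactSupport hFc)
      (fun y _ => by fun_prop) (fun y _ => hFs.differentiable (by simp) y)
    simpa using this
  have g := L.green_aux μ F (L.co k) (hFs.of_le (by norm_cast)) (L.co k).contDiff (Or.inl hFc)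
  have o : ∀ y, L.op (L.co k) y = 0 := by
    intro y
    unfold op
    simp
  simp only [o, mul_zero, integral_zero] at g
  have e : (fun y => L.gk η k x y) = fun y => L.gr F (L.co k) y -
      ∑ l, L.c k l x * fderiv ℝ F y (L.b l) := by
    ext y
    have : L.gr F (L.co k) y = ∑ l, L.c k l y * fderiv ℝ F y (L.b l) := by
      unfold gr
      refine Finset.sum_congr rfl fun l _ => ?_
      simp only [ContinuousLinearMap.fderiv, L.co_b]
      simp [L.symm l k]
    rw [this, ← Finset.sum_sub_distrib, gk]
    refine Finset.sum_congr rfl fun l _ => ?_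
    rw [key]
    ring
  rw [e]
  have i3 : Integrable (fun y => ∑ l, L.c k l x * fderiv ℝ F y (L.b l)) μ :=
    integrable_finsetSum _ fun l _ => (iF _).const_mul _
  refine ⟨g.2.1.sub i3, ?_⟩
  rw [integral_sub g.2.1 i3, integral_finsetSum _ fun l _ => (iF _).const_mul _]
  simp only [integral_const_mul, i0]
  have := g.2.2
  simp
  linarith

lemma gk_bound (R : ℝ) : ∃ A, 0 ≤ A ∧ ∀ s k x y, 0 < s → 2 * s ≤ 1 → ‖x‖ ≤ R - 1 →
    |L.gk (mo n s) k x y| ≤ (closedBall x (2 * s)).indicator (fun _ => A * (s ^ (2 * n))⁻¹) y := by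
  obtain ⟨M, hM1, hM⟩ := exists_unif R L.c L.hc
  choose B hB0 hB using fun l => mo_fd n (L.b l)
  refine ⟨∑ l, 2 * M * B l, Finset.sum_nonneg fun l _ => by have := hB0 l; positivity, ?_⟩
  intro s k x y hs hs1 hx
  by_cases hy : y ∈ closedBall x (2 * s)
  · rw [Set.indicator_of_mem hy]
    have hd : ‖x - y‖ ≤ 2 * s := by rwa [mem_closedBall, dist_comm, dist_eq_norm] at hy
    unfold gk
    refine (Finset.abs_sum_le_sum_abs _ _).trans ?_
    rw [Finset.sum_mul]
    refine Finset.sum_le_sum fun l _ => ?_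
    rw [abs_mul]
    have hyR : ‖y‖ ≤ R := by
      have : ‖y‖ ≤ ‖x‖ + ‖x - y‖ := by
        have := norm_sub_le x (x - y)
        simpa using this
      linarith
    have h1 := (hM k l).2 x y (by linarith) hyR
    have h2 := hB l s hs (x - y)
    calc _ ≤ (M * (2 * s)) * (B l * (s ^ (2 * n))⁻¹ * s⁻¹) := by
          refine mul_le_mul (h1.trans ?_) h2 (abs_nonneg _) (by positivity)
          gcongr
      _ = _ := by field_simp
  · rw [Set.indicator_of_notMem hy]
    have hd : 2 * s < ‖x - y‖ := by
      rw [mem_closedBall, dist_comm, dist_eq_norm] at hy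
      exact not_le.1 hy
    unfold gk
    simp [mo_fd_zero n _ hs _ hd]

lemma ind_int (u : E → ℝ) (hu : Integrable u μ) (x : E) (a c s : ℝ) :
    Integrable (fun y => |u y - c| * (closedBall x s).indicator (fun _ => a) y) μ ∧
    ∫ y, |u y - c| * (closedBall x s).indicator (fun _ => a) y ∂μ
      = a * ∫ y in closedBall x s, |u y - c| ∂μ := by
  have e : (fun y => |u y - c| * (closedBall x s).indicator (fun _ => a) y)
      = (closedBall x s).indicator (fun y => a * |u y - c|) := by
    ext y
    by_cases h : y ∈ closedBall x s <;> simp [h, mul_comm]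
  rw [e, integral_indicator measurableSet_closedBall, integral_const_mul]
  refine ⟨?_, rfl⟩
  rw [integrable_indicator_iff measurableSet_closedBall]
  exact ((hu.integrableOn.sub (integrableOn_const measure_closedBall_lt_top.ne)).abs).const_mul a

lemma dG_bound (R : ℝ) : ∃ A, 0 ≤ A ∧ ∀ (u : E → ℝ) (hu : Integrable u μ)
    (hcu : ∀ k l, Integrable (fun y => L.c k l y * u y) μ) (s k x), 0 < s → 2 * s ≤ 1 →
    ‖x‖ ≤ R - 1 →
    |L.dG μ u (mo n s) k x| ≤ A * (s ^ (2 * n))⁻¹ * ∫ y in closedBall x (2 * s), |u y| ∂μ ∧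
    |L.dG μ u (mo n s) k x| ≤ A * (s ^ (2 * n))⁻¹ * ∫ y in closedBall x (2 * s), |u y - u x| ∂μ := by
  obtain ⟨A, hA, hb⟩ := L.gk_bound R
  refine ⟨A, hA, fun u hu hcu s k x hs hs1 hx => ?_⟩
  have d := L.dG_eq μ hu hcu (mo_cs n hs) (mo_smooth n s) k x
  have g := L.gk_int μ (mo_cs n hs) (mo_smooth n s) k x
  have key : ∀ c, L.dG μ u (mo n s) k x = ∫ y, (u y - c) * L.gk (mo n s) k x y ∂μ → 
      |L.dG μ u (mo n s) k x| ≤ A * (s ^ (2 * n))⁻¹ * ∫ y in closedBall x (2 * s), |u y - c| ∂μ := by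
    intro c hc
    rw [hc, ← (ind_int μ u hu x _ c _).2]
    refine (abs_integral_le_integral_abs).trans ?_
    have i : Integrable (fun y => (u y - c) * L.gk (mo n s) k x y) μ := by
      have := d.1.sub (g.1.const_mul c)
      refine this.congr (Eventually.of_forall fun y => ?_)
      simp; ring
    refine integral_mono i.abs (ind_int μ u hu x _ c _).1 fun y => ?_
    simp only [abs_mul]
    exact mul_le_mul_of_nonneg_left (hb s k x y hs hs1 hx) (abs_nonneg _)
  constructor
  · have := key 0 (by simpa using d.2)
    simpa using this
  · apply key
    rw [d.2]
    have : (fun y => (u y - u x) * L.gk (mo n s) k x y) =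
        fun y => u y * L.gk (mo n s) k x y - u x * L.gk (mo n s) k x y := by
      ext y; ring
    rw [this, integral_sub d.1 (g.1.const_mul _), integral_const_mul, g.2]
    simp

lemma cv_low {u : E → ℝ} (hu : Integrable u μ) (hu0 : ∀ x, u x ≤ 0) {s : ℝ} (hs : 0 < s) (x : E) :
    ∫ y in closedBall x s, |u y| ∂μ ≤ s ^ (2 * n) * (- cv μ u (mo n s) x) := by
  have e := (ind_int μ u hu x 1 0 s)
  simp only [sub_zero, one_mul] at e
  rw [← e.2]
  unfold cv
  rw [← integral_neg, ← integral_const_mul]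
  refine integral_mono e.1 ((cv_int μ hu (mo_cs n hs) (mo_smooth n s).continuous x).neg.const_mul _) ?_
  intro y
  simp only
  rw [abs_of_nonpos (hu0 y)]
  by_cases hy : y ∈ closedBall x s
  · rw [Set.indicator_of_mem hy, mo_in n hs]
    · have : s ^ (2 * n) ≠ 0 := by positivity
      field_simp
      exact le_rfl
    · rwa [mem_closedBall, dist_comm, dist_eq_norm] at hy
  · rw [Set.indicator_of_notMem hy, mul_zero]
    have := mo_nonneg n hs (x - y)
    have h2 := hu0 y
    have : 0 ≤ -(u y * mo n s (x - y)) := by nlinarith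
    positivity

lemma cv_nonpos {u η : E → ℝ} (hu0 : ∀ x, u x ≤ 0) (hη : ∀ z, 0 ≤ η z) (x : E) : cv μ u η x ≤ 0 :=
  integral_nonpos fun y => mul_nonpos_of_nonpos_of_nonneg (hu0 y) (hη _)

lemma leb_scale {u : E → ℝ} {x : E} (hL : LebPt μ n u x) {s : ℕ → ℝ} (hs : ∀ i, 0 < s i)
    (hs0 : Tendsto s atTop (𝓝 0)) (A : ℝ) :
    Tendsto (fun i => A * (s i ^ (2 * n))⁻¹ * ∫ y in closedBall x (2 * s i), |u y - u x| ∂μ)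
      atTop (𝓝 0) := by
  have h1 : Tendsto (fun i => 2 * s i) atTop (𝓝[>] 0) := by
    refine tendsto_nhdsWithin_iff.2 ⟨by simpa using hs0.const_mul 2, ?_⟩
    exact Eventually.of_forall fun i => by have := hs i; simp [this]
  have h2 := (hL.comp h1).const_mul (A * 2 ^ (2 * n))
  rw [mul_zero] at h2
  refine h2.congr fun i => ?_
  simp only [Function.comp]
  rw [mul_pow]
  have := (hs i).ne'
  field_simp

lemma cv_lim (L : Ell n E ι) {u : E → ℝ} (hu : Integrable u μ) {x : E} (hL : LebPt μ n u x) {s : ℕ → ℝ}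
    (hs : ∀ i, 0 < s i) (hs0 : Tendsto s atTop (𝓝 0)) :
    Tendsto (fun i => cv μ u (mo n (s i)) x) atTop (𝓝 ((∫ y, bump0 E y ∂μ) * u x)) := by
  have h := leb_scale μ hL hs hs0 1
  rw [tendsto_iff_norm_sub_tendsto_zero]
  refine squeeze_zero (fun i => norm_nonneg _) (fun i => ?_) h
  have hm : Integrable (fun y => mo n (s i) (x - y)) μ :=
    Continuous.integrable_of_hasCompactSupport
      ((mo_smooth n (s i)).continuous.comp (by fun_prop))
      ((mo_cs n (hs i)).comp_homeomorph (Homeomorph.subLeft x))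
  have hc := cv_int μ hu (mo_cs n (hs i)) (mo_smooth n (s i)).continuous x
  have e : cv μ u (mo n (s i)) x - (∫ y, bump0 E y ∂μ) * u x
      = ∫ y, (u y - u x) * mo n (s i) (x - y) ∂μ := by
    have : (fun y => (u y - u x) * mo n (s i) (x - y)) = 
        fun y => u y * mo n (s i) (x - y) - u x * mo n (s i) (x - y) := by ext y; ring
    rw [this, integral_sub hc (hm.const_mul _), integral_const_mul, mo_integral μ L (hs i)]
    unfold cv
    ring
  rw [e, one_mul, ← (ind_int μ u hu x _ _ _).2, Real.norm_eq_abs]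
  refine (abs_integral_le_integral_abs).trans ?_
  have i2 : Integrable (fun y => (u y - u x) * mo n (s i) (x - y)) μ := by
    refine (hc.sub (hm.const_mul (u x))).congr (Eventually.of_forall fun y => ?_)
    simp; ring
  refine integral_mono i2.abs (ind_int μ u hu x _ _ _).1 fun y => ?_
  simp only [abs_mul]
  refine mul_le_mul_of_nonneg_left ?_ (abs_nonneg _)
  rw [abs_of_nonneg (mo_nonneg n (hs i) _)]
  by_cases hy : y ∈ closedBall x (2 * s i)
  · rw [Set.indicator_of_mem hy]
    exact mo_le n (hs i) _
  · rw [Set.indicator_of_notMem hy, mo_zero n (hs i)]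
    rw [mem_closedBall, dist_comm, dist_eq_norm] at hy
    exact (not_le.1 hy).le

end Ell

namespace Ell

lemma rec_lim0 {y e : ℕ → ℝ} (h : ∀ j, y (j + 1) = y j / 4 + e j) (he : Tendsto e atTop (𝓝 0)) :
    Tendsto y atTop (𝓝 0) := by
  rw [Metric.tendsto_atTop]
  intro ε hε
  obtain ⟨N, hN⟩ := (Metric.tendsto_atTop.1 he) (ε / 4) (by positivity)
  have b : ∀ m, |y (N + m)| ≤ |y N| * (1 / 4) ^ m + ε / 3 := by
    intro m
    induction m with
    | zero => simp; positivity
    | succ m ih =>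
      have h1 := hN (N + m) (by omega)
      rw [Real.dist_eq, sub_zero] at h1
      rw [← add_assoc, h]
      have h2 : |y (N + m) / 4 + e (N + m)| ≤ |y (N + m)| / 4 + |e (N + m)| := by
        refine (abs_add_le _ _).trans ?_
        rw [abs_div]
        norm_num
      rw [pow_succ]
      linarith
  have t : Tendsto (fun m => |y N| * (1 / 4 : ℝ) ^ m) atTop (𝓝 0) := by
    have := (tendsto_pow_atTop_nhds_zero_of_lt_one (r := (1 / 4 : ℝ)) (by norm_num)
      (by norm_num)).const_mul |y N|
    simpa using this
  obtain ⟨m0, hm0⟩ := (Metric.tendsto_atTop.1 t) (ε / 3) (by positivity)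
  refine ⟨N + m0, fun j hj => ?_⟩
  obtain ⟨m, rfl⟩ := Nat.exists_eq_add_of_le (show N ≤ j by omega)
  have h1 := hm0 m (by omega)
  rw [Real.dist_eq, sub_zero] at h1 ⊢
  have := b m
  have := le_abs_self (|y N| * (1 / 4 : ℝ) ^ m)
  linarith

lemma rec_lim {x a : ℕ → ℝ} {l : ℝ} (h : ∀ j, x (j + 1) = x j / 4 + a (j + 1))
    (ha : Tendsto a atTop (𝓝 l)) : Tendsto x atTop (𝓝 (4 / 3 * l)) := by
  have h1 : Tendsto (fun j => x j - 4 / 3 * l) atTop (𝓝 0) := by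
    refine rec_lim0 (e := fun j => a (j + 1) - l) (fun j => ?_) ?_
    · rw [h]; ring
    · have := (ha.comp (tendsto_add_atTop_nat 1)).sub_const l
      simpa using this
  have := h1.add_const (4 / 3 * l)
  simpa using this

variable {n : ℕ} {E ι : Type} [NormedAddCommGroup E] [NormedSpace ℝ E]
  [FiniteDimensional ℝ E] [Fintype ι] [DecidableEq ι] [MeasurableSpace E] [BorelSpace E]
  (μ : Measure E) [μ.IsAddHaarMeasure]

/-- multi-scale kernel -/
noncomputable def et (n : ℕ) (s : ℝ) : ℕ → E → ℝ
  | 0 => mo n s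
  | j + 1 => fun z => et n s j z / 4 + mo n (s / 2 ^ (j + 1)) z

lemma et_props (n : ℕ) {s : ℝ} (hs : 0 < s) (j : ℕ) : ContDiff ℝ (⊤ : ℕ∞) (et n s j : E → ℝ) ∧
    (∀ z : E, 0 ≤ et n s j z) ∧ (∀ z : E, 2 * s ≤ ‖z‖ → et n s j z = 0) := by
  induction j with
  | zero => exact ⟨mo_smooth n s, mo_nonneg n hs, mo_zero n hs⟩
  | succ j ih =>
    have h2 : 0 < s / 2 ^ (j + 1) := by positivity
    refine ⟨(ih.1.div_const 4).add (mo_smooth n _), fun z => ?_, fun z hz => ?_⟩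
    · have := ih.2.1 z
      have := mo_nonneg n h2 z
      simp only [et]
      positivity
    · simp only [et]
      rw [ih.2.2 z hz, mo_zero n h2]
      · simp
      · refine le_trans ?_ hz
        have : s / 2 ^ (j + 1) ≤ s := div_le_self hs.le (one_le_pow₀ (by norm_num))
        linarith

lemma et_tsupport (n : ℕ) {s : ℝ} (hs : 0 < s) (j : ℕ) :
    tsupport (et n s j : E → ℝ) ⊆ closedBall 0 (2 * s) := by
  refine closure_minimal ?_ isClosed_closedBall
  intro z hz
  by_contra h
  apply hz
  apply (et_props n hs j).2.2
  rw [mem_closedBall, dist_zero_right] at h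
  exact (not_le.1 h).le

lemma et_cs (n : ℕ) {s : ℝ} (hs : 0 < s) (j : ℕ) : HasCompactSupport (et n s j : E → ℝ) :=
  (isCompact_closedBall _ _).of_isClosed_subset (isClosed_tsupport _) (et_tsupport n hs j)

variable (L : Ell n E ι)

lemma cv_et {u : E → ℝ} (hu : Integrable u μ) {s : ℝ} (hs : 0 < s) (j : ℕ) (x : E) :
    cv μ u (et n s (j + 1)) x = cv μ u (et n s j) x / 4 + cv μ u (mo n (s / 2 ^ (j + 1))) x := by
  have h2 : 0 < s / 2 ^ (j + 1) := by positivity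
  have i1 := cv_int μ hu (et_cs n hs j) (et_props n hs j).1.continuous x
  have i2 := cv_int μ hu (mo_cs n h2) (mo_smooth n _).continuous x
  unfold cv
  rw [← integral_div, ← integral_add (i1.div_const 4) i2]
  congr 1
  ext y
  simp only [et]
  ring

lemma dG_et {u : E → ℝ} (hu : Integrable u μ)
    (hcu : ∀ k l, Integrable (fun y => L.c k l y * u y) μ) {s : ℝ} (hs : 0 < s) (j : ℕ) (k : ι)
    (x : E) : L.dG μ u (et n s (j + 1)) k x
      = L.dG μ u (et n s j) k x / 4 + L.dG μ u (mo n (s / 2 ^ (j + 1))) k x := by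
  have h2 : 0 < s / 2 ^ (j + 1) := by positivity
  have d0 := L.dG_eq μ hu hcu (et_cs n hs (j + 1)) (et_props n hs (j + 1)).1 k x
  have d1 := L.dG_eq μ hu hcu (et_cs n hs j) (et_props n hs j).1 k x
  have d2 := L.dG_eq μ hu hcu (mo_cs n h2) (mo_smooth n _) k x
  rw [d0.2, d1.2, d2.2, ← integral_div, ← integral_add (d1.1.div_const 4) d2.1]
  congr 1
  ext y
  have : ∀ v, fderiv ℝ (et n s (j + 1)) (x - y) v = fderiv ℝ (et n s j) (x - y) v / 4
      + fderiv ℝ (mo n (s / 2 ^ (j + 1))) (x - y) v := by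
    intro v
    have a1 := ((et_props n hs j).1.differentiable (by simp) (x - y)).hasFDerivAt.mul_const (1 / 4 : ℝ)
    have a2 := ((mo_smooth n (s / 2 ^ (j + 1))).differentiable (by simp) (x - y)).hasFDerivAt
    have a3 := (a1.add a2).fderiv
    have e : (et n s (j + 1) : E → ℝ) = (fun y => et n s j y * (1 / 4)) + mo n (s / 2 ^ (j + 1)) := by
      ext z; simp [et]; ring
    rw [e, a3]
    simp
    ring
  simp only [gk, this, Finset.mul_sum]
  rw [Finset.sum_div, ← Finset.sum_add_distrib]
  exact Finset.sum_congr rfl fun l _ => by ring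

/-- the normalising constant -/
noncomputable def cst (E : Type) [NormedAddCommGroup E] [NormedSpace ℝ E] [FiniteDimensional ℝ E]
    [MeasurableSpace E] (μ : Measure E) : ℝ := 4 / 3 * ∫ y, bump0 E y ∂μ

lemma cst_pos : 0 < cst E μ := by
  unfold cst
  have := (bump0 E).integral_pos (μ := μ)
  positivity

/-- approximation package -/
structure Apx (K : Set E) (u : E → ℝ) (w : ℕ → E → ℝ) (G : ℕ → ι → E → ℝ) (C : ℝ) : Prop where
  C0 : 0 ≤ C
  sm : ∀ j, ContDiff ℝ (⊤ : ℕ∞) (w j)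
  np : ∀ j x, w j x ≤ 0
  Gc : ∀ j k, Continuous (G j k)
  Gb : ∀ j k, ∀ x ∈ K, |G j k x| ≤ C * (1 - w j x)
  lim : ∀ᵐ x ∂μ, x ∈ K → Tendsto (fun j => w j x) atTop (𝓝 (cst E μ * u x)) ∧
    ∀ k, Tendsto (fun j => G j k x) atTop (𝓝 0)
  star : ∀ j (ζ : E → ℝ), ContDiff ℝ 1 ζ → HasCompactSupport ζ → (∀ x, 0 ≤ ζ x) → tsupport ζ ⊆ K →
    ∫ x, L.gr ζ (w j) x ∂μ ≤ ∫ x, ∑ k, G j k x * fderiv ℝ ζ x (L.b k) ∂μ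

lemma exists_apx {D K : Set E} (hD : IsOpen D) (hK : IsCompact K) (hKD : K ⊆ D) {u : E → ℝ}
    (hu : L.Sub μ D u) (hu0 : ∀ x ∈ D, u x ≤ 0) : ∃ w G C, L.Apx μ K u w G C := by
  obtain ⟨δ, hδ, hδD⟩ := hK.exists_cthickening_subset_open hD hKD
  set K2 := cthickening δ K with hK2
  have cK2 : IsCompact K2 := hK.cthickening
  set v : E → ℝ := K2.indicator u with hv
  have mK2 : MeasurableSet K2 := cK2.measurableSet
  have iuK : IntegrableOn u K2 μ := hu.li.integrableOn_compact_subset hδD cK2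
  have iv : Integrable v μ := (integrable_indicator_iff mK2).2 iuK
  have icv : ∀ k l, Integrable (fun y => L.c k l y * v y) μ := by
    intro k l
    have : (fun y => L.c k l y * v y) = K2.indicator fun y => u y * L.c k l y := by
      ext y
      by_cases h : y ∈ K2 <;> simp [hv, h, mul_comm]
    rw [this, integrable_indicator_iff mK2]
    exact iuK.mul_continuousOn (L.cont_c k l).continuousOn cK2
  have v0 : ∀ x, v x ≤ 0 := by
    intro x
    by_cases h : x ∈ K2
    · rw [hv, Set.indicator_of_mem h]; exact hu0 x (hδD h)
    · rw [hv, Set.indicator_of_notMem h]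
  obtain ⟨R0, hR0⟩ := hK.isBounded.exists_norm_le
  obtain ⟨A, hA, hb⟩ := L.dG_bound μ (R0 + 1)
  set s : ℝ := min (δ / 2) (1 / 2) with hs_def
  have hs : 0 < s := by positivity
  have hsδ : 2 * s ≤ δ := by have := min_le_left (δ / 2) (1 / 2 : ℝ); linarith
  have hs1 : 2 * s ≤ 1 := by have := min_le_right (δ / 2) (1 / 2 : ℝ); linarith
  have si : ∀ i, 0 < s / 2 ^ i := fun i => by positivity
  have si1 : ∀ i : ℕ, 2 * (s / 2 ^ i) ≤ 1 := by
    intro i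
    have : s / 2 ^ i ≤ s := div_le_self hs.le (one_le_pow₀ (by norm_num))
    linarith
  have st : Tendsto (fun i : ℕ => s / 2 ^ i) atTop (𝓝 0) := by
    have := (tendsto_pow_atTop_nhds_zero_of_lt_one (r := (1 / 2 : ℝ)) (by norm_num)
      (by norm_num)).const_mul s
    simpa [div_eq_mul_inv] using this
  have np : ∀ j x, cv μ v (et n s j) x ≤ 0 := fun j x => cv_nonpos μ v0 (et_props n hs j).2.1 x
  set B := A * (s ^ (2 * n))⁻¹ * ∫ y, |v y| ∂μ with hB
  have hB0 : 0 ≤ B := by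
    have : 0 ≤ ∫ y, |v y| ∂μ := integral_nonneg fun y => abs_nonneg _
    positivity
  set A' := A * 2 ^ (2 * n) with hA'
  have hA0 : 0 ≤ A' := by positivity
  have mb : ∀ j k x, x ∈ K → |L.dG μ v (mo n (s / 2 ^ (j + 1))) k x|
      ≤ A' * (- cv μ v (mo n (s / 2 ^ j)) x) := by
    intro j k x hx
    have h1 := (hb v iv icv (s / 2 ^ (j + 1)) k x (si _) (si1 _) (by linarith [hR0 x hx])).1
    have h2 : 2 * (s / 2 ^ (j + 1)) = s / 2 ^ j := by rw [pow_succ]; field_simp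
    rw [h2] at h1
    have h3 := cv_low (n := n) μ iv v0 (si j) x
    refine h1.trans ?_
    calc _ ≤ A * ((s / 2 ^ (j + 1)) ^ (2 * n))⁻¹ *
          ((s / 2 ^ j) ^ (2 * n) * -cv μ v (mo n (s / 2 ^ j)) x) := by gcongr
      _ = _ := by
        rw [hA', ← h2, mul_pow]
        have := (si (j + 1)).ne'
        field_simp
  have G0 : ∀ k x, x ∈ K → |L.dG μ v (et n s 0) k x| ≤ B := by
    intro k x hx
    have h1 := (hb v iv icv s k x hs hs1 (by linarith [hR0 x hx])).1
    refine h1.trans ?_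
    rw [hB]
    gcongr
    · exact Eventually.of_forall fun y => abs_nonneg _
    · exact iv.abs
    · exact Measure.restrict_le_self
  have Gs : ∀ j k x, x ∈ K → |L.dG μ v (et n s (j + 1)) k x| ≤ A' * (- cv μ v (et n s j) x) + B := by
    intro j k x hx
    have step : ∀ j, |L.dG μ v (et n s (j + 1)) k x| ≤ |L.dG μ v (et n s j) k x| / 4 +
        A' * (- cv μ v (mo n (s / 2 ^ j)) x) := by
      intro j
      rw [L.dG_et μ iv icv hs]
      refine (abs_add_le _ _).trans ?_
      rw [abs_div]
      have := mb j k x hx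
      norm_num
      linarith
    induction j with
    | zero =>
      have h1 := step 0
      have h2 := G0 k x hx
      have e : (et n s 0 : E → ℝ) = mo n (s / 2 ^ 0) := by simp [et]
      rw [← e] at h1
      linarith
    | succ j ih =>
      have h1 := step (j + 1)
      rw [cv_et μ iv hs j x]
      linarith
  refine ⟨fun j => cv μ v (et n s j), fun j => L.dG μ v (et n s j), 4 * A' + B, ?_⟩
  refine ⟨by positivity, fun j => cv_smooth μ iv (et_cs n hs j) (et_props n hs j).1, np,
    fun j k => L.dG_cont μ iv icv (et_cs n hs j) (et_props n hs j).1 k, ?_, ?_, ?_⟩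
  · intro j k x hx
    have n1 := np j x
    cases j with
    | zero =>
      have := G0 k x hx
      nlinarith
    | succ j =>
      have h1 := Gs j k x hx
      have h2 := cv_et (n := n) μ iv hs j x
      have h3 := cv_nonpos μ v0 (mo_nonneg n (si (j + 1))) x
      have h4 : - cv μ v (et n s j) x ≤ 4 * (- cv μ v (et n s (j + 1)) x) := by linarith
      have h5 := mul_le_mul_of_nonneg_left h4 hA0
      nlinarith
  · filter_upwards [lebPt_D μ L hD hu.li] with x hx hxK
    have hL : LebPt μ n v x := by
      refine lebPt_congr μ n ?_ (hx (hKD hxK))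
      filter_upwards [closedBall_mem_nhds x hδ] with y hy
      rw [hv, Set.indicator_of_mem (closedBall_subset_cthickening hxK δ hy)]
    have hvx : v x = u x := by
      rw [hv, Set.indicator_of_mem (closedBall_subset_cthickening hxK δ (mem_closedBall_self hδ.le))]
    constructor
    · have := rec_lim (x := fun j => cv μ v (et n s j) x) (fun j => cv_et (n := n) μ iv hs j x) (cv_lim μ L iv hL si st)
      rw [hvx, ← mul_assoc] at this
      exact this
    · intro k
      have t := leb_scale μ hL si st A
      have t2 : Tendsto (fun i => L.dG μ v (mo n (s / 2 ^ i)) k x) atTop (𝓝 0) := by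
        apply squeeze_zero_norm _ t
        intro i
        exact (hb v iv icv _ k x (si _) (si1 _) (by linarith [hR0 x hxK])).2
      have := rec_lim (x := fun j => L.dG μ v (et n s j) k x) (fun j => L.dG_et μ iv icv hs j k x) t2
      simpa using this
  · intro j ζ h1 h2 h3 h4
    refine L.star μ iv icv (et_cs n hs j) (et_props n hs j).1 K ?_ h1 h2 h3 h4
    intro x hx
    set φ : E → ℝ := fun y' => et n s j (x - y') with hφ
    have sφ : ContDiff ℝ (⊤ : ℕ∞) φ := (et_props n hs j).1.comp (contDiff_const.sub contDiff_id)
    have cφ : HasCompactSupport φ := (et_cs n hs j).comp_homeomorph (Homeomorph.subLeft x)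
    have tφ : tsupport φ ⊆ closedBall x (2 * s) := by
      refine closure_minimal ?_ isClosed_closedBall
      intro z hz
      by_contra h
      apply hz
      apply (et_props n hs j).2.2
      rw [mem_closedBall, dist_comm, dist_eq_norm] at h
      exact (not_le.1 h).le
    have tK : closedBall x (2 * s) ⊆ K2 := (closedBall_subset_closedBall hsδ).trans
      (closedBall_subset_cthickening hx δ)
    have := hu.pos φ sφ cφ (tφ.trans (tK.trans hδD)) (fun z => (et_props n hs j).2.1 _)
    refine this.trans_eq ?_
    rw [← integral_indicator hD.measurableSet]
    congr 1
    ext y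
    by_cases hy : y ∈ K2
    · rw [Set.indicator_of_mem (hδD hy), hv, Set.indicator_of_mem hy]
    · have : L.op φ y = 0 := L.op_eq_zero φ y fun h => hy (tK (tφ h))
      rw [this, mul_zero]
      by_cases hyD : y ∈ D <;> simp [hyD, this]

end Ell

namespace Ell

lemma lse_abs {V A : Type} [AddCommGroup V] [Module ℝ V] [Fintype A] (B : V →ₗ[ℝ] V →ₗ[ℝ] ℝ)
    (hB : ∀ e, 0 ≤ B e e) (l : A → V →ₗ[ℝ] ℝ) (N : A → ℝ) (p φ : ℝ) (hp : 0 ≤ p) (hφ : 0 ≤ φ)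
    (hl : 0 < φ → ∀ a e, l a e ≤ B e e + N a) (σ : A → ℝ) (hσ : ∀ a, 0 ≤ σ a) (hS : ∑ a, σ a ≤ 1)
    (d : A → V) (m f : V) (hm : m = ∑ a, σ a • d a) (ζ : A → V)
    (hζ : ∀ a, ζ a = σ a • f + (φ * (p * σ a)) • (d a - m)) :
    B f m - ∑ a, σ a * l a f - φ * p * ∑ a, σ a * N a ≤ ∑ a, (B (ζ a) (d a) - l a (ζ a)) := by
  have e1 : ∀ a, B (ζ a) (d a) - l a (ζ a) = σ a * B f (d a) - σ a * l a f
      + φ * p * (σ a * (B (d a - m) (d a - m) - l a (d a - m)) + σ a * B (d a - m) m) := by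
    intro a
    rw [hζ]
    simp only [map_add, map_smul, map_sub, LinearMap.add_apply, LinearMap.smul_apply,
      LinearMap.sub_apply, smul_eq_mul]
    ring
  have e2 : ∑ a, σ a * B f (d a) = B f m := by
    rw [hm, map_sum]
    simp
  have e3 : ∑ a, σ a * B (d a - m) m = (1 - ∑ a, σ a) * B m m := by
    have : ∑ a, σ a * B (d a) m = B m m := by
      have : ∀ v, B m v = ∑ a, σ a * B (d a) v := by
        intro v
        rw [hm]
        simp
      rw [this]
    simp only [map_sub, LinearMap.sub_apply, mul_sub, Finset.sum_sub_distrib, this, ← Finset.sum_mul]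
    ring
  simp only [e1, Finset.sum_add_distrib, Finset.sum_sub_distrib, ← Finset.mul_sum, e2, e3]
  rcases hφ.eq_or_lt with h0 | h0
  · simp [← h0]
  have h1 : - ∑ a, σ a * N a ≤ ∑ a, σ a * (B (d a - m) (d a - m) - l a (d a - m)) := by
    rw [← Finset.sum_neg_distrib]
    refine Finset.sum_le_sum fun a _ => ?_
    have := mul_le_mul_of_nonneg_left (hl h0 a (d a - m)) (hσ a)
    linarith
  have h2 : 0 ≤ (1 - ∑ a, σ a) * B m m := mul_nonneg (by linarith) (hB m)
  have h3 : 0 ≤ φ * p := mul_nonneg hφ hp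
  nlinarith

variable {n : ℕ} {E ι : Type} [NormedAddCommGroup E] [NormedSpace ℝ E]
  [FiniteDimensional ℝ E] [Fintype ι] [DecidableEq ι] [MeasurableSpace E] [BorelSpace E]
  (μ : Measure E) [μ.IsAddHaarMeasure]

variable (L : Ell n E ι)

lemma ellip (R : ℝ) : ∃ C, 1 ≤ C ∧ ∀ z, ‖z‖ ≤ R → ∀ ξ : ι → ℝ,
    ∑ k, ξ k ^ 2 ≤ C * ∑ k, ∑ l, L.c k l z * ξ k * ξ l := by
  set q : E × (ι → ℝ) → ℝ := fun P => ∑ k, ∑ l, L.c k l P.1 * P.2 k * P.2 l with hq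
  have cq : Continuous q := by
    refine continuous_finsetSum _ fun k _ => continuous_finsetSum _ fun l _ => ?_
    have := (L.cont_c k l)
    fun_prop
  have q0 : ∀ z ξ, 0 ≤ q (z, ξ) := by
    intro z ξ
    by_cases h : ξ = 0
    · simp [hq, h]
    · exact (L.pos z ξ h).le
  have sc : ∀ z (a : ℝ) ξ, q (z, a • ξ) = a ^ 2 * q (z, ξ) := by
    intro z a ξ
    simp only [hq, Finset.mul_sum, Pi.smul_apply, smul_eq_mul]
    exact Finset.sum_congr rfl fun k _ => Finset.sum_congr rfl fun l _ => by ring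
  have hc : ∀ ξ : ι → ℝ, ∑ k, ξ k ^ 2 ≤ Fintype.card ι * ‖ξ‖ ^ 2 := by
    intro ξ
    refine (Finset.sum_le_sum (g := fun _ => ‖ξ‖ ^ 2) fun k _ => ?_).trans (by simp)
    have := norm_le_pi_norm ξ k
    rw [← sq_abs]
    gcongr
    simpa using this
  by_cases hne : (closedBall (0 : E) R ×ˢ sphere (0 : ι → ℝ) 1).Nonempty
  · have hK : IsCompact (closedBall (0 : E) R ×ˢ sphere (0 : ι → ℝ) 1) :=
      (isCompact_closedBall 0 R).prod (isCompact_sphere 0 1)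
    obtain ⟨p, hp, hmin⟩ := hK.exists_isMinOn hne cq.continuousOn
    have hpos : 0 < q p := by
      apply L.pos
      intro h
      have := hp.2
      simp [h] at this
    refine ⟨max 1 (Fintype.card ι * (q p)⁻¹), le_max_left _ _, fun z hz ξ => ?_⟩
    by_cases hy : ξ = 0
    · simp [hy]
    have hy' : 0 < ‖ξ‖ := norm_pos_iff.2 hy
    have h1 : q p ≤ q (z, ‖ξ‖⁻¹ • ξ) := by
      have := hmin (show (z, ‖ξ‖⁻¹ • ξ) ∈ _ from ⟨by simpa using hz, by
        simp [norm_smul, hy'.ne']⟩)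
      simpa using this
    rw [sc] at h1
    have h2 : q p * ‖ξ‖ ^ 2 ≤ q (z, ξ) := by
      have := mul_le_mul_of_nonneg_right h1 (sq_nonneg ‖ξ‖)
      refine this.trans (le_of_eq ?_)
      field_simp
    calc _ ≤ (Fintype.card ι : ℝ) * ‖ξ‖ ^ 2 := hc ξ
      _ = Fintype.card ι * (q p)⁻¹ * (q p * ‖ξ‖ ^ 2) := by field_simp
      _ ≤ Fintype.card ι * (q p)⁻¹ * q (z, ξ) := by gcongr
      _ ≤ _ := by
        gcongr
        · exact q0 z ξ
        · exact le_max_right _ _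
  · refine ⟨1, le_rfl, fun z hz ξ => ?_⟩
    by_cases hy : ξ = 0
    · simp [hy]
    · exfalso
      apply hne
      exact ⟨(z, ‖ξ‖⁻¹ • ξ), by simpa using hz, by
        simp [norm_smul, (norm_pos_iff.2 hy).ne']⟩

variable {A : Type} [Fintype A]

/-- log-sum-exp -/
noncomputable def lse (p M : ℝ) (t : A → ℝ) : ℝ :=
  p⁻¹ * Real.log (Real.exp (-(p * M)) + ∑ a, Real.exp (p * t a))

lemma lse_T_pos (p M : ℝ) (t : A → ℝ) : 0 < Real.exp (-(p * M)) + ∑ a, Real.exp (p * t a) := by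
  have : 0 ≤ ∑ a, Real.exp (p * t a) := Finset.sum_nonneg fun a _ => (Real.exp_pos _).le
  have := Real.exp_pos (-(p * M))
  linarith

lemma lse_exp {p : ℝ} (hp : 0 < p) (M : ℝ) (t : A → ℝ) (s : ℝ) :
    Real.exp (p * (s - lse p M t)) =
      Real.exp (p * s) / (Real.exp (-(p * M)) + ∑ a, Real.exp (p * t a)) := by
  unfold lse
  rw [mul_sub, Real.exp_sub, ← mul_assoc, mul_inv_cancel₀ hp.ne', one_mul,
    Real.exp_log (lse_T_pos p M t)]

lemma lse_bounds {p : ℝ} (hp : 0 < p) {M : ℝ} {t : A → ℝ} {m : ℝ} (h1 : -M ≤ m) (h2 : ∀ a, t a ≤ m)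
    (h3 : m = -M ∨ ∃ a, m = t a) :
    m ≤ lse p M t ∧ lse p M t ≤ m + p⁻¹ * Real.log (1 + Fintype.card A) := by
  have hT := lse_T_pos p M t
  set T := Real.exp (-(p * M)) + ∑ a, Real.exp (p * t a) with hTd
  have l1 : Real.exp (p * m) ≤ T := by
    rcases h3 with h | ⟨a, h⟩
    · have : 0 ≤ ∑ a, Real.exp (p * t a) := Finset.sum_nonneg fun a _ => (Real.exp_pos _).le
      rw [h, mul_neg]; linarith
    · have : Real.exp (p * t a) ≤ ∑ a, Real.exp (p * t a) :=
        Finset.single_le_sum (f := fun a => Real.exp (p * t a)) (fun a _ => (Real.exp_pos _).le)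
          (Finset.mem_univ a)
      have := Real.exp_pos (-(p * M))
      rw [h]; linarith
  have l2 : T ≤ Real.exp (p * m) * (1 + Fintype.card A) := by
    have a1 : Real.exp (-(p * M)) ≤ Real.exp (p * m) := Real.exp_le_exp.2 (by nlinarith)
    have a2 : ∑ a, Real.exp (p * t a) ≤ ∑ a : A, Real.exp (p * m) :=
      Finset.sum_le_sum fun a _ => Real.exp_le_exp.2 (mul_le_mul_of_nonneg_left (h2 a) hp.le)
    simp at a2
    linarith
  have hl : lse p M t = p⁻¹ * Real.log T := rfl
  rw [hl]
  constructor
  · have := Real.log_le_log (Real.exp_pos _) l1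
    rw [Real.log_exp] at this
    rw [inv_mul_eq_div, le_div_iff₀ hp]
    linarith
  · have := Real.log_le_log hT l2
    rw [Real.log_mul (Real.exp_pos _).ne' (by positivity), Real.log_exp] at this
    calc p⁻¹ * Real.log T ≤ p⁻¹ * (p * m + Real.log (1 + Fintype.card A)) := by gcongr
      _ = _ := by field_simp

/-- error term -/
noncomputable def err (L : Ell n E ι) (p M Λ : ℝ) (w : A → E → ℝ) (G : A → ι → E → ℝ) (φ : E → ℝ) (x : E) : ℝ :=
  (∑ a, Real.exp (p * (w a x - lse p M fun a => w a x)) * ∑ k, G a k x * fderiv ℝ φ x (L.b k))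
  + φ x * p * ∑ a, Real.exp (p * (w a x - lse p M fun a => w a x)) * (Λ * ∑ k, G a k x ^ 2)

lemma lse_ineq {K : Set E} (w : A → E → ℝ) (G : A → ι → E → ℝ)
    (hw : ∀ a, ContDiff ℝ (⊤ : ℕ∞) (w a)) (hG : ∀ a k, Continuous (G a k))
    (hstar : ∀ a (ζ : E → ℝ), ContDiff ℝ 1 ζ → HasCompactSupport ζ → (∀ x, 0 ≤ ζ x) → tsupport ζ ⊆ K →
    ∫ x, L.gr ζ (w a) x ∂μ ≤ ∫ x, ∑ k, G a k x * fderiv ℝ ζ x (L.b k) ∂μ)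
    {φ : E → ℝ} (hφ : ContDiff ℝ (⊤ : ℕ∞) φ) (hφc : HasCompactSupport φ) (hφ0 : ∀ x, 0 ≤ φ x)
    (hφK : tsupport φ ⊆ K) {p M Λ : ℝ} (hp : 0 < p) (hΛ : 0 < Λ)
    (hell : ∀ x, 0 < φ x → ∀ ξ : ι → ℝ,
      ∑ k, ξ k ^ 2 ≤ 4 * Λ * ∑ k, ∑ l, L.c k l x * ξ k * ξ l) :
    Continuous (L.err p M Λ w G φ) ∧ Continuous (fun x => lse p M fun a => w a x) ∧
    0 ≤ ∫ x, (lse p M fun a => w a x) * L.op φ x ∂μ + ∫ x, L.err p M Λ w G φ x ∂μ := by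
  set F : E → ℝ := fun x => lse p M fun a => w a x with hF
  have sF : ContDiff ℝ (⊤ : ℕ∞) F := by
    refine contDiff_const.mul (ContDiff.log ?_ fun x => (lse_T_pos p M _).ne')
    exact contDiff_const.add (ContDiff.sum fun a _ => (contDiff_const.mul (hw a)).exp)
  set σ : A → E → ℝ := fun a x => Real.exp (p * (w a x - F x)) with hσ
  have sσ : ∀ a, ContDiff ℝ (⊤ : ℕ∞) (σ a) := fun a =>
    (contDiff_const.mul ((hw a).sub sF)).exp
  have dw : ∀ a x, HasFDerivAt (w a) (fderiv ℝ (w a) x) x := fun a x =>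
    ((hw a).differentiable (by simp) x).hasFDerivAt
  have dF : ∀ x, HasFDerivAt F (∑ a, σ a x • fderiv ℝ (w a) x) x := by
    intro x
    have h1 : HasFDerivAt (fun x => ∑ a, Real.exp (p * w a x))
        (∑ a, Real.exp (p * w a x) • (p • fderiv ℝ (w a) x)) x :=
      HasFDerivAt.fun_sum fun a _ => ((dw a x).const_mul p).exp
    have h2 := ((h1.const_add (Real.exp (-(p * M)))).log (lse_T_pos p M fun a => w a x).ne').const_mul p⁻¹
    refine h2.congr_fderiv ?_
    simp only [Finset.smul_sum]
    refine Finset.sum_congr rfl fun a _ => ?_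
    simp only [hσ, hF, lse_exp hp, smul_smul]
    congr 1
    have := (lse_T_pos p M fun a => w a x).ne'
    field_simp
  have dσ : ∀ a x, HasFDerivAt (σ a) ((p * σ a x) • (fderiv ℝ (w a) x - fderiv ℝ F x)) x := by
    intro a x
    have := (((dw a x).sub (dF x).differentiableAt.hasFDerivAt).const_mul p).exp
    refine this.congr_fderiv ?_
    rw [smul_smul]
    congr 1
    simp only [hσ]
    exact mul_comm _ _
  set ζ : A → E → ℝ := fun a x => φ x * σ a x with hζ
  have sζ : ∀ a, ContDiff ℝ (⊤ : ℕ∞) (ζ a) := fun a => hφ.mul (sσ a)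
  have cζ : ∀ a, HasCompactSupport (ζ a) := fun a => hφc.mul_right
  have dφ : ∀ x, HasFDerivAt φ (fderiv ℝ φ x) x := fun x => (hφ.differentiable (by simp) x).hasFDerivAt
  have dζ : ∀ a x, fderiv ℝ (ζ a) x = σ a x • fderiv ℝ φ x +
      (φ x * (p * σ a x)) • (fderiv ℝ (w a) x - fderiv ℝ F x) := by
    intro a x
    have := ((dφ x).mul (dσ a x)).fderiv
    refine this.trans ?_
    rw [smul_smul, add_comm]
  have σ0 : ∀ a x, 0 ≤ σ a x := fun a x => (Real.exp_pos _).le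
  have σ1 : ∀ x, ∑ a, σ a x ≤ 1 := by
    intro x
    simp only [hσ, hF, lse_exp hp]
    rw [← Finset.sum_div, div_le_one (lse_T_pos p M _)]
    have := Real.exp_pos (-(p * M))
    linarith
  have cfd : ∀ (u : E → ℝ), ContDiff ℝ (⊤ : ℕ∞) u → ∀ v, Continuous fun x => fderiv ℝ u x v :=
    fun u hu v => (smooth_fd hu v).continuous
  have cerr : Continuous (L.err p M Λ w G φ) := by
    have c1 : ∀ a, Continuous fun x => Real.exp (p * (w a x - lse p M fun a => w a x)) :=
      fun a => (sσ a).continuous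
    have c2 := hφ.continuous
    have c3 := fun k => cfd φ hφ (L.b k)
    unfold err
    fun_prop
  refine ⟨cerr, sF.continuous, ?_⟩
  have ierr : Integrable (L.err p M Λ w G φ) μ := by
    refine cerr.integrable_of_hasCompactSupport (HasCompactSupport.intro hφc fun x hx => ?_)
    have h1 : φ x = 0 := image_eq_zero_of_notMem_tsupport hx
    have h2 : ∀ v, fderiv ℝ φ x v = 0 := by
      intro v
      have : x ∉ tsupport fun x => fderiv ℝ φ x v := fun h => hx (tsupport_fderiv_apply_subset ℝ v h)
      exact image_eq_zero_of_notMem_tsupport (f := fun x => fderiv ℝ φ x v) this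
    simp [err, h1, h2]
  have g1 := L.green_aux μ F φ (sF.of_le (by norm_cast)) (hφ.of_le (by norm_cast)) (Or.inr hφc)
  have i1 : ∀ a, Integrable (L.gr (ζ a) (w a)) μ := fun a =>
    (L.green_aux μ (ζ a) (w a) ((sζ a).of_le (by norm_cast)) ((hw a).of_le (by norm_cast))
      (Or.inl (cζ a))).2.1
  have i2 : ∀ a, Integrable (fun x => ∑ k, G a k x * fderiv ℝ (ζ a) x (L.b k)) μ := fun a =>
    integrable_finsetSum _ fun k _ => ((hG a k).mul (cfd _ (sζ a) _)).integrable_of_hasCompactSupport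
      ((cζ a).fderiv_apply (𝕜 := ℝ) _).mul_left
  have s0 : ∑ a, (∫ x, L.gr (ζ a) (w a) x ∂μ - ∫ x, ∑ k, G a k x * fderiv ℝ (ζ a) x (L.b k) ∂μ) ≤ 0 := by
    refine Finset.sum_nonpos fun a _ => ?_
    have := hstar a (ζ a) ((sζ a).of_le (by norm_cast)) (cζ a)
      (fun x => mul_nonneg (hφ0 x) (σ0 a x))
      ((closure_mono (Function.support_mul_subset_left _ _)).trans hφK)
    linarith
  have i3 : ∀ a, Integrable (fun x => L.gr (ζ a) (w a) x - ∑ k, G a k x * fderiv ℝ (ζ a) x (L.b k)) μ :=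
    fun a => (i1 a).sub (i2 a)
  have e0 : ∑ a, (∫ x, L.gr (ζ a) (w a) x ∂μ - ∫ x, ∑ k, G a k x * fderiv ℝ (ζ a) x (L.b k) ∂μ)
      = ∫ x, ∑ a, (L.gr (ζ a) (w a) x - ∑ k, G a k x * fderiv ℝ (ζ a) x (L.b k)) ∂μ := by
    rw [integral_finsetSum _ fun a _ => i3 a]
    exact Finset.sum_congr rfl fun a _ => (integral_sub (i1 a) (i2 a)).symm
  rw [e0] at s0
  have pt : ∀ x, L.gr F φ x - L.err p M Λ w G φ x ≤
      ∑ a, (L.gr (ζ a) (w a) x - ∑ k, G a k x * fderiv ℝ (ζ a) x (L.b k)) := by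
    intro x
    let B : (E →L[ℝ] ℝ) →ₗ[ℝ] (E →L[ℝ] ℝ) →ₗ[ℝ] ℝ := LinearMap.mk₂ ℝ
      (fun e f => ∑ k, ∑ l, L.c k l x * e (L.b k) * f (L.b l))
      (fun a b c => by
        simp only [ContinuousLinearMap.add_apply, ← Finset.sum_add_distrib]
        exact Finset.sum_congr rfl fun k _ => Finset.sum_congr rfl fun l _ => by ring)
      (fun a b c => by
        simp only [ContinuousLinearMap.smul_apply, smul_eq_mul, Finset.mul_sum]
        exact Finset.sum_congr rfl fun k _ => Finset.sum_congr rfl fun l _ => by ring)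
      (fun a b c => by
        simp only [ContinuousLinearMap.add_apply, ← Finset.sum_add_distrib]
        exact Finset.sum_congr rfl fun k _ => Finset.sum_congr rfl fun l _ => by ring)
      (fun a b c => by
        simp only [ContinuousLinearMap.smul_apply, smul_eq_mul, Finset.mul_sum]
        exact Finset.sum_congr rfl fun k _ => Finset.sum_congr rfl fun l _ => by ring)
    have hBd : ∀ e f, B e f = ∑ k, ∑ l, L.c k l x * e (L.b k) * f (L.b l) := fun e f => rfl
    let l : A → (E →L[ℝ] ℝ) →ₗ[ℝ] ℝ := fun a =>
      { toFun := fun e => ∑ k, G a k x * e (L.b k)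
        map_add' := fun e f => by
          simp only [ContinuousLinearMap.add_apply, ← Finset.sum_add_distrib]
          exact Finset.sum_congr rfl fun k _ => by ring
        map_smul' := fun c e => by
          simp only [ContinuousLinearMap.smul_apply, smul_eq_mul, Finset.mul_sum, RingHom.id_apply]
          exact Finset.sum_congr rfl fun k _ => by ring }
    have hld : ∀ a e, l a e = ∑ k, G a k x * e (L.b k) := fun a e => rfl
    have main := lse_abs B (fun e => by
        rw [hBd]
        by_cases h : (fun k => e (L.b k)) = 0
        · have : ∀ k, e (L.b k) = 0 := fun k => congrFun h k
          simp [this]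
        · exact (L.pos x _ h).le) l (fun a => Λ * ∑ k, G a k x ^ 2) p (φ x) hp.le (hφ0 x)
      (by
        intro h a e
        rw [hBd, hld]
        have h1 := hell x h (fun k => e (L.b k))
        set Qe := ∑ k, ∑ l, L.c k l x * e (L.b k) * e (L.b l) with hQe
        have h2 : ∑ k, G a k x * e (L.b k) ≤ Λ * ∑ k, G a k x ^ 2 + (4 * Λ)⁻¹ * ∑ k, e (L.b k) ^ 2 := by
          rw [Finset.mul_sum, Finset.mul_sum, ← Finset.sum_add_distrib]
          refine Finset.sum_le_sum fun k _ => ?_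
          have : 0 ≤ Λ * (G a k x - (2 * Λ)⁻¹ * e (L.b k)) ^ 2 := by positivity
          have e4 : Λ * (G a k x - (2 * Λ)⁻¹ * e (L.b k)) ^ 2 = Λ * G a k x ^ 2 +
              (4 * Λ)⁻¹ * e (L.b k) ^ 2 - G a k x * e (L.b k) := by
            field_simp
            ring
          linarith
        have h3 : (4 * Λ)⁻¹ * ∑ k, e (L.b k) ^ 2 ≤ Qe := by
          rw [inv_mul_le_iff₀ (by positivity)]
          exact h1
        linarith)
      (fun a => σ a x) (fun a => σ0 a x) (σ1 x) (fun a => fderiv ℝ (w a) x) (fderiv ℝ F x)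
      (fderiv ℝ φ x) (dF x).fderiv (fun a => fderiv ℝ (ζ a) x) (fun a => dζ a x)
    simp only [hBd, hld] at main
    rw [L.gr_comm F φ]
    refine le_trans (le_of_eq ?_) main
    unfold err gr
    ring
  have s1 : ∫ x, (L.gr F φ x - L.err p M Λ w G φ x) ∂μ ≤ 0 :=
    (integral_mono (g1.2.1.sub ierr) (integrable_finsetSum _ fun a _ => i3 a) pt).trans s0
  rw [integral_sub g1.2.1 ierr] at s1
  have := g1.2.2
  linarith

end Ell

namespace Ell

variable {n : ℕ} {E ι : Type} [NormedAddCommGroup E] [NormedSpace ℝ E]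
  [FiniteDimensional ℝ E] [Fintype ι] [DecidableEq ι] [MeasurableSpace E] [BorelSpace E]
  (μ : Measure E) [μ.IsAddHaarMeasure]

variable (L : Ell n E ι)

variable {A : Type} [Fintype A]

lemma lse_abs_le {p M : ℝ} (hp : 1 ≤ p) (hM : 0 ≤ M) {t : A → ℝ} (ht : ∀ a, t a ≤ 0) :
    |lse p M t| ≤ M + Real.log (1 + Fintype.card A) := by
  have hT := lse_T_pos p M t
  have hp0 : 0 < p := by linarith
  have hl : lse p M t = p⁻¹ * Real.log (Real.exp (-(p * M)) + ∑ a, Real.exp (p * t a)) := rfl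
  set T := Real.exp (-(p * M)) + ∑ a, Real.exp (p * t a) with hTd
  have l0 : 0 ≤ ∑ a, Real.exp (p * t a) := Finset.sum_nonneg fun a _ => (Real.exp_pos _).le
  have l1 : -(p * M) ≤ Real.log T := by
    rw [Real.le_log_iff_exp_le hT]; linarith
  have l2 : Real.log T ≤ Real.log (1 + Fintype.card A) := by
    apply Real.log_le_log hT
    have : ∑ a, Real.exp (p * t a) ≤ ∑ a : A, (1 : ℝ) := Finset.sum_le_sum fun a _ => by
      rw [Real.exp_le_one_iff]; exact mul_nonpos_of_nonneg_of_nonpos hp0.le (ht a)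
    have h2 : Real.exp (-(p * M)) ≤ 1 := by
      rw [Real.exp_le_one_iff]; nlinarith
    simp at this
    linarith
  have l3 : 0 ≤ Real.log (1 + Fintype.card A) := Real.log_nonneg (by simp)
  rw [hl, abs_le]
  have hi : p⁻¹ ≤ 1 := inv_le_one_of_one_le₀ hp
  have hi0 : 0 < p⁻¹ := inv_pos.2 hp0
  constructor
  · have : p⁻¹ * (-(p * M)) ≤ p⁻¹ * Real.log T := mul_le_mul_of_nonneg_left l1 hi0.le
    have e : p⁻¹ * (-(p * M)) = -M := by field_simp
    linarith
  · have : p⁻¹ * Real.log T ≤ p⁻¹ * Real.log (1 + Fintype.card A) := mul_le_mul_of_nonneg_left l2 hi0.le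
    nlinarith

lemma sig_le {p M : ℝ} (hp : 1 ≤ p) {t : A → ℝ} {s : ℝ} (hs : s ≤ 0) :
    Real.exp (p * (s - lse p M t)) ≤ Real.exp (p * M) * Real.exp s := by
  rw [lse_exp (by linarith), div_le_iff₀ (lse_T_pos p M t)]
  have l0 : 0 ≤ ∑ a, Real.exp (p * t a) := Finset.sum_nonneg fun a _ => (Real.exp_pos _).le
  have h1 : Real.exp (p * s) ≤ Real.exp s := Real.exp_le_exp.2 (by nlinarith)
  have h2 : Real.exp (p * M) * Real.exp s * Real.exp (-(p * M)) = Real.exp s := by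
    rw [← Real.exp_add, ← Real.exp_add]; congr 1; ring
  have h3 : 0 ≤ Real.exp (p * M) * Real.exp s := by positivity
  nlinarith

lemma exp_one_sub {s : ℝ} (hs : s ≤ 0) : Real.exp s * (1 - s) ≤ 1 ∧ Real.exp s * (1 - s) ^ 2 ≤ 4 := by
  constructor
  · have := Real.add_one_le_exp (-s)
    have h : Real.exp s * Real.exp (-s) = 1 := by rw [← Real.exp_add]; simp
    nlinarith [Real.exp_pos s]
  · have := Real.add_one_le_exp (-(s / 2))
    have h : Real.exp s * Real.exp (-(s / 2)) ^ 2 = 1 := by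
      rw [← Real.exp_nat_mul, ← Real.exp_add]; simp; ring
    have h2 : (1 - s) ^ 2 ≤ 4 * Real.exp (-(s / 2)) ^ 2 := by
      have : (1 - s) ≤ 2 * Real.exp (-(s / 2)) := by linarith
      calc (1 - s) ^ 2 ≤ (2 * Real.exp (-(s / 2))) ^ 2 := by gcongr; linarith
        _ = _ := by ring
    nlinarith [Real.exp_pos s]

lemma lse_cont {p M : ℝ} : Continuous fun t : A → ℝ => lse p M t := by
  unfold lse
  refine continuous_const.mul (Continuous.log (by fun_prop) fun t => (lse_T_pos p M t).ne')

lemma err_bound {p M Λ : ℝ} (hp : 1 ≤ p) (hΛ : 0 < Λ) {w : A → E → ℝ} {G : A → ι → E → ℝ} {φ : E → ℝ}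
    (hφ0 : ∀ x, 0 ≤ φ x) (x : E) (hw : ∀ a, w a x ≤ 0) (C : A → ℝ)
    (hC : ∀ a, 0 ≤ C a) (hG : ∀ a k, |G a k x| ≤ C a * (1 - w a x)) :
    |L.err p M Λ w G φ x| ≤ (∑ a, Real.exp (p * M) * ∑ k, C a * |fderiv ℝ φ x (L.b k)|) +
      φ x * p * ∑ a, Real.exp (p * M) * (Λ * ∑ k : ι, C a ^ 2 * 4) := by
  unfold err
  have hσ : ∀ a, Real.exp (p * (w a x - lse p M fun a => w a x)) ≤ Real.exp (p * M) * Real.exp (w a x) :=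
    fun a => sig_le hp (hw a)
  have hp0 : 0 ≤ p := by linarith
  refine (abs_add_le _ _).trans (add_le_add ?_ ?_)
  · refine (Finset.abs_sum_le_sum_abs _ _).trans (Finset.sum_le_sum fun a _ => ?_)
    rw [abs_mul, Real.abs_exp]
    have : |∑ k, G a k x * fderiv ℝ φ x (L.b k)| ≤ ∑ k, C a * (1 - w a x) * |fderiv ℝ φ x (L.b k)| := by
      refine (Finset.abs_sum_le_sum_abs _ _).trans (Finset.sum_le_sum fun k _ => ?_)
      rw [abs_mul]
      exact mul_le_mul_of_nonneg_right (hG a k) (abs_nonneg _)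
    refine (mul_le_mul (hσ a) this (abs_nonneg _) (by positivity)).trans ?_
    rw [mul_assoc]
    refine mul_le_mul_of_nonneg_left ?_ (Real.exp_pos _).le
    rw [Finset.mul_sum]
    refine Finset.sum_le_sum fun k _ => ?_
    have h1 := (exp_one_sub (hw a)).1
    calc _ = (Real.exp (w a x) * (1 - w a x)) * (C a * |fderiv ℝ φ x (L.b k)|) := by ring
      _ ≤ 1 * (C a * |fderiv ℝ φ x (L.b k)|) := by
        refine mul_le_mul_of_nonneg_right h1 (mul_nonneg (hC a) (abs_nonneg _))
      _ = _ := one_mul _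
  · rw [abs_mul, abs_of_nonneg (mul_nonneg (hφ0 x) hp0)]
    refine mul_le_mul_of_nonneg_left ?_ (mul_nonneg (hφ0 x) hp0)
    refine (Finset.abs_sum_le_sum_abs _ _).trans (Finset.sum_le_sum fun a _ => ?_)
    have h0 : 0 ≤ Λ * ∑ k, G a k x ^ 2 := by positivity
    rw [abs_mul, Real.abs_exp, abs_of_nonneg h0]
    have : Λ * ∑ k, G a k x ^ 2 ≤ Λ * ∑ k : ι, (C a * (1 - w a x)) ^ 2 := by
      refine mul_le_mul_of_nonneg_left (Finset.sum_le_sum fun k _ => ?_) hΛ.le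
      rw [← sq_abs]
      exact pow_le_pow_left₀ (abs_nonneg _) (hG a k) 2
    refine (mul_le_mul (hσ a) this h0 (by positivity)).trans ?_
    rw [mul_assoc]
    refine mul_le_mul_of_nonneg_left ?_ (Real.exp_pos _).le
    rw [mul_left_comm]
    refine mul_le_mul_of_nonneg_left ?_ hΛ.le
    rw [Finset.mul_sum]
    refine Finset.sum_le_sum fun k _ => ?_
    have h1 := (exp_one_sub (hw a)).2
    calc _ = (C a ^ 2) * (Real.exp (w a x) * (1 - w a x) ^ 2) := by ring
      _ ≤ _ := mul_le_mul_of_nonneg_left h1 (sq_nonneg _)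

lemma lse_lim {D : Set E} (hD : IsOpen D) (u : A → E → ℝ) (hu : ∀ a, L.Sub μ D (u a))
    (hu0 : ∀ a, ∀ x ∈ D, u a x ≤ 0) {φ : E → ℝ} (hφ : ContDiff ℝ (⊤ : ℕ∞) φ) (hφc : HasCompactSupport φ)
    (hφD : tsupport φ ⊆ D) (hφ0 : ∀ x, 0 ≤ φ x) {p M : ℝ} (hp : 1 ≤ p) (hM : 0 ≤ M) :
    Integrable (fun x => (lse p M fun a => cst E μ * u a x) * L.op φ x) μ ∧
    0 ≤ ∫ x, (lse p M fun a => cst E μ * u a x) * L.op φ x ∂μ := by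
  have hap := fun a => L.exists_apx μ hD hφc.isCompact hφD (hu a) (hu0 a)
  choose w G C H using hap
  obtain ⟨R, hR⟩ := hφc.isCompact.isBounded.exists_norm_le
  obtain ⟨Λ0, hΛ0, hell⟩ := L.ellip R
  set Λ := Λ0 / 4 with hΛd
  have hΛ : 0 < Λ := by positivity
  have h4 : 4 * Λ = Λ0 := by rw [hΛd]; ring
  have key := fun j => L.lse_ineq μ (K := tsupport φ) (fun a => w a j) (fun a => G a j) (fun a => (H a).sm j)
    (fun a k => (H a).Gc j k) (fun a => (H a).star j) hφ hφc hφ0 subset_rfl (p := p) (M := M) (by linarith)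
    hΛ (fun x hx ξ => by
      rw [h4]
      exact hell x (hR x (subset_tsupport _ (Function.mem_support.2 hx.ne'))) ξ)
  have φ20 : ContDiff ℝ 2 φ := hφ.of_le (WithTop.coe_le_coe.2 le_top)
  have cop : Continuous (L.op φ) := L.op_cont φ φ20
  have hae : ∀ᵐ x ∂μ, ∀ a, x ∈ tsupport φ → Tendsto (fun j => w a j x) atTop (𝓝 (cst E μ * u a x)) ∧
    ∀ k, Tendsto (fun j => G a j k x) atTop (𝓝 0) := ae_all_iff.2 fun a => (H a).lim
  have off1 : ∀ x, x ∉ tsupport φ → φ x = 0 := fun x hx => image_eq_zero_of_notMem_tsupport hx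
  have off2 : ∀ x, x ∉ tsupport φ → fderiv ℝ φ x = 0 := fun x hx =>
    image_eq_zero_of_notMem_tsupport fun h => hx (tsupport_fderiv_subset ℝ h)
  -- limit of lse part
  have ptl : ∀ᵐ x ∂μ, Tendsto (fun j => (lse p M fun a => w a j x) * L.op φ x) atTop
      (𝓝 ((lse p M fun a => cst E μ * u a x) * L.op φ x)) := by
    filter_upwards [hae] with x hx
    by_cases h : x ∈ tsupport φ
    · exact (((lse_cont (p := p) (M := M)).tendsto _).comp
        (tendsto_pi_nhds.2 fun a => (hx a h).1)).mul_const _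
    · simp [L.op_eq_zero φ x h]
  have bdl : ∀ j x, ‖(lse p M fun a => w a j x) * L.op φ x‖ ≤
      (M + Real.log (1 + Fintype.card A)) * |L.op φ x| := by
    intro j x
    rw [norm_mul, Real.norm_eq_abs, Real.norm_eq_abs]
    exact mul_le_mul_of_nonneg_right (lse_abs_le hp hM fun a => (H a).np j x) (abs_nonneg _)
  have il : Integrable (fun x => (M + Real.log (1 + Fintype.card A)) * |L.op φ x|) μ :=
    ((cop.integrable_of_hasCompactSupport (L.op_cs φ hφc)).abs).const_mul _
  have ml : ∀ j, AEStronglyMeasurable (fun x => (lse p M fun a => w a j x) * L.op φ x) μ := fun j =>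
    ((key j).2.1.mul cop).aestronglyMeasurable
  have lim1 := tendsto_integral_of_dominated_convergence _ ml il (fun j => Eventually.of_forall (bdl j)) ptl
  have intl : Integrable (fun x => (lse p M fun a => cst E μ * u a x) * L.op φ x) μ := by
    refine il.mono' (aestronglyMeasurable_of_tendsto_ae atTop ml ptl) ?_
    filter_upwards [ptl] with x hx
    exact le_of_tendsto hx.norm (Eventually.of_forall fun j => bdl j x)
  refine ⟨intl, ?_⟩
  -- error part
  set B : E → ℝ := fun x => (∑ a, Real.exp (p * M) * ∑ k, C a * |fderiv ℝ φ x (L.b k)|) +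
      φ x * p * ∑ a, Real.exp (p * M) * (Λ * ∑ k : ι, C a ^ 2 * 4) with hB
  have cB : Continuous B := by
    have c2 := hφ.continuous
    have c3 : ∀ k, Continuous fun x => fderiv ℝ φ x (L.b k) := fun k => (smooth_fd hφ (L.b k)).continuous
    fun_prop
  have iB : Integrable B μ := by
    refine cB.integrable_of_hasCompactSupport (HasCompactSupport.intro hφc fun x hx => ?_)
    simp [hB, off1 x hx, off2 x hx]
  have bde : ∀ j x, ‖L.err p M Λ (fun a => w a j) (fun a => G a j) φ x‖ ≤ B x := by
    intro j x
    by_cases h : x ∈ tsupport φ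
    · exact L.err_bound hp hΛ hφ0 x (fun a => (H a).np j x) C (fun a => (H a).C0)
        fun a k => (H a).Gb j k x h
    · simp [hB, err, off1 x h, off2 x h]
  have pte : ∀ᵐ x ∂μ, Tendsto (fun j => L.err p M Λ (fun a => w a j) (fun a => G a j) φ x) atTop (𝓝 0) := by
    filter_upwards [hae] with x hx
    by_cases h : x ∈ tsupport φ
    · have t1 : Tendsto (fun j => lse p M fun a => w a j x) atTop (𝓝 (lse p M fun a => cst E μ * u a x)) :=
        ((lse_cont (p := p) (M := M)).tendsto _).comp (tendsto_pi_nhds.2 fun a => (hx a h).1)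
      have t2 : ∀ a, Tendsto (fun j => Real.exp (p * (w a j x - lse p M fun a => w a j x))) atTop
          (𝓝 (Real.exp (p * (cst E μ * u a x - lse p M fun a => cst E μ * u a x)))) := fun a =>
        (Real.continuous_exp.tendsto _).comp ((((hx a h).1).sub t1).const_mul p)
      have t3 : Tendsto (fun j => L.err p M Λ (fun a => w a j) (fun a => G a j) φ x) atTop
        (𝓝 ((∑ a, Real.exp (p * (cst E μ * u a x - lse p M fun a => cst E μ * u a x)) *
          ∑ k, 0 * fderiv ℝ φ x (L.b k)) + φ x * p * ∑ a,
          Real.exp (p * (cst E μ * u a x - lse p M fun a => cst E μ * u a x)) * (Λ * ∑ k : ι, (0:ℝ) ^ 2))) := by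
        unfold err
        refine Tendsto.add (tendsto_finsetSum _ fun a _ => (t2 a).mul
          (tendsto_finsetSum _ fun k _ => ((hx a h).2 k).mul_const _)) (Tendsto.const_mul _
          (tendsto_finsetSum _ fun a _ => (t2 a).mul (Tendsto.const_mul _
          (tendsto_finsetSum _ fun k _ => ((hx a h).2 k).pow 2))))
      simpa using t3
    · simp [err, off1 x h, off2 x h]
  have lim2 := tendsto_integral_of_dominated_convergence B (fun j => (key j).1.aestronglyMeasurable) iB
    (fun j => Eventually.of_forall (bde j)) pte
  have lim3 := lim1.add lim2
  simp only [integral_zero, add_zero] at lim3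
  exact ge_of_tendsto' lim3 fun j => (key j).2.2

lemma max_sub {D : Set E} (hD : IsOpen D) (u : A → E → ℝ) (hu : ∀ a, L.Sub μ D (u a))
    (hu0 : ∀ a, ∀ x ∈ D, u a x ≤ 0) {φ : E → ℝ} (hφ : ContDiff ℝ (⊤ : ℕ∞) φ) (hφc : HasCompactSupport φ)
    (hφD : tsupport φ ⊆ D) (hφ0 : ∀ x, 0 ≤ φ x) {M : ℝ} (hM : 0 ≤ M) (m : E → ℝ)
    (h1 : ∀ x ∈ D, -M ≤ m x) (h2 : ∀ x ∈ D, ∀ a, u a x ≤ m x)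
    (h3 : ∀ x ∈ D, m x = -M ∨ ∃ a, m x = u a x) :
    0 ≤ ∫ x in D, m x * L.op φ x ∂μ := by
  have φ20 : ContDiff ℝ 2 φ := hφ.of_le (WithTop.coe_le_coe.2 le_top)
  have cop : Continuous (L.op φ) := L.op_cont φ φ20
  have iop := (cop.integrable_of_hasCompactSupport (L.op_cs φ hφc) (μ := μ))
  set c := cst E μ with hc
  have hc0 : 0 < c := cst_pos μ
  have e1 : ∫ x in D, m x * L.op φ x ∂μ = ∫ x, m x * L.op φ x ∂μ := by
    apply setIntegral_eq_integral_of_forall_compl_eq_zero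
    intro x hx
    rw [L.op_eq_zero φ x (fun h => hx (hφD h)), mul_zero]
  rw [e1]
  have hp : ∀ i : ℕ, (1 : ℝ) ≤ (i : ℝ) + 1 := fun i => by simp
  have H := fun i : ℕ => L.lse_lim μ hD u hu hu0 hφ hφc hφD hφ0 (hp i) (M := c * M) (by positivity)
  have est : ∀ (i : ℕ) x, |(lse ((i : ℝ) + 1) (c * M) fun a => c * u a x) * L.op φ x - c * (m x * L.op φ x)|
      ≤ ((i : ℝ) + 1)⁻¹ * (Real.log (1 + Fintype.card A) * |L.op φ x|) := by
    intro i x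
    by_cases h : x ∈ tsupport φ
    · have hx := hφD h
      have := lse_bounds (p := (i : ℝ) + 1) (by positivity) (M := c * M) (t := fun a => c * u a x)
        (m := c * m x) (by nlinarith [h1 x hx]) (fun a => mul_le_mul_of_nonneg_left (h2 x hx a) hc0.le)
        (by rcases h3 x hx with h | ⟨a, h⟩
            · left; rw [h]; ring
            · right; exact ⟨a, by rw [h]⟩)
      rw [← mul_assoc, ← sub_mul, abs_mul, ← mul_assoc]
      refine mul_le_mul_of_nonneg_right ?_ (abs_nonneg _)
      rw [abs_of_nonneg (by linarith)]
      linarith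
    · simp [L.op_eq_zero φ x h]
  have iB : Integrable (fun x => Real.log (1 + Fintype.card A) * |L.op φ x|) μ := iop.abs.const_mul _
  have t0 : Tendsto (fun i : ℕ => ((i : ℝ) + 1)⁻¹) atTop (𝓝 0) := by
    simpa using tendsto_one_div_add_atTop_nhds_zero_nat (𝕜 := ℝ)
  have ptl : ∀ x, Tendsto (fun i : ℕ => (lse ((i : ℝ) + 1) (c * M) fun a => c * u a x) * L.op φ x) atTop
      (𝓝 (c * (m x * L.op φ x))) := by
    intro x
    rw [tendsto_iff_norm_sub_tendsto_zero]
    refine squeeze_zero (fun _ => norm_nonneg _) (fun i => est i x) ?_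
    simpa using t0.mul_const (Real.log (1 + Fintype.card A) * |L.op φ x|)
  have mm : AEStronglyMeasurable (fun x => c * (m x * L.op φ x)) μ :=
    aestronglyMeasurable_of_tendsto_ae atTop (fun i => (H i).1.aestronglyMeasurable)
      (Eventually.of_forall ptl)
  have im : Integrable (fun x => c * (m x * L.op φ x)) μ := by
    refine Integrable.mono' ((H 0).1.abs.add iB) mm (Eventually.of_forall fun x => ?_)
    have := est 0 x
    simp only [Nat.cast_zero, zero_add, inv_one, one_mul] at this
    simp only [Pi.add_apply, Nat.cast_zero, zero_add]
    rw [Real.norm_eq_abs]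
    have t := abs_sub_abs_le_abs_sub (c * (m x * L.op φ x))
      ((lse 1 (c * M) fun a => c * u a x) * L.op φ x)
    rw [abs_sub_comm] at t
    linarith
  have le : ∀ i : ℕ, -(((i : ℝ) + 1)⁻¹ * ∫ x, Real.log (1 + Fintype.card A) * |L.op φ x| ∂μ) ≤
      ∫ x, c * (m x * L.op φ x) ∂μ := by
    intro i
    have a1 : ∫ x, (lse ((i : ℝ) + 1) (c * M) fun a => c * u a x) * L.op φ x ∂μ ≤
      ∫ x, (c * (m x * L.op φ x) + ((i : ℝ) + 1)⁻¹ * (Real.log (1 + Fintype.card A) * |L.op φ x|)) ∂μ := by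
      refine integral_mono (H i).1 (im.add (iB.const_mul _)) fun x => ?_
      have := (abs_le.1 (est i x)).2
      simp only
      linarith
    rw [integral_add im (iB.const_mul _), integral_const_mul (((i : ℝ) + 1)⁻¹)] at a1
    linarith [(H i).2]
  have fin : 0 ≤ ∫ x, c * (m x * L.op φ x) ∂μ := by
    have t := (t0.mul_const (∫ x, Real.log (1 + Fintype.card A) * |L.op φ x| ∂μ)).neg
    simp only [zero_mul, neg_zero] at t
    exact le_of_tendsto' t le
  rw [integral_const_mul] at fin
  exact nonneg_of_mul_nonneg_right fin hc0

end Ell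

namespace Ell

variable {n : ℕ} {E ι : Type} [NormedAddCommGroup E] [NormedSpace ℝ E]
  [FiniteDimensional ℝ E] [Fintype ι] [DecidableEq ι] [MeasurableSpace E] [BorelSpace E]
  (μ : Measure E) [μ.IsAddHaarMeasure]

/-- strongly upper semicontinuous subsolutions -/
structure SH (L : Ell n E ι) (D : Set E) (u : E → ℝ) : Prop where
  sub : L.Sub μ D u
  usc : UpperSemicontinuousOn u D
  str : ∀ z ∈ D, ∀ S : Set E, (∃ N ∈ 𝓝 z, μ (N \ S) = 0) → ∀ c : ℝ,
      (∀ᶠ y in 𝓝[S] z, u y ≤ c) → u z ≤ c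

variable (L : Ell n E ι)

/-- finite maxima -/
noncomputable def mx (u : ℕ → E → ℝ) (C : ℝ) : ℕ → E → ℝ
  | 0 => fun _ => -C
  | k + 1 => fun x => max (mx u C k x) (u k x)

lemma mx_ge (u : ℕ → E → ℝ) (C : ℝ) (k : ℕ) (x : E) : -C ≤ mx u C k x := by
  induction k with
  | zero => exact le_rfl
  | succ k ih => exact ih.trans (le_max_left _ _)

lemma mx_mono (u : ℕ → E → ℝ) (C : ℝ) (x : E) : Monotone fun k => mx u C k x :=
  monotone_nat_of_le_succ fun k => le_max_left _ _

lemma mx_u (u : ℕ → E → ℝ) (C : ℝ) {i k : ℕ} (h : i < k) (x : E) : u i x ≤ mx u C k x :=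
  (le_max_right _ _ : u i x ≤ mx u C (i + 1) x).trans (mx_mono u C x h)

lemma mx_eq (u : ℕ → E → ℝ) (C : ℝ) (k : ℕ) (x : E) :
    mx u C k x = -C ∨ ∃ a : Fin k, mx u C k x = u a x := by
  induction k with
  | zero => left; rfl
  | succ k ih =>
    rcases le_total (u k x) (mx u C k x) with h | h
    · have e : mx u C (k + 1) x = mx u C k x := max_eq_left h
      rcases ih with h1 | ⟨a, h1⟩
      · left; rw [e, h1]
      · right; exact ⟨a.castSucc, by rw [e, h1]; simp⟩
    · have e : mx u C (k + 1) x = u k x := max_eq_right h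
      right; exact ⟨Fin.last k, by rw [e]; simp⟩

lemma mx_le (u : ℕ → E → ℝ) {C : ℝ} (hC : 0 ≤ C) (k : ℕ) {x : E} (h : ∀ i, u i x ≤ 0) :
    mx u C k x ≤ 0 := by
  induction k with
  | zero => simp [mx, hC]
  | succ k ih => exact max_le ih (h k)

/-- countable supremum -/
noncomputable def Wk (D : Set E) (u : ℕ → E → ℝ) (C : ℝ) (x : E) : ℝ :=
  D.indicator (fun x => ⨆ k, mx u C k x) x

lemma Wk_tend {D : Set E} {u : ℕ → E → ℝ} {C : ℝ} (hC : 0 ≤ C) {x : E} (hx : x ∈ D) (h : ∀ i, u i x ≤ 0) :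
    Tendsto (fun k => mx u C k x) atTop (𝓝 (Wk D u C x)) := by
  have : Wk D u C x = ⨆ k, mx u C k x := by simp [Wk, hx]
  rw [this]
  exact tendsto_atTop_ciSup (mx_mono u C x) ⟨0, by rintro _ ⟨k, rfl⟩; exact mx_le u hC k h⟩

lemma mx_le_Wk {D : Set E} {u : ℕ → E → ℝ} {C : ℝ} (hC : 0 ≤ C) {x : E} (hx : x ∈ D) (h : ∀ i, u i x ≤ 0)
    (k : ℕ) : mx u C k x ≤ Wk D u C x :=
  (mx_mono u C x).ge_of_tendsto (Wk_tend hC hx h) k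

lemma Wk_le {D : Set E} {u : ℕ → E → ℝ} {C : ℝ} (hC : 0 ≤ C) {x : E} (hx : x ∈ D) (h : ∀ i, u i x ≤ 0)
    {t : ℝ} (h1 : -C ≤ t) (h2 : ∀ i, u i x ≤ t) : Wk D u C x ≤ t := by
  refine le_of_tendsto' (Wk_tend hC hx h) fun k => ?_
  rcases mx_eq u C k x with e | ⟨a, e⟩
  · rw [e]; exact h1
  · rw [e]; exact h2 a

lemma u_le_Wk {D : Set E} {u : ℕ → E → ℝ} {C : ℝ} (hC : 0 ≤ C) {x : E} (hx : x ∈ D) (h : ∀ i, u i x ≤ 0)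
    (i : ℕ) : u i x ≤ Wk D u C x :=
  (mx_u u C (Nat.lt_succ_self i) x).trans (mx_le_Wk hC hx h _)

lemma meas_ind {D : Set E} (hD : IsOpen D) {u : E → ℝ} (hu : UpperSemicontinuousOn u D) :
    Measurable (D.indicator u) := by
  apply measurable_of_Iio
  intro c
  have h1 : IsOpen {x | x ∈ D ∧ u x < c} := by
    rw [isOpen_iff_mem_nhds]
    rintro x ⟨hx, hc⟩
    have := hu x hx c hc
    rw [hD.nhdsWithin_eq hx] at this
    filter_upwards [this, hD.mem_nhds hx] with y h1 h2 using ⟨h2, h1⟩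
  have : D.indicator u ⁻¹' Set.Iio c = {x | x ∈ D ∧ u x < c} ∪ (Dᶜ ∩ {x | (0 : ℝ) < c}) := by
    ext x
    by_cases h : x ∈ D <;> simp [h]
  rw [this]
  exact h1.measurableSet.union (hD.measurableSet.compl.inter (MeasurableSet.const _))

lemma mx_usc {D : Set E} {u : ℕ → E → ℝ} (hu : ∀ i, UpperSemicontinuousOn (u i) D) (C : ℝ) (k : ℕ) :
    UpperSemicontinuousOn (mx u C k) D := by
  induction k with
  | zero => intro x hx c hc; exact Eventually.of_forall fun _ => hc
  | succ k ih =>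
    intro x hx c hc
    have hc' : max (mx u C k x) (u k x) < c := hc
    rw [max_lt_iff] at hc'
    filter_upwards [ih x hx c hc'.1, hu k x hx c hc'.2] with y h1 h2
    exact max_lt h1 h2

variable {D : Set E} {u : ℕ → E → ℝ} {C : ℝ}

lemma Wk_meas (hD : IsOpen D) (hC : 0 ≤ C) (hu : ∀ i, UpperSemicontinuousOn (u i) D)
    (h0 : ∀ i, ∀ x ∈ D, u i x ≤ 0) : Measurable (Wk D u C) := by
  refine measurable_of_tendsto_metrizable (f := fun k => D.indicator (mx u C k))
    (fun k => meas_ind hD (mx_usc hu C k)) (tendsto_pi_nhds.2 fun x => ?_)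
  by_cases h : x ∈ D
  · have := Wk_tend hC h (fun i => h0 i x h)
    simpa [h] using this
  · simp [h, Wk]

lemma Wk_abs (hC : 0 ≤ C) (h0 : ∀ i, ∀ x ∈ D, u i x ≤ 0) (x : E) : |Wk D u C x| ≤ C := by
  by_cases h : x ∈ D
  · rw [abs_le]
    refine ⟨(mx_ge u C 0 x).trans (mx_le_Wk hC h (fun i => h0 i x h) 0), ?_⟩
    exact Wk_le hC h (fun i => h0 i x h) (by linarith) fun i => (h0 i x h).trans hC
  · simp [Wk, h, hC]

lemma Wk_pos (hD : IsOpen D) (hC : 0 ≤ C) (hu : ∀ i, L.SH μ D (u i))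
    (h0 : ∀ i, ∀ x ∈ D, u i x ≤ 0) {φ : E → ℝ} (hφ : ContDiff ℝ (⊤ : ℕ∞) φ) (hφc : HasCompactSupport φ)
    (hφD : tsupport φ ⊆ D) (hφ0 : ∀ x, 0 ≤ φ x) : 0 ≤ ∫ x in D, Wk D u C x * L.op φ x ∂μ := by
  have φ20 : ContDiff ℝ 2 φ := hφ.of_le (WithTop.coe_le_coe.2 le_top)
  have cop : Continuous (L.op φ) := L.op_cont φ φ20
  have iop := (L.op_integrable μ φ φ20 hφc).abs.const_mul C
  have hk : ∀ k, 0 ≤ ∫ x in D, mx u C k x * L.op φ x ∂μ := fun k =>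
    L.max_sub μ hD (fun a : Fin k => u a) (fun a => (hu a).sub) (fun a => h0 a) hφ hφc hφD hφ0 hC
      (mx u C k) (fun x _ => mx_ge u C k x) (fun x _ a => mx_u u C a.2 x) fun x _ => mx_eq u C k x
  have lim : Tendsto (fun k => ∫ x in D, mx u C k x * L.op φ x ∂μ) atTop
      (𝓝 (∫ x in D, Wk D u C x * L.op φ x ∂μ)) := by
    refine tendsto_integral_of_dominated_convergence (fun x => C * |L.op φ x|) (fun k => ?_)
      iop.integrableOn (fun k => ?_) ?_
    · have m1 := (meas_ind hD (mx_usc (fun i => (hu i).usc) C k)).aestronglyMeasurable (μ := μ.restrict D)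
      refine ((m1.congr ?_).mul cop.aestronglyMeasurable)
      exact indicator_ae_eq_restrict hD.measurableSet
    · filter_upwards [ae_restrict_mem hD.measurableSet] with x hx
      rw [norm_mul, Real.norm_eq_abs, Real.norm_eq_abs]
      refine mul_le_mul_of_nonneg_right ?_ (abs_nonneg _)
      rw [abs_le]
      exact ⟨mx_ge u C k x, (mx_le u hC k fun i => h0 i x hx).trans hC⟩
    · filter_upwards [ae_restrict_mem hD.measurableSet] with x hx
      exact (Wk_tend hC hx fun i => h0 i x hx).mul_const _
  exact ge_of_tendsto' lim hk

variable {R K r0 r : ℝ} {z : E}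

lemma Wk_mean (hD : IsOpen D) (hC : 0 ≤ C) (hu : ∀ i, L.SH μ D (u i))
    (h0 : ∀ i, ∀ x ∈ D, u i x ≤ 0) (hB : L.Bd R K) (hK : L.KB R K r0) (hr : 0 < r) (hr0 : r ≤ r0)
    (hCr : K * r ≤ 1) (hz : ‖z‖ < R - 1) (hDz : closedBall z (2 * (K * r)) ⊆ D) :
    Wk D u C z * ∫ x, L.ker r z x ∂μ ≤ ∫ x, Wk D u C x * L.ker r z x ∂μ := by
  have hzD : z ∈ D := hDz (mem_closedBall_self (by have := hK.one; positivity))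
  have mW := Wk_meas hD hC (fun i => (hu i).usc) h0
  have aW := Wk_abs hC h0
  have kp := L.ker_pos μ hK hr hr0 hCr hz.le
  refine le_of_tendsto' ((Wk_tend hC hzD fun i => h0 i z hzD).mul_const _) fun k => ?_
  rcases mx_eq u C k z with e | ⟨a, e⟩
  · rw [e, ← integral_const_mul]
    refine integral_mono ((L.ker_int μ hK hr hr0 hCr hz.le).const_mul _)
      (L.ker_mul_int μ hK hr hr0 hCr hz.le _ mW C aW) fun x => ?_
    exact mul_le_mul_of_nonneg_right (abs_le.1 (aW x)).1 (L.ker_nonneg hK hr hr0 hCr hz.le x)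
  · rw [e]
    exact L.mean_all μ hD hB hK hr hr0 hCr hz hDz (hu a).sub ((hu a).str z hzD) _ mW C aW
      fun x hx => u_le_Wk hC hx (fun i => h0 i x hx) a

lemma star_mean (hD : IsOpen D) (hC : 0 ≤ C) (hu : ∀ i, L.SH μ D (u i))
    (h0 : ∀ i, ∀ x ∈ D, u i x ≤ 0) (hB : L.Bd R K) (hK : L.KB R K r0) (hr : 0 < r) (hr0 : r ≤ r0)
    (hCr : K * r ≤ 1) (hz : ‖z‖ < R - 1) (hDz : closedBall z (3 * (K * r)) ⊆ D) {s : ℝ}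
    (hs : ∀ c < s, ∃ᶠ y in 𝓝 z, c < Wk D u C y) :
    s * ∫ x, L.ker r z x ∂μ ≤ ∫ x, Wk D u C x * L.ker r z x ∂μ := by
  have mW := Wk_meas hD hC (fun i => (hu i).usc) h0
  have aW := Wk_abs hC h0
  have kp := L.ker_pos μ hK hr hr0 hCr hz.le
  have hKr : 0 < K * r := by have := hK.one; positivity
  by_contra! hlt
  set I := ∫ x, L.ker r z x ∂μ with hI
  set J := ∫ x, Wk D u C x * L.ker r z x ∂μ with hJ
  obtain ⟨c, hc1, hc2⟩ := exists_between ((div_lt_iff₀ kp).2 hlt)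
  rw [div_lt_iff₀ kp] at hc1
  have c1 := L.ker_cont μ hK hr hr0 hCr hz (Wk D u C) mW C aW
  have c2 := L.ker_cont μ hK hr hr0 hCr hz (fun _ => (1 : ℝ)) measurable_const 1 (fun _ => by simp)
  simp only [one_mul] at c2
  have c3 : ContinuousAt (fun z => c * ∫ x, L.ker r z x ∂μ) z := c2.const_mul c
  have ev1 := c1.eventually_lt c3 hc1
  have ev2 : ∀ᶠ y in 𝓝 z, ‖y‖ < R - 1 := continuous_norm.continuousAt.eventually_lt continuousAt_const hz
  have ev3 : ∀ᶠ y in 𝓝 z, y ∈ closedBall z (K * r) := closedBall_mem_nhds z hKr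
  obtain ⟨y, hy1, hy2, hy3, hy4⟩ := ((hs c hc2).and_eventually (ev1.and (ev2.and ev3))).exists
  have hy : closedBall y (2 * (K * r)) ⊆ D := by
    refine Set.Subset.trans (closedBall_subset_closedBall' ?_) hDz
    have : dist y z ≤ K * r := hy4
    linarith
  have m := L.Wk_mean μ hD hC hu h0 hB hK hr hr0 hCr hy3 hy
  have kp' := L.ker_pos μ hK hr hr0 hCr hy3.le
  nlinarith

theorem core (hD : IsOpen D) (hC : 0 ≤ C) (hR : ∀ z ∈ D, ‖z‖ < R - 1) (u : ℕ → ℕ → E → ℝ)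
    (hu : ∀ j i, L.SH μ D (u j i)) (h0 : ∀ j i, ∀ x ∈ D, u j i x ≤ 0)
    (hanti : ∀ j, ∀ x ∈ D, Wk D (u (j + 1)) C x ≤ Wk D (u j) C x)
    (s : ℕ → E → ℝ) (hs : ∀ j, UpperSemicontinuousOn (s j) D)
    (hWs : ∀ j, ∀ x ∈ D, Wk D (u j) C x ≤ s j x)
    (hsW : ∀ j, ∀ z ∈ D, ∀ c < s j z, ∃ᶠ y in 𝓝 z, c < Wk D (u j) C y)
    (v : E → ℝ) (hv : ∀ z ∈ D, Tendsto (fun j => s j z) atTop (𝓝 (v z)))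
    (hvs : ∀ j, ∀ z ∈ D, v z ≤ s j z) : L.SH μ D v := by
  obtain ⟨K, r0, hB, hK⟩ := L.exists_BK R
  have hK1 := hK.one
  set W : E → ℝ := fun x => ⨅ j, Wk D (u j) C x with hW
  have aj : ∀ j x, |Wk D (u j) C x| ≤ C := fun j => Wk_abs hC (h0 j)
  have mj : ∀ j, Measurable (Wk D (u j) C) := fun j => Wk_meas hD hC (fun i => (hu j i).usc) (h0 j)
  have anti : ∀ x, Antitone fun j => Wk D (u j) C x := by
    intro x
    refine antitone_nat_of_succ_le fun j => ?_
    by_cases h : x ∈ D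
    · exact hanti j x h
    · simp [Wk, h]
  have tW : ∀ x, Tendsto (fun j => Wk D (u j) C x) atTop (𝓝 (W x)) := fun x =>
    tendsto_atTop_ciInf (anti x) ⟨-C, by rintro _ ⟨j, rfl⟩; exact (abs_le.1 (aj j x)).1⟩
  have mW : Measurable W := measurable_of_tendsto_metrizable mj (tendsto_pi_nhds.2 tW)
  have aW : ∀ x, |W x| ≤ C := fun x => le_of_tendsto' (tW x).abs fun j => aj j x
  have Wv : ∀ x ∈ D, W x ≤ v x := fun x hx => le_of_tendsto_of_tendsto' (tW x) (hv x hx) fun j => hWs j x hx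
  -- mean inequality
  have mean : ∀ z ∈ D, ∃ r1 > 0, ∀ r, 0 < r → r ≤ r1 →
      v z * ∫ x, L.ker r z x ∂μ ≤ ∫ x, W x * L.ker r z x ∂μ := by
    intro z hz
    obtain ⟨δ, hδ, hb⟩ := Metric.nhds_basis_closedBall.mem_iff.1 (hD.mem_nhds hz)
    have hr0 := hK.r0pos
    refine ⟨min r0 (min K⁻¹ (δ / (3 * K))), by positivity, fun r hr hr1 => ?_⟩
    have a1 : r ≤ r0 := hr1.trans (min_le_left _ _)
    have a2 : K * r ≤ 1 := by
      have : r ≤ K⁻¹ := hr1.trans ((min_le_right _ _).trans (min_le_left _ _))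
      calc K * r ≤ K * K⁻¹ := by gcongr
        _ = 1 := by field_simp
    have a3 : 3 * (K * r) ≤ δ := by
      have : r ≤ δ / (3 * K) := hr1.trans ((min_le_right _ _).trans (min_le_right _ _))
      rw [le_div_iff₀ (by positivity)] at this
      linarith
    have hzR := hR z hz
    have kp := L.ker_pos μ hK hr a1 a2 hzR.le
    have lim : Tendsto (fun j => ∫ x, Wk D (u j) C x * L.ker r z x ∂μ) atTop
        (𝓝 (∫ x, W x * L.ker r z x ∂μ)) := by
      refine tendsto_integral_of_dominated_convergence (fun x => C * L.ker r z x)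
        (fun j => ((mj j).mul (L.measurable_ker r z)).aestronglyMeasurable)
        ((L.ker_int μ hK hr a1 a2 hzR.le).const_mul C) (fun j => Eventually.of_forall fun x => ?_)
        (Eventually.of_forall fun x => (tW x).mul_const _)
      have kn := L.ker_nonneg hK hr a1 a2 hzR.le x
      rw [norm_mul, Real.norm_eq_abs, Real.norm_eq_abs, abs_of_nonneg kn]
      exact mul_le_mul_of_nonneg_right (aj j x) kn
    refine ge_of_tendsto' lim fun j => ?_
    refine (mul_le_mul_of_nonneg_right (hvs j z hz) kp.le).trans ?_
    exact L.star_mean μ hD hC (hu j) (h0 j) hB hK hr a1 a2 hzR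
      ((closedBall_subset_closedBall a3).trans hb) (hsW j z hz)
  have hfin : μ D < ⊤ := by
    refine (measure_mono fun x hx => ?_).trans_lt (measure_ball_lt_top (x := (0 : E)) (r := R - 1))
    simpa using hR x hx
  have iW : IntegrableOn W D μ := by
    refine Measure.integrableOn_of_bounded (M := C) hfin.ne mW.aestronglyMeasurable ?_
    exact Eventually.of_forall aW
  have lW : LocallyIntegrable W μ := by
    intro x
    refine ⟨closedBall x 1, closedBall_mem_nhds x one_pos, ?_⟩
    exact Measure.integrableOn_of_bounded (M := C) (measure_closedBall_lt_top).ne mW.aestronglyMeasurable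
      (Eventually.of_forall aW)
  have ae1 : ∀ᵐ x ∂μ, x ∈ D → W x = v x := by
    filter_upwards [L.lebPt_ae μ lW] with x hx hxD
    obtain ⟨r1, hr1, hm⟩ := mean x hxD
    exact le_antisymm (Wv x hxD) (L.le_of_mean_leb μ hK (hR x hxD).le W mW C aW hx _ r1 hr1 hm)
  have ae2 : W =ᵐ[μ.restrict D] v := (ae_restrict_iff' hD.measurableSet).2 ae1
  refine ⟨⟨(show IntegrableOn v D μ from iW.congr ae2).locallyIntegrableOn, ?_⟩, ?_, ?_⟩
  · intro φ hφ hφc hφD hφ0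
    have φ20 : ContDiff ℝ 2 φ := hφ.of_le (WithTop.coe_le_coe.2 le_top)
    have cop : Continuous (L.op φ) := L.op_cont φ φ20
    have e : ∫ x in D, v x * L.op φ x ∂μ = ∫ x in D, W x * L.op φ x ∂μ := by
      refine integral_congr_ae ?_
      filter_upwards [ae2] with x hx
      rw [hx]
    rw [e]
    have lim : Tendsto (fun j => ∫ x in D, Wk D (u j) C x * L.op φ x ∂μ) atTop
        (𝓝 (∫ x in D, W x * L.op φ x ∂μ)) := by
      refine tendsto_integral_of_dominated_convergence (fun x => C * |L.op φ x|)
        (fun j => (((mj j).aestronglyMeasurable).mul cop.aestronglyMeasurable))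
        ((L.op_integrable μ φ φ20 hφc).abs.const_mul C).integrableOn
        (fun j => Eventually.of_forall fun x => ?_)
        (Eventually.of_forall fun x => (tW x).mul_const _)
      rw [norm_mul, Real.norm_eq_abs, Real.norm_eq_abs]
      exact mul_le_mul_of_nonneg_right (aj j x) (abs_nonneg _)
    exact ge_of_tendsto' lim fun j => L.Wk_pos μ hD hC (hu j) (h0 j) hφ hφc hφD hφ0
  · intro x hx c hc
    obtain ⟨j, hj⟩ := ((hv x hx).eventually_lt_const hc).exists
    filter_upwards [hs j x hx c hj, self_mem_nhdsWithin] with y hy hyD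
    exact (hvs j y hyD).trans_lt hy
  · intro z hz S hS c hc
    obtain ⟨r1, hr1, hm⟩ := mean z hz
    exact L.strong_of_mean μ hK (hR z hz).le W v mW C aW D hD hz Wv r1 hr1 hm S hS c hc

end Ell

namespace Ell

section
variable {E : Type} [TopologicalSpace E]

/-- upper envelope -/
noncomputable def om (F : Set (E → ℝ)) (z : E) : ℝ := sSup ((fun u : E → ℝ => u z) '' F)

/-- regularised upper envelope -/
noncomputable def st (F : Set (E → ℝ)) (z : E) : ℝ := limsup (om F) (𝓝 z)

variable {D : Set E} {F F' : Set (E → ℝ)} {C : ℝ}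

lemma le_om (h0 : ∀ u ∈ F, ∀ z ∈ D, u z ≤ 0) {u : E → ℝ} (hu : u ∈ F) {z : E} (hz : z ∈ D) :
    u z ≤ om F z :=
  le_csSup ⟨0, by rintro _ ⟨w, hw, rfl⟩; exact h0 w hw z hz⟩ ⟨u, hu, rfl⟩

lemma om_le {t : ℝ} {z : E} (hne : F.Nonempty) (h : ∀ u ∈ F, u z ≤ t) : om F z ≤ t :=
  csSup_le (hne.image _) (by rintro _ ⟨w, hw, rfl⟩; exact h w hw)

lemma lt_om {c : ℝ} {z : E} (hne : F.Nonempty) (h : c < om F z) : ∃ u ∈ F, c < u z := by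
  obtain ⟨_, ⟨u, hu, rfl⟩, h⟩ := exists_lt_of_lt_csSup (hne.image _) h
  exact ⟨u, hu, h⟩

variable (hD : IsOpen D) (h0 : ∀ u ∈ F, ∀ z ∈ D, u z ≤ 0) (hc : (fun _ => -C) ∈ F)
include hD h0 hc

lemma om_bdd {z : E} (hz : z ∈ D) : IsBoundedUnder (· ≤ ·) (𝓝 z) (om F) :=
  isBoundedUnder_of_eventually_le (a := 0) (by
    filter_upwards [hD.mem_nhds hz] with y hy
    exact om_le ⟨_, hc⟩ fun u hu => h0 u hu y hy)

lemma om_cobdd {z : E} (hz : z ∈ D) : IsCoboundedUnder (· ≤ ·) (𝓝 z) (om F) :=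
  (isBoundedUnder_of_eventually_ge (a := -C) (by
    filter_upwards [hD.mem_nhds hz] with y hy
    exact le_om h0 hc hy)).isCoboundedUnder_le

lemma om_le_st {z : E} (hz : z ∈ D) : om F z ≤ st F z := by
  refine le_limsup_of_frequently_le ?_ (om_bdd hD h0 hc hz)
  intro h
  exact h.self_of_nhds le_rfl

lemma st_le_of {z : E} (hz : z ∈ D) {t : ℝ} (h : ∀ᶠ y in 𝓝 z, om F y ≤ t) : st F z ≤ t :=
  limsup_le_of_le (om_cobdd hD h0 hc hz) h

lemma st_nonpos {z : E} (hz : z ∈ D) : st F z ≤ 0 :=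
  st_le_of hD h0 hc hz (by
    filter_upwards [hD.mem_nhds hz] with y hy
    exact om_le ⟨_, hc⟩ fun u hu => h0 u hu y hy)

lemma st_ge {z : E} (hz : z ∈ D) : -C ≤ st F z :=
  (le_om h0 hc hz).trans (om_le_st hD h0 hc hz)

lemma st_mono (h0' : ∀ u ∈ F', ∀ z ∈ D, u z ≤ 0) (hc' : (fun _ => -C) ∈ F') (hFF : F' ⊆ F)
    {z : E} (hz : z ∈ D) : st F' z ≤ st F z := by
  refine limsup_le_limsup ?_ (om_cobdd hD h0' hc' hz) (om_bdd hD h0 hc hz)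
  filter_upwards [hD.mem_nhds hz] with y hy
  exact om_le ⟨_, hc'⟩ fun u hu => le_om h0 (hFF hu) hy

lemma st_usc : UpperSemicontinuousOn (st F) D := by
  intro z hz c hcz
  obtain ⟨t, ht1, ht2⟩ := exists_between hcz
  have ev : ∀ᶠ y in 𝓝 z, om F y < t := eventually_lt_of_limsup_lt ht1 (om_bdd hD h0 hc hz)
  have := eventually_eventually_nhds.2 ev
  refine mem_nhdsWithin_of_mem_nhds ?_
  filter_upwards [this, hD.mem_nhds hz] with y hy hyD
  refine (st_le_of hD h0 hc hyD ?_).trans_lt ht2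
  filter_upwards [hy] with x hx using hx.le

lemma choquet [SecondCountableTopology E] : ∃ u : ℕ → E → ℝ, (∀ i, u i ∈ F) ∧
    ∀ z ∈ D, ∀ c < st F z, ∃ᶠ y in 𝓝 z, y ∈ D ∧ ∃ i, c < u i y := by
  classical
  obtain ⟨B, hBc, hB0, hB⟩ := TopologicalSpace.exists_countable_basis E
  have : Countable B := hBc.to_subtype
  have key : ∀ p : B × ℚ, ∃ u ∈ F, (∃ y ∈ (p.1 : Set E) ∩ D, (p.2 : ℝ) < om F y) →
      ∃ y ∈ (p.1 : Set E) ∩ D, (p.2 : ℝ) < u y := by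
    intro p
    by_cases h : ∃ y ∈ (p.1 : Set E) ∩ D, (p.2 : ℝ) < om F y
    · obtain ⟨y, hy, h1⟩ := h
      obtain ⟨u, hu, h2⟩ := lt_om ⟨_, hc⟩ h1
      exact ⟨u, hu, fun _ => ⟨y, hy, h2⟩⟩
    · exact ⟨_, hc, fun h' => absurd h' h⟩
  choose u hu hup using key
  by_cases hne : Nonempty (B × ℚ)
  · obtain ⟨e, he⟩ := exists_surjective_nat (B × ℚ)
    refine ⟨fun i => u (e i), fun i => hu _, fun z hz c hcz => ?_⟩
    obtain ⟨q, hq1, hq2⟩ := exists_rat_btwn hcz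
    have fr : ∃ᶠ y in 𝓝 z, (q : ℝ) < om F y := frequently_lt_of_lt_limsup (om_cobdd hD h0 hc hz) hq2
    rw [frequently_iff]
    intro N hN
    obtain ⟨V, hV, hzV, hVN⟩ := hB.mem_nhds_iff.1 (inter_mem hN (hD.mem_nhds hz))
    obtain ⟨y, hy1, hy2⟩ := (fr.and_eventually (hB.mem_nhds hV hzV)).exists
    obtain ⟨i, hi⟩ := he (⟨V, hV⟩, q)
    obtain ⟨x, hx, hxu⟩ := hup (⟨V, hV⟩, q) ⟨y, ⟨hy2, (hVN hy2).2⟩, hy1⟩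
    exact ⟨x, (hVN hx.1).1, hx.2, i, by simp only [hi]; exact hq1.trans hxu⟩
  · refine ⟨fun _ _ => -C, fun _ => hc, fun z hz c _ => ?_⟩
    exfalso
    obtain ⟨V, hV, hzV, -⟩ := hB.mem_nhds_iff.1 (hD.mem_nhds hz)
    exact hne ⟨⟨V, hV⟩, 0⟩

end

variable {n : ℕ} {E ι : Type} [NormedAddCommGroup E] [NormedSpace ℝ E]
  [FiniteDimensional ℝ E] [Fintype ι] [DecidableEq ι] [MeasurableSpace E] [BorelSpace E]
  (μ : Measure E) [μ.IsAddHaarMeasure]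

variable (L : Ell n E ι)

theorem core2 {D : Set E} {C : ℝ} (hD : IsOpen D) (hC : 0 ≤ C) (hb : Bornology.IsBounded D)
    (F : ℕ → Set (E → ℝ)) (hF : ∀ j, F (j + 1) ⊆ F j) (hSH : ∀ j, ∀ u ∈ F j, L.SH μ D u)
    (h0 : ∀ j, ∀ u ∈ F j, ∀ z ∈ D, u z ≤ 0) (hc : ∀ j, (fun _ => -C) ∈ F j) :
    ∃ v : E → ℝ, L.SH μ D v ∧ ∀ z ∈ D, Tendsto (fun j => st (F j) z) atTop (𝓝 (v z)) ∧
      ∀ j, v z ≤ st (F j) z := by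
  have : SecondCountableTopology E := by
    have := FiniteDimensional.proper_real E
    infer_instance
  obtain ⟨R0, hR0⟩ := hb.exists_norm_le
  have hch := fun j => choquet hD (h0 j) (hc j)
  choose u hu hust using hch
  have hFle : ∀ a b, a ≤ b → F b ⊆ F a := fun a b h => antitone_nat_of_succ_le (f := F) hF h
  set U : ℕ → ℕ → E → ℝ := fun j i => u (j + (Nat.unpair i).1) (Nat.unpair i).2 with hU
  have hUF : ∀ j i, U j i ∈ F j := fun j i => hFle j _ (Nat.le_add_right _ _) (hu _ _)
  have hU0 : ∀ j i, ∀ x ∈ D, U j i x ≤ 0 := fun j i => h0 j _ (hUF j i)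
  have hmono : ∀ z ∈ D, Antitone fun j => st (F j) z := fun z hz =>
    antitone_nat_of_succ_le fun j => st_mono hD (h0 j) (hc j) (h0 (j + 1)) (hc (j + 1)) (hF j) hz
  have hbb : ∀ z ∈ D, BddBelow (Set.range fun j => st (F j) z) := fun z hz =>
    ⟨-C, by rintro _ ⟨j, rfl⟩; exact st_ge hD (h0 j) (hc j) hz⟩
  have T : ∀ z ∈ D, Tendsto (fun j => st (F j) z) atTop (𝓝 (⨅ j, st (F j) z)) := fun z hz =>
    tendsto_atTop_ciInf (hmono z hz) (hbb z hz)
  refine ⟨fun z => ⨅ j, st (F j) z, ?_, fun z hz => ⟨T z hz, fun j => ciInf_le (hbb z hz) j⟩⟩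
  refine L.core μ (R := R0 + 2) hD hC (fun z hz => by linarith [hR0 z hz]) U
    (fun j i => hSH j _ (hUF j i)) hU0 ?_ (fun j => st (F j)) (fun j => st_usc hD (h0 j) (hc j)) ?_ ?_ _ T
    (fun j z hz => ciInf_le (hbb z hz) j)
  · intro j x hx
    refine Wk_le hC hx (fun i => hU0 _ i x hx) ?_ fun i => ?_
    · exact (mx_ge (U j) C 0 x).trans (mx_le_Wk hC hx (fun i => hU0 j i x hx) 0)
    · have := u_le_Wk hC hx (fun i => hU0 j i x hx) (Nat.pair ((Nat.unpair i).1 + 1) (Nat.unpair i).2)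
      simp only [hU, Nat.unpair_pair] at this
      refine le_trans (le_of_eq ?_) this
      simp only [hU]
      rw [show j + 1 + (Nat.unpair i).1 = j + ((Nat.unpair i).1 + 1) by ring]
  · intro j x hx
    refine Wk_le hC hx (fun i => hU0 _ i x hx) (st_ge hD (h0 j) (hc j) hx) fun i => ?_
    exact (le_om (h0 j) (hUF j i) hx).trans (om_le_st hD (h0 j) (hc j) hx)
  · intro j z hz c hcz
    refine (hust j z hz c hcz).mono ?_
    rintro y ⟨hy, i, hi⟩
    have := u_le_Wk hC hy (fun i => hU0 j i y hy) (Nat.pair 0 i)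
    simp only [hU, Nat.unpair_pair, add_zero] at this
    exact hi.trans_le this

end Ell

namespace Ell

/-- the real basis of `ℂⁿ` -/
noncomputable def bs (n : ℕ) : Module.Basis (Σ _ : Fin n, Fin 2) ℝ (Cn n) :=
  Pi.basis fun _ => Complex.basisOneI

lemma bs_zero {n : ℕ} (j : Fin n) : bs n ⟨j, 0⟩ = Pi.single j 1 := by
  unfold bs; rw [Pi.basis_apply]; simp

lemma bs_one {n : ℕ} (j : Fin n) : bs n ⟨j, 1⟩ = Pi.single j Complex.I := by
  unfold bs; rw [Pi.basis_apply]; simp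

/-- the weights `1, I` -/
noncomputable def ep : Fin 2 → ℂ := ![1, Complex.I]

/-- real coefficients -/
noncomputable def cf {n : ℕ} (A : AlphaForm n) (p q : Σ _ : Fin n, Fin 2) (z : Cn n) : ℝ :=
  (A.coeff q.1 p.1 z * (ep p.2 * starRingEnd ℂ (ep q.2) / 4)).re

lemma cf_contDiff {n : ℕ} (A : AlphaForm n) (p q : Σ _ : Fin n, Fin 2) : ContDiff ℝ 1 (cf A p q) :=
  Complex.reCLM.contDiff.comp ((A.contDiff q.1 p.1).mul contDiff_const)

lemma cf_fderiv {n : ℕ} (A : AlphaForm n) (p q : Σ _ : Fin n, Fin 2) (z v : Cn n) :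
    fderiv ℝ (cf A p q) z v =
      (fderiv ℝ (A.coeff q.1 p.1) z v * (ep p.2 * starRingEnd ℂ (ep q.2) / 4)).re := by
  have h1 : HasFDerivAt (A.coeff q.1 p.1) (fderiv ℝ (A.coeff q.1 p.1) z) z :=
    ((A.contDiff q.1 p.1).differentiable (by simp) z).hasFDerivAt
  have h2 := (h1.mul_const (ep p.2 * starRingEnd ℂ (ep q.2) / 4))
  have h3 := Complex.reCLM.hasFDerivAt.comp z h2
  have : HasFDerivAt (cf A p q) _ z := h3
  rw [this.fderiv]
  simp [mul_comm]

lemma cf_symm {n : ℕ} (A : AlphaForm n) (p q : Σ _ : Fin n, Fin 2) (z : Cn n) :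
    cf A p q z = cf A q p z := by
  unfold cf
  rw [A.hermitian q.1 p.1 z, ← Complex.conj_re]
  congr 1
  simp only [map_mul, map_div₀, Complex.conj_conj]
  rw [show (starRingEnd ℂ) 4 = 4 from Complex.conj_ofNat 4]
  ring

lemma cf_pos {n : ℕ} (A : AlphaForm n) (z : Cn n) (ξ : (Σ _ : Fin n, Fin 2) → ℝ) (hξ : ξ ≠ 0) :
    0 < ∑ p, ∑ q, cf A p q z * ξ p * ξ q := by
  set η : Fin n → ℂ := fun j => (ξ ⟨j, 0⟩ : ℂ) - Complex.I * ξ ⟨j, 1⟩ with hη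
  have h := A.strictlyPositive z η (by
    intro h
    apply hξ
    funext p
    have h1 := congrFun h p.1
    have h2 := congrArg Complex.re h1
    have h3 := congrArg Complex.im h1
    simp [hη] at h2 h3
    obtain ⟨j, a⟩ := p
    fin_cases a
    · exact h2
    · exact h3)
  have e : ∑ p, ∑ q, cf A p q z * ξ p * ξ q =
      (∑ j, ∑ k, A.coeff j k z * η j * starRingEnd ℂ (η k)).re / 4 := by
    rw [Finset.sum_comm]
    simp only [Fintype.sum_sigma, Fin.sum_univ_two, Complex.re_sum, Finset.sum_div]
    simp only [← Finset.sum_add_distrib]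
    refine Finset.sum_congr rfl fun j _ => Finset.sum_congr rfl fun k _ => ?_
    simp [cf, ep, hη, Complex.mul_re, Complex.mul_im, Complex.div_re, Complex.normSq]
    ring
  rw [e]
  linarith

lemma wdz_conj {n : ℕ} (k : Fin n) (f : Cn n → ℂ) (z : Cn n) (hf : DifferentiableAt ℝ f z) :
    wdz k (fun w => starRingEnd ℂ (f w)) z = starRingEnd ℂ (wdzbar k f z) := by
  have h : HasFDerivAt (fun w => starRingEnd ℂ (f w))
      ((Complex.conjCLE : ℂ →L[ℝ] ℂ).comp (fderiv ℝ f z)) z :=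
    (Complex.conjCLE : ℂ →L[ℝ] ℂ).hasFDerivAt.comp z hf.hasFDerivAt
  unfold wdz wdzbar
  rw [h.fderiv]
  simp only [map_div₀, map_add, map_mul, Complex.conj_I]
  rw [show (starRingEnd ℂ) 2 = 2 from Complex.conj_ofNat 2]
  simp
  ring

lemma closed' {n : ℕ} (A : AlphaForm n) (j : Fin n) (z : Cn n) :
    ∑ k, wdzbar k (A.coeff j k) z = 0 := by
  have h := A.closed j z
  have e : ∀ k, A.coeff k j = fun w => starRingEnd ℂ (A.coeff j k w) := fun k => by
    funext w; exact A.hermitian j k w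
  simp only [e] at h
  have h2 : ∑ k, wdz k (fun w => starRingEnd ℂ (A.coeff j k w)) z =
      starRingEnd ℂ (∑ k, wdzbar k (A.coeff j k) z) := by
    rw [map_sum]
    refine Finset.sum_congr rfl fun k _ => ?_
    exact wdz_conj k _ z ((A.contDiff j k).differentiable (by simp) z)
  rw [h2] at h
  exact (map_eq_zero (starRingEnd ℂ)).1 h

lemma cf_div {n : ℕ} (A : AlphaForm n) (q : Σ _ : Fin n, Fin 2) (z : Cn n) :
    ∑ p, fderiv ℝ (cf A p q) z (bs n p) = 0 := by
  have h := closed' A q.1 z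
  have e : ∑ p, fderiv ℝ (cf A p q) z (bs n p) =
      ((∑ k, wdzbar k (A.coeff q.1 k) z) * (starRingEnd ℂ (ep q.2) / 2)).re := by
    simp only [cf_fderiv, Fintype.sum_sigma, Fin.sum_univ_two, bs_zero, bs_one, Finset.sum_mul,
      Complex.re_sum]
    refine Finset.sum_congr rfl fun k _ => ?_
    rw [← Complex.add_re]
    congr 1
    simp [ep, wdzbar]
    ring
  rw [e, h]
  simp

/-- the real elliptic operator attached to `A` -/
noncomputable def ofA {n : ℕ} (hn : 1 ≤ n) (A : AlphaForm n) : Ell n (Cn n) (Σ _ : Fin n, Fin 2) where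
  b := bs n
  c := cf A
  hc := cf_contDiff A
  symm := cf_symm A
  pos := cf_pos A
  div := cf_div A
  card := by simp [mul_comm]
  hn := hn

lemma ofA_op {n : ℕ} (hn : 1 ≤ n) (A : AlphaForm n) {φ : Cn n → ℝ} (hφ : ContDiff ℝ (⊤ : ℕ∞) φ) (z : Cn n) :
    alphaOpR A φ z = (ofA hn A).op φ z := by
  have d1 : ∀ x v, fderiv ℝ (fun w => (φ w : ℂ)) x v = ((fderiv ℝ φ x v : ℝ) : ℂ) := by
    intro x v
    have h : HasFDerivAt (fun w => (φ w : ℂ)) (Complex.ofRealCLM.comp (fderiv ℝ φ x)) x :=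
      Complex.ofRealCLM.hasFDerivAt.comp x (hφ.differentiable (by simp) x).hasFDerivAt
    rw [h.fderiv]
    simp
  have d2 : ∀ j, wdz j (fun w => (φ w : ℂ)) = fun x =>
      (((fderiv ℝ φ x (bs n ⟨j, 0⟩) : ℝ) : ℂ) - Complex.I * ((fderiv ℝ φ x (bs n ⟨j, 1⟩) : ℝ) : ℂ)) / 2 := by
    intro j
    funext x
    simp [wdz, d1, bs_zero, bs_one]
  have d3 : ∀ j v, fderiv ℝ (wdz j (fun w => (φ w : ℂ))) z v =
      (((fderiv ℝ (fun x => fderiv ℝ φ x (bs n ⟨j, 0⟩)) z v : ℝ) : ℂ) -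
        Complex.I * ((fderiv ℝ (fun x => fderiv ℝ φ x (bs n ⟨j, 1⟩)) z v : ℝ) : ℂ)) / 2 := by
    intro j v
    rw [d2]
    have hd : ∀ e, HasFDerivAt (fun x => ((fderiv ℝ φ x e : ℝ) : ℂ))
        (Complex.ofRealCLM.comp (fderiv ℝ (fun x => fderiv ℝ φ x e) z)) z := fun e =>
      Complex.ofRealCLM.hasFDerivAt.comp z
        (((smooth_fd hφ e).differentiable (by simp)) z).hasFDerivAt
    have := ((hd (bs n ⟨j, 0⟩)).fun_sub ((hd (bs n ⟨j, 1⟩)).const_mul Complex.I)).mul_const ((2 : ℂ)⁻¹)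
    simp only [div_eq_mul_inv]
    rw [HasFDerivAt.fderiv this]
    simp
    ring
  unfold alphaOpR alphaOp op
  have hb : (ofA hn A).b = bs n := rfl
  have hcc : (ofA hn A).c = cf A := rfl
  rw [hb, hcc, Finset.sum_comm]
  simp only [wdzbar, d3, Fintype.sum_sigma, Fin.sum_univ_two, Complex.re_sum]
  rw [Finset.sum_comm]
  simp only [← Finset.sum_add_distrib]
  rw [Finset.sum_comm]
  refine Finset.sum_congr rfl fun k _ => ?_
  refine Finset.sum_congr rfl fun j _ => ?_
  simp only [bs_zero, bs_one]
  simp [cf, ep, Complex.mul_re, Complex.mul_im, Complex.div_re, Complex.div_im, Complex.normSq]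
  ring

end Ell

namespace Ell

lemma neBot_of_null {E : Type} [TopologicalSpace E] [MeasurableSpace E] (μ : Measure E)
    [μ.IsOpenPosMeasure] {z : E} {S : Set E} (h : ∃ N ∈ 𝓝 z, μ (N \ S) = 0) : (𝓝[S] z).NeBot := by
  obtain ⟨N, hN, h⟩ := h
  rw [← mem_closure_iff_nhdsWithin_neBot, mem_closure_iff_nhds]
  intro T hT
  by_contra hne
  have h1 : N ∩ T ⊆ N \ S := by
    intro x hx
    refine ⟨hx.1, fun hS => hne ⟨x, hx.2, hS⟩⟩
  have h2 : 0 < μ (N ∩ T) := μ.measure_pos_of_mem_nhds (inter_mem hN hT)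
  exact absurd (measure_mono_null h1 h) h2.ne'

lemma link {n : ℕ} (hn : 1 ≤ n) (A : AlphaForm n) {D : Set (Cn n)} (hD : IsOpen D) (u : Cn n → ℝ) :
    IsAlphaSubharmonic A D u ↔ (ofA hn A).SH volume D u := by
  have hop : ∀ ω : Cn n → ℝ, ContDiff ℝ (⊤ : ℕ∞) ω →
      ∫ z in D, (u z) * alphaOpR A ω z = ∫ z in D, u z * (ofA hn A).op ω z := by
    intro ω hω
    congr 1
    funext z
    rw [ofA_op hn A hω]
  constructor
  · rintro ⟨-, h2, h3, h4, h5⟩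
    simp only [EReal.toReal_coe] at h4 h5
    refine ⟨⟨h4, fun φ h6 h7 h8 h9 => ?_⟩, ?_, ?_⟩
    · rw [← hop φ h6]
      exact h5 φ h6 h7 h8 h9
    · intro z hz c hc
      have := h2 z hz (c : EReal) (EReal.coe_lt_coe_iff.2 hc)
      filter_upwards [this] with y hy
      exact_mod_cast hy
    · intro z hz S hS c hc
      have := h3 z hz S hS
      have h6 : limsup (fun z => (u z : EReal)) (𝓝[S] z) ≤ (c : EReal) :=
        limsup_le_of_le (by isBoundedDefault) (by
          filter_upwards [hc] with y hy
          exact_mod_cast hy)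
      rw [this] at h6
      exact EReal.coe_le_coe_iff.1 h6
  · rintro ⟨⟨h4, h5⟩, h2, h3⟩
    have h2' : UpperSemicontinuousOn (fun z => (u z : EReal)) D := by
      intro z hz c hc
      obtain ⟨t, ht1, ht2⟩ := EReal.exists_between_coe_real hc
      have := h2 z hz t (EReal.coe_lt_coe_iff.1 ht1)
      filter_upwards [this] with y hy
      exact lt_trans (by exact_mod_cast hy) ht2
    refine ⟨fun z _ => EReal.coe_ne_top _, h2', ?_, ?_, ?_⟩
    · intro z hz S hS
      apply le_antisymm
      · refine le_of_forall_gt_imp_ge_of_dense fun c hc => ?_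
        have := h2' z hz c hc
        rw [hD.nhdsWithin_eq hz] at this
        refine limsup_le_of_le (by isBoundedDefault) ?_
        filter_upwards [mem_nhdsWithin_of_mem_nhds this] with y hy
        exact le_of_lt hy
      · by_contra hlt
        rw [not_le] at hlt
        obtain ⟨t, ht1, ht2⟩ := EReal.exists_between_coe_real hlt
        have h6 := eventually_lt_of_limsup_lt ht1 (by isBoundedDefault)
        have := h3 z hz S hS t (by
          filter_upwards [h6] with y hy
          exact_mod_cast hy.le)
        exact absurd ht2 (not_lt.2 (EReal.coe_le_coe_iff.2 this))
    · simpa only [EReal.toReal_coe] using h4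
    · intro φ h6 h7 h8 h9
      simp only [EReal.toReal_coe]
      rw [hop φ h6]
      exact h5 φ h6 h7 h8 h9

lemma sh_sub_const {n : ℕ} {L : Ell n (Cn n) (Σ _ : Fin n, Fin 2)} {D : Set (Cn n)}
    (hD : IsOpen D) {u : Cn n → ℝ} (hu : L.SH volume D u) (ε : ℝ) :
    L.SH volume D (fun z => u z - ε) := by
  refine ⟨⟨?_, ?_⟩, ?_, ?_⟩
  · exact hu.sub.li.sub ((locallyIntegrable_const ε).locallyIntegrableOn D)
  · intro φ h1 h2 h3 h4
    have sm2 : ContDiff ℝ 2 φ := h1.of_le (by norm_cast)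
    have i1 := L.mul_op_integrable volume hD hu.sub.li φ sm2 h2 h3
    have i2 : IntegrableOn (fun x => ε * L.op φ x) D volume :=
      ((L.op_integrable volume φ sm2 h2).const_mul _).integrableOn
    have : ∫ x in D, (u x - ε) * L.op φ x =
        ∫ x in D, (u x * L.op φ x - ε * L.op φ x) := by
      congr 1; ext x; ring
    rw [this, integral_sub i1 i2, integral_const_mul, L.int_op_D volume φ sm2 h2 h3]
    simpa using hu.sub.pos φ h1 h2 h3 h4
  · intro z hz c hc
    have := hu.usc z hz (c + ε) (by simp only at hc; linarith)
    filter_upwards [this] with y hy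
    linarith
  · intro z hz S hS c hc
    have := hu.str z hz S hS (c + ε) (by
      filter_upwards [hc] with y hy
      linarith)
    linarith

lemma const_sub {n : ℕ} (A : AlphaForm n) {D : Set (Cn n)} (hD : IsOpen D) (c : ℝ) :
    IsAlphaSubharmonic A D (fun _ => c) := by
  refine ⟨fun z _ => EReal.coe_ne_top _, upperSemicontinuousOn_const, ?_, ?_, ?_⟩
  · intro z hz S hS
    have := neBot_of_null volume hS
    exact limsup_const _
  · exact (locallyIntegrable_const _).locallyIntegrableOn D
  · intro φ h1 h2 h3 h4
    simp only [EReal.toReal_coe]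
    rw [integral_const_mul]
    rcases Nat.eq_zero_or_pos n with h | hn
    · subst h
      simp [alphaOpR, alphaOp]
    · have : ∫ z in D, alphaOpR A φ z = ∫ z in D, (ofA hn A).op φ z := by
        congr 1
        funext z
        exact ofA_op hn A h1 z
      rw [this, (ofA hn A).int_op_D volume φ (h1.of_le (by norm_cast)) h2 h3]
      simp

theorem main {n : ℕ} (A : AlphaForm n)
    (D U : Set (Cn n)) (hD : IsAlphaRegularDomain A D) (hU : IsOpen U) (hUD : U ⊆ D)
    (K : ℕ → Set (Cn n)) 
    (hKmono : ∀ j, K j ⊆ interior (K (j + 1))) (hUnion : U = ⋃ j, K j)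
    (ψ : Cn n → ℝ) (hbd : ∃ C : ℝ, ∀ z ∈ U, |ψ z| ≤ C)
    (husc : UpperSemicontinuousOn ψ U) :
    ∀ z ∈ D,
      (∀ j, omegaWStar A (K (j + 1)) D ψ z ≤ omegaWStar A (K j) D ψ z) ∧
      Filter.Tendsto (fun j => omegaWStar A (K j) D ψ z) atTop
        (𝓝 (omegaWStar A U D ψ z)) := by
  obtain ⟨hDo, -, hDb, -⟩ := hD
  obtain ⟨C0, hC0⟩ := hbd
  set C : ℝ := max C0 1 with hC
  have hCpos : 0 < C := lt_of_lt_of_le one_pos (le_max_right _ _)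
  have hKU : ∀ j, K j ⊆ U := fun j => hUnion ▸ Set.subset_iUnion K j
  have hKK : ∀ j, K j ⊆ K (j + 1) := fun j => (hKmono j).trans interior_subset
  have h0 : ∀ E : Set (Cn n), ∀ u ∈ Uclass A E D ψ, ∀ z ∈ D, u z ≤ 0 :=
    fun E u hu z hz => (hu.2.2 z hz).le
  have hc : ∀ E : Set (Cn n), E ⊆ U → (fun _ => -C) ∈ Uclass A E D ψ := by
    intro E hE
    refine ⟨const_sub A hDo _, fun z hz => ?_, fun z hz => by simpa using hCpos⟩
    have := (abs_le.1 (hC0 z (hE hz))).1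
    have h2 : C0 ≤ C := le_max_left _ _
    simp only; linarith
  have hsub : ∀ E E' : Set (Cn n), E ⊆ E' → Uclass A E' D ψ ⊆ Uclass A E D ψ :=
    fun E E' h u hu => ⟨hu.1, fun z hz => hu.2.1 z (h hz), hu.2.2⟩
  have hmono : ∀ E E' : Set (Cn n), E ⊆ E' → E' ⊆ U → ∀ z ∈ D,
      st (Uclass A E' D ψ) z ≤ st (Uclass A E D ψ) z := fun E E' h h' z hz =>
    st_mono hDo (h0 E) (hc E (h.trans h')) (h0 E') (hc E' h') (hsub E E' h) hz
  have hst : ∀ E, omegaWStar A E D ψ = st (Uclass A E D ψ) := fun E => rfl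
  simp only [hst]
  intro z hz
  refine ⟨fun j => hmono _ _ (hKK j) (hKU _) z hz, ?_⟩
  rcases Nat.eq_zero_or_pos n with h | hn
  · subst h
    have hK' : ∀ᶠ j in atTop, K j = U := by
      rcases U.eq_empty_or_nonempty with h | ⟨x, hx⟩
      · exact Eventually.of_forall fun j => by
          rw [h]; exact Set.subset_eq_empty (hKU j) h
      · have hx' := hx
        rw [hUnion, Set.mem_iUnion] at hx'
        obtain ⟨j0, hj0⟩ := hx'
        filter_upwards [eventually_ge_atTop j0] with j hj
        have hm : Monotone K := monotone_nat_of_le_succ hKK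
        refine Set.Subset.antisymm (hKU j) fun y _ => ?_
        rw [Subsingleton.elim y x]
        exact hm hj hj0
    refine tendsto_const_nhds.congr' ?_
    filter_upwards [hK'] with j hj
    rw [hj]
  · obtain ⟨v, hv, hvt⟩ := (ofA hn A).core2 volume hDo hCpos.le hDb
      (fun j => Uclass A (K j) D ψ) (fun j => hsub _ _ (hKK j))
      (fun j u hu => (link hn A hDo u).1 hu.1) (fun j => h0 _) (fun j => hc _ (hKU j))
    have hvψ : ∀ x ∈ U, v x ≤ ψ x := by
      intro x hx
      have hx' := hx
      rw [hUnion, Set.mem_iUnion] at hx'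
      obtain ⟨j, hj⟩ := hx'
      refine ((hvt x (hUD hx)).2 (j + 1)).trans ?_
      refine le_of_forall_pos_le_add fun ε hε => ?_
      refine st_le_of hDo (h0 _) (hc _ (hKU (j + 1))) (hUD hx) ?_
      have h1 := husc x hx (ψ x + ε) (by linarith)
      rw [hU.nhdsWithin_eq hx] at h1
      filter_upwards [h1, mem_interior_iff_mem_nhds.1 (hKmono j hj)] with y hy hyK
      exact om_le ⟨_, hc _ (hKU (j + 1))⟩ fun u hu => (hu.2.1 y hyK).trans (le_of_lt hy)
    have hv0 : ∀ x ∈ D, v x ≤ 0 := fun x hx => ((hvt x hx).2 0).trans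
      (st_nonpos hDo (h0 _) (hc _ (hKU 0)) hx)
    have hmem : ∀ ε > 0, (fun x => v x - ε) ∈ Uclass A U D ψ := by
      intro ε hε
      refine ⟨(link hn A hDo _).2 (sh_sub_const hDo hv ε), fun x hx => ?_, fun x hx => ?_⟩
      · have := hvψ x hx
        simp only; linarith
      · have := hv0 x hx
        simp only; linarith
    have e : v z = st (Uclass A U D ψ) z := by
      apply le_antisymm
      · refine le_of_forall_pos_le_add fun ε hε => ?_
        have h1 := le_om (h0 U) (hmem ε hε) hz
        have h2 := om_le_st hDo (h0 U) (hc U subset_rfl) hz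
        linarith
      · exact ge_of_tendsto' (hvt z hz).1 fun j => hmono _ _ (hKU j) subset_rfl z hz
    rw [← e]
    exact (hvt z hz).1

end Ell

/-- If `U = ⋃ K_j ⊆ D` is open, with compacts `K_j ⊆ int K_{j+1}`, and
`ψ` is bounded and upper semicontinuous on `U` with `sup_U ψ < 0`, then
`ω*_α(·,K_j,D,ψ)` decreases pointwise on `D` to `ω*_α(·,U,D,ψ)`. -/
theorem weighted_measure_compact_exhaustion {n : ℕ} (A : AlphaForm n)
    (D U : Set (Cn n)) (hD : IsAlphaRegularDomain A D) (hU : IsOpen U) (hUD : U ⊆ D)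
    (K : ℕ → Set (Cn n)) (hKc : ∀ j, IsCompact (K j))
    (hKmono : ∀ j, K j ⊆ interior (K (j + 1))) (hUnion : U = ⋃ j, K j)
    (ψ : Cn n → ℝ) (hbd : ∃ C : ℝ, ∀ z ∈ U, |ψ z| ≤ C)
    (hsup : ∃ c < (0 : ℝ), ∀ z ∈ U, ψ z ≤ c) (husc : UpperSemicontinuousOn ψ U) :
    ∀ z ∈ D,
      (∀ j, omegaWStar A (K (j + 1)) D ψ z ≤ omegaWStar A (K j) D ψ z) ∧
      Filter.Tendsto (fun j => omegaWStar A (K j) D ψ z) atTop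
        (𝓝 (omegaWStar A U D ψ z)) := by
  exact Ell.main A D U hD hU hUD K hKmono hUnion ψ hbd husc
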